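/- Let F : K* → ℝ be of form (F) and let R : K* → V be of form (R) with admissible parameters and with Q = 0. Then there exist continuous functions φ : ℝ₊ × K* → ℝ₊ and ψ : ℝ₊ × K* → K* solving the generalized Riccati equations ∂_t φ(t,u) = F(ψ(t,u)), φ(0,u) = 0, and ∂_t ψ(t,u) = R(ψ(t,u)), ψ(0,u) = u, for all u ∈ K̊*, and a unique affine family of transition kernels (p_t(x,·)) on K whose associated functions are φ and ψ, i.e. ∫_K e^{−⟨u,ξ⟩} p_t(x,dξ) = e^{−φ(t,u) − ⟨ψ(t,u),x⟩} for all t ≥ 0, u ∈ K*, x ∈ K. -/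

import Mathlib

open MeasureTheory Filter Set
open scoped RealInnerProductSpace ENNReal Topology

variable {V : Type*} [NormedAddCommGroup V] [InnerProductSpace ℝ V] [FiniteDimensional ℝ V]
  [MeasurableSpace V] [BorelSpace V]

/-- The closed dual cone of a set `K`. -/
def dualCone (K : Set V) : Set V := {u | ∀ x ∈ K, 0 ≤ ⟪x, u⟫}

/-- `K` is a proper (pointed) generating closed convex cone. -/
structure IsProperConvexCone (K : Set V) : Prop where
  isClosed : IsClosed K
  convex : Convex ℝ K
  smul_mem : ∀ (c : ℝ), 0 ≤ c → ∀ x ∈ K, c • x ∈ K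
  proper : K ∩ (-K) = {0}
  generating : ∀ v : V, ∃ x ∈ K, ∃ y ∈ K, v = x - y

/-- An affine family of transition kernels on the cone `K`, with associated
functions `φ` and `ψ`. -/
structure AffineTransitionFamily (K : Set V) (φ : ℝ → V → ℝ) (ψ : ℝ → V → V) where
  p : ℝ → V → Measure V
  measurable_p : ∀ t : ℝ, 0 ≤ t → ∀ A : Set V, MeasurableSet A →
      Measurable fun x => p t x A
  subprob : ∀ t : ℝ, 0 ≤ t → ∀ x ∈ K, p t x Set.univ ≤ 1
  supported : ∀ t : ℝ, 0 ≤ t → ∀ x ∈ K, p t x Kᶜ = 0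
  init : ∀ x ∈ K, p 0 x = Measure.dirac x
  chapman : ∀ s t : ℝ, 0 ≤ s → 0 ≤ t → ∀ x ∈ K, ∀ A : Set V, MeasurableSet A →
      p (t + s) x A = ∫⁻ ξ, p t ξ A ∂(p s x)
  weakCont : ∀ x ∈ K, ∀ f : BoundedContinuousFunction V ℝ,
      ContinuousOn (fun s => ∫ ξ, f ξ ∂(p s x)) (Set.Ici (0 : ℝ))
  laplace : ∀ t : ℝ, 0 ≤ t → ∀ u ∈ dualCone K, ∀ x ∈ K,
      ∫ ξ, Real.exp (-⟪u, ξ⟫) ∂(p t x) = Real.exp (-(φ t u) - ⟪ψ t u, x⟫)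

/-- `χ` is a truncation function: continuous, bounded in norm by `1`, and equal to
the identity on a neighborhood of the origin. -/
def IsTruncation {V : Type*} [NormedAddCommGroup V] (χ : V → V) : Prop :=
  Continuous χ ∧ (∀ ξ : V, ‖χ ξ‖ ≤ 1) ∧ ∀ᶠ ξ in nhds (0 : V), χ ξ = ξ

/-- Parameters witnessing that `F` is of form (F). -/
structure FParams {V : Type*} [NormedAddCommGroup V] [InnerProductSpace ℝ V]
    [MeasurableSpace V] (K : Set V) (F : V → ℝ) where
  b : V
  b_mem : b ∈ K
  c : ℝ
  c_nonneg : 0 ≤ c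
  m : Measure V
  m_supp : m Kᶜ = 0
  m_zero : m {0} = 0
  m_int : (∫⁻ ξ, ENNReal.ofReal (min ‖ξ‖ 1) ∂m) < ⊤
  eq : ∀ u ∈ dualCone K, F u = ⟪b, u⟫ + c - ∫ ξ, (Real.exp (-⟪u, ξ⟫) - 1) ∂m

/-- Parameters witnessing that `R` is of form (R) relative to the truncation
function `χ`. -/
structure RParams {V : Type*} [NormedAddCommGroup V] [InnerProductSpace ℝ V]
    [MeasurableSpace V] (K : Set V) (χ : V → V) (R : V → V) where
  Q : V →ₗ[ℝ] V →ₗ[ℝ] V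
  Q_symm : ∀ u v : V, Q u v = Q v u
  Q_pos : ∀ v : V, Q v v ∈ dualCone K
  B : V →ₗ[ℝ] V
  γ : V
  γ_mem : γ ∈ dualCone K
  M : V → Measure V
  M_sigma : ∀ x ∈ K, SigmaFinite (M x)
  M_add : ∀ x ∈ K, ∀ y ∈ K, M (x + y) = M x + M y
  M_smul : ∀ (c : ℝ), 0 ≤ c → ∀ x ∈ K, M (c • x) = ENNReal.ofReal c • M x
  M_supp : ∀ x ∈ K, M x Kᶜ = 0
  M_zero : ∀ x ∈ K, M x {0} = 0
  M_int : ∀ x ∈ K, (∫⁻ ξ, ENNReal.ofReal (min (‖ξ‖ ^ 2) 1) ∂(M x)) < ⊤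
  eq : ∀ u ∈ dualCone K, ∀ x ∈ K,
    ⟪R u, x⟫ = -(1/2) * ⟪Q u u, x⟫ + ⟪B u, x⟫ + ⟪γ, x⟫
      - ∫ ξ, (Real.exp (-⟪u, ξ⟫) - 1 + ⟪χ ξ, u⟫) ∂(M x)

/-- The parameters of form (R) are admissible. -/
def RParams.Admissible {V : Type*} [NormedAddCommGroup V] [InnerProductSpace ℝ V]
    [MeasurableSpace V] {K : Set V} {χ : V → V} {R : V → V}
    (P : RParams K χ R) : Prop :=
  ∀ u ∈ dualCone K, ∀ x ∈ K, ⟪u, x⟫ = 0 →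
    (∀ v : V, ⟪P.Q u v, x⟫ = 0) ∧
    Integrable (fun ξ => ⟪χ ξ, u⟫) (P.M x) ∧
    0 ≤ ⟪P.B u, x⟫ - ∫ ξ, ⟪χ ξ, u⟫ ∂(P.M x)

set_option linter.all false

theorem mem_dual_iff {K : Set V} {u : V} : u ∈ dualCone K ↔ ∀ x ∈ K, 0 ≤ ⟪u, x⟫ := by
  simp only [dualCone, Set.mem_setOf_eq]
  constructor <;> intro h x hx <;> rw [real_inner_comm] <;> exact h x hx

theorem dual_add {K : Set V} {u v : V} (hu : u ∈ dualCone K) (hv : v ∈ dualCone K) :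
    u + v ∈ dualCone K := by
  rw [mem_dual_iff] at *
  intro x hx
  rw [inner_add_left]
  exact add_nonneg (hu x hx) (hv x hx)

theorem dual_smul {K : Set V} {u : V} {c : ℝ} (hc : 0 ≤ c) (hu : u ∈ dualCone K) :
    c • u ∈ dualCone K := by
  rw [mem_dual_iff] at *
  intro x hx
  rw [real_inner_smul_left]
  exact mul_nonneg hc (hu x hx)

theorem dual_zero {K : Set V} : (0:V) ∈ dualCone K := by
  rw [mem_dual_iff]; intro x hx; simp

theorem dual_closed {K : Set V} : IsClosed (dualCone K) := by
  have : dualCone K = ⋂ x ∈ K, {u : V | 0 ≤ ⟪x, u⟫} := by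
    ext u; simp [dualCone]
  rw [this]
  refine isClosed_biInter fun x _ => ?_
  exact isClosed_le continuous_const (by fun_prop)

namespace IsProperConvexCone
variable {K : Set V} (hK : IsProperConvexCone K)
include hK

theorem zero_mem : (0:V) ∈ K := by
  have : (0:V) ∈ K ∩ (-K) := by rw [hK.proper]; rfl
  exact this.1

theorem add_mem {x y : V} (hx : x ∈ K) (hy : y ∈ K) : x + y ∈ K := by
  have h := hK.convex hx hy (by norm_num : (0:ℝ) ≤ 1/2) (by norm_num : (0:ℝ) ≤ 1/2) (by norm_num)
  have := hK.smul_mem 2 (by norm_num) _ h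
  rw [smul_add, smul_smul, smul_smul] at this
  norm_num at this
  exact this

theorem bidual {x : V} (h : ∀ u ∈ dualCone K, 0 ≤ ⟪u, x⟫) : x ∈ K := by
  by_contra hx
  obtain ⟨f, a, h1, h2⟩ := geometric_hahn_banach_point_closed hK.convex hK.isClosed hx
  have h0 := h2 0 hK.zero_mem
  rw [map_zero] at h0
  have hf : ∀ b ∈ K, 0 ≤ f b := by
    intro b hb
    by_contra hlt
    push Not at hlt
    have := h2 _ (hK.smul_mem (a / f b) (div_nonneg_of_nonpos h0.le hlt.le) b hb)
    rw [map_smul, smul_eq_mul, div_mul_cancel₀ _ hlt.ne] at this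
    exact lt_irrefl _ this
  obtain ⟨w, hw⟩ := (InnerProductSpace.toDual ℝ V).surjective f
  have hw' : ∀ z, ⟪w, z⟫ = f z := fun z => by rw [← hw]; simp
  have := h w (mem_dual_iff.2 fun b hb => by rw [hw']; exact hf b hb)
  rw [hw'] at this
  linarith

theorem exists_e : ∃ (e : V) (c : ℝ), 0 < c ∧ ∀ x ∈ K, c * ‖x‖ ≤ ⟪e, x⟫ := by
  have hcomp : IsCompact (K ∩ Metric.sphere 0 1) :=
    (isCompact_sphere 0 1).inter_left hK.isClosed
  have h1 : ∀ x ∈ K ∩ Metric.sphere 0 1, ∃ u ∈ dualCone K, 0 < ⟪u, x⟫ := by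
    rintro x ⟨hx, hx1⟩
    by_contra hcon
    push Not at hcon
    have : -x ∈ K := hK.bidual fun u hu => by
      rw [inner_neg_right]; linarith [hcon u hu]
    have : x ∈ K ∩ (-K) := ⟨hx, this⟩
    rw [hK.proper] at this
    rw [Set.mem_singleton_iff.1 this] at hx1
    simp at hx1
  obtain ⟨t, ht⟩ := hcomp.elim_finite_subcover
    (fun u : dualCone K => {x : V | 0 < ⟪(u : V), x⟫})
    (fun u => isOpen_lt continuous_const (by fun_prop))
    (fun x hx => by
      obtain ⟨u, hu, h⟩ := h1 x hx
      exact Set.mem_iUnion.2 ⟨⟨u, hu⟩, h⟩)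
  set e : V := ∑ u ∈ t, (u : V) with he
  have hpos : ∀ x ∈ K ∩ Metric.sphere 0 1, 0 < ⟪e, x⟫ := by
    intro x hx
    obtain ⟨u, hu, hux⟩ := Set.mem_iUnion₂.1 (ht hx)
    rw [he, sum_inner]
    exact Finset.sum_pos' (fun i _ => mem_dual_iff.1 i.2 x hx.1) ⟨u, hu, hux⟩
  obtain ⟨c, hc, hce⟩ : ∃ c > 0, ∀ x ∈ K ∩ Metric.sphere 0 1, c ≤ ⟪e, x⟫ := by
    rcases (K ∩ Metric.sphere (0:V) 1).eq_empty_or_nonempty with h | h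
    · exact ⟨1, one_pos, by simp [h]⟩
    · obtain ⟨x, hx, hm⟩ := hcomp.exists_isMinOn h
        (f := fun x => ⟪e, x⟫) (by fun_prop)
      exact ⟨_, hpos x hx, fun y hy => hm hy⟩
  refine ⟨e, c, hc, fun x hx => ?_⟩
  by_cases hx0 : x = 0
  · simp [hx0]
  have hn : 0 < ‖x‖ := norm_pos_iff.2 hx0
  have := hce (‖x‖⁻¹ • x) ⟨hK.smul_mem _ (by positivity) x hx, by
    simp [norm_smul, hn.ne']⟩
  rw [real_inner_smul_right] at this
  have h4 : c * ‖x‖ ≤ ‖x‖⁻¹ * ⟪e, x⟫ * ‖x‖ := mul_le_mul_of_nonneg_right this hn.le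
  have h5 : ‖x‖⁻¹ * ⟪e, x⟫ * ‖x‖ = ⟪e, x⟫ := by field_simp
  linarith

omit hK in
theorem mem_int_iff {u : V} :
    u ∈ interior (dualCone K) ↔ ∃ c > 0, ∀ x ∈ K, c * ‖x‖ ≤ ⟪u, x⟫ := by
  constructor
  · intro h
    obtain ⟨ε, hε, hb⟩ := Metric.mem_nhds_iff.1 (mem_interior_iff_mem_nhds.1 h)
    refine ⟨ε/2, by positivity, fun x hx => ?_⟩
    by_cases hx0 : x = 0
    · simp [hx0]
    have hn : 0 < ‖x‖ := norm_pos_iff.2 hx0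
    have : u - (ε/2 * ‖x‖⁻¹) • x ∈ dualCone K := hb (by
      simp [norm_smul, abs_of_pos hε, hn.ne']
      linarith)
    have := mem_dual_iff.1 this x hx
    rw [inner_sub_left, real_inner_smul_left, real_inner_self_eq_norm_sq] at this
    have e1 : ε/2 * ‖x‖⁻¹ * ‖x‖^2 = ε/2*‖x‖ := by field_simp
    linarith
  · rintro ⟨c, hc, h⟩
    refine mem_interior_iff_mem_nhds.2 (Metric.mem_nhds_iff.2 ⟨c, hc, fun v hv => ?_⟩)
    rw [mem_dual_iff]
    intro x hx
    have h1 := h x hx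
    have h2 : |⟪v - u, x⟫| ≤ ‖v - u‖ * ‖x‖ := abs_real_inner_le_norm _ _
    have h3 : ‖v - u‖ < c := by simpa [dist_eq_norm] using hv
    rw [inner_sub_left] at h2
    have := abs_le.1 h2
    nlinarith [norm_nonneg x]

theorem exists_ext {W : Type*} [AddCommGroup W] [Module ℝ W] (f : V → W)
    (hadd : ∀ x ∈ K, ∀ y ∈ K, f (x + y) = f x + f y)
    (hsmul : ∀ c : ℝ, 0 ≤ c → ∀ x ∈ K, f (c • x) = c • f x) :
    ∃ L : V →ₗ[ℝ] W, ∀ x ∈ K, L x = f x := by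
  choose p hp q hq hpq using hK.generating
  have wd : ∀ x ∈ K, ∀ y ∈ K, ∀ z, z = x - y → f (p z) - f (q z) = f x - f y := by
    intro x hx y hy z hz
    have e1 : p z + y = x + q z := by
      have := hpq z
      rw [hz] at this
      rw [hz]
      rw [sub_eq_sub_iff_add_eq_add] at this
      rw [this]
    have e2 := congrArg f e1
    rw [hadd _ (hp z) _ hy, hadd _ hx _ (hq z)] at e2
    rw [sub_eq_sub_iff_add_eq_add]
    rw [e2]
  refine ⟨{ toFun := fun z => f (p z) - f (q z), map_add' := ?_, map_smul' := ?_ }, ?_⟩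
  · intro z w
    rw [wd _ (hK.add_mem (hp z) (hp w)) _ (hK.add_mem (hq z) (hq w)) (z + w), 
      hadd _ (hp z) _ (hp w), hadd _ (hq z) _ (hq w)]
    · abel
    · conv_lhs => rw [hpq z, hpq w]
      abel
  · intro c z
    simp only [RingHom.id_apply]
    rcases le_total 0 c with hc | hc
    · rw [wd _ (hK.smul_mem c hc _ (hp z)) _ (hK.smul_mem c hc _ (hq z)) (c • z),
        hsmul c hc _ (hp z), hsmul c hc _ (hq z), smul_sub]
      conv_lhs => rw [hpq z]
      rw [smul_sub]
    · have hc' : 0 ≤ -c := by linarith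
      rw [wd _ (hK.smul_mem (-c) hc' _ (hq z)) _ (hK.smul_mem (-c) hc' _ (hp z)) (c • z),
        hsmul _ hc' _ (hp z), hsmul _ hc' _ (hq z), smul_sub]
      · simp only [neg_smul]; abel
      · conv_lhs => rw [hpq z]
        rw [smul_sub]; simp only [neg_smul]; abel
  · intro x hx
    show f (p x) - f (q x) = f x
    have h0 : f 0 = 0 := by
      have := hsmul 0 le_rfl 0 hK.zero_mem
      simpa using this
    rw [wd x hx 0 hK.zero_mem x (by simp), h0, sub_zero]

theorem exists_frame : ∃ (n : ℕ) (x y : Fin n → V), (∀ i, x i ∈ K) ∧ (∀ i, y i ∈ K) ∧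
    (∀ v : V, ‖v‖ ≤ ∑ i, (|⟪v, x i⟫| + |⟪v, y i⟫|)) := by
  let b := stdOrthonormalBasis ℝ V
  choose p hp q hq hpq using hK.generating
  refine ⟨_, fun i => p (b i), fun i => q (b i), fun i => hp _, fun i => hq _, fun v => ?_⟩
  conv_lhs => rw [← b.sum_repr' v]
  refine (norm_sum_le _ _).trans (Finset.sum_le_sum fun i _ => ?_)
  rw [norm_smul, b.orthonormal.1 i, mul_one, Real.norm_eq_abs, real_inner_comm]
  conv_lhs => rw [hpq (b i)]
  rw [inner_sub_right]
  exact abs_sub _ _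

theorem exists_normbd : ∃ C : ℝ, 0 < C ∧ ∀ (v : V) (a : ℝ), 0 ≤ a → (∀ x ∈ K, |⟪v, x⟫| ≤ a * ‖x‖) →
    ‖v‖ ≤ C * a := by
  obtain ⟨n, x, y, hx, hy, h⟩ := hK.exists_frame
  refine ⟨∑ i, (‖x i‖ + ‖y i‖) + 1, by positivity, fun v a ha hv => ?_⟩
  calc ‖v‖ ≤ ∑ i, (|⟪v, x i⟫| + |⟪v, y i⟫|) := h v
    _ ≤ ∑ i, (‖x i‖ + ‖y i‖) * a := by
        refine Finset.sum_le_sum fun i _ => ?_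
        have h1 := hv _ (hx i)
        have h2 := hv _ (hy i)
        linarith
    _ = (∑ i, (‖x i‖ + ‖y i‖)) * a := by rw [Finset.sum_mul]
    _ ≤ _ := by nlinarith

end IsProperConvexCone

/-- sub-probability measures carried by `K` -/
def SP (K : Set V) (μ : Measure V) : Prop := μ Set.univ ≤ 1 ∧ μ Kᶜ = 0

/-- Laplace transform -/
noncomputable def LapT (μ : Measure V) (u : V) : ℝ := ∫ ξ, Real.exp (-⟪u, ξ⟫) ∂μ

/-- cutoff -/
noncomputable def cutf (r : ℝ) (ξ : V) : ℝ := max 0 (min 1 (r + 1 - ‖ξ‖))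

theorem cutf_cont (r : ℝ) : Continuous (cutf r : V → ℝ) := by
  unfold cutf; fun_prop

theorem cutf_nonneg (r : ℝ) (ξ : V) : 0 ≤ cutf r ξ := le_max_left _ _

theorem cutf_le_one (r : ℝ) (ξ : V) : cutf r ξ ≤ 1 := 
  max_le zero_le_one (min_le_left _ _)

theorem cutf_eq_one {r : ℝ} {ξ : V} (h : ‖ξ‖ ≤ r) : cutf r ξ = 1 := by
  unfold cutf
  rw [min_eq_left (by linarith)]; simp

theorem cutf_eq_zero {r : ℝ} {ξ : V} (h : r + 1 < ‖ξ‖) : cutf r ξ = 0 := by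
  unfold cutf
  exact max_eq_left ((min_le_right _ _).trans (by linarith))

section SPsec
variable {K : Set V} {μ : Measure V}

theorem SP.fin (h : SP K μ) : IsFiniteMeasure μ := ⟨h.1.trans_lt ENNReal.one_lt_top⟩

theorem SP.ae (h : SP K μ) : ∀ᵐ ξ ∂μ, ξ ∈ K := by
  rw [ae_iff]; exact h.2

theorem SP.real_le (h : SP K μ) : μ.real Set.univ ≤ 1 :=
  ENNReal.toReal_le_of_le_ofReal zero_le_one (by simpa using h.1)

theorem SP.int_exp (h : SP K μ) {u : V} (hu : u ∈ dualCone K) :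
    Integrable (fun ξ => Real.exp (-⟪u, ξ⟫)) μ := by
  have := h.fin
  refine Integrable.of_bound (by fun_prop) 1 ?_
  filter_upwards [h.ae] with ξ hξ
  rw [Real.norm_eq_abs, Real.abs_exp]
  exact Real.exp_le_one_iff.2 (by linarith [mem_dual_iff.1 hu ξ hξ])

theorem SP.int_bdd (h : SP K μ) {f : V → ℝ} (hf : Continuous f) {C : ℝ} (hC : ∀ ξ, |f ξ| ≤ C) :
    Integrable f μ := by
  have := h.fin
  exact Integrable.of_bound hf.aestronglyMeasurable C (Eventually.of_forall hC)

theorem LapT_nonneg (u : V) : 0 ≤ LapT μ u := integral_nonneg fun _ => (Real.exp_pos _).le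

theorem SP.LT_le_one (h : SP K μ) {u : V} (hu : u ∈ dualCone K) : LapT μ u ≤ 1 := by
  have := h.fin
  calc LapT μ u ≤ ∫ ξ, (1:ℝ) ∂μ := by
        refine integral_mono_ae (h.int_exp hu) (integrable_const _) ?_
        filter_upwards [h.ae] with ξ hξ
        exact Real.exp_le_one_iff.2 (by linarith [mem_dual_iff.1 hu ξ hξ])
    _ ≤ 1 := by simpa using h.real_le

theorem SP.LT_cut (h : SP K μ) {u : V} {c : ℝ} (hc : 0 < c) (hu : ∀ x ∈ K, c * ‖x‖ ≤ ⟪u, x⟫)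
    {r : ℝ} (hr : 0 ≤ r) :
    |LapT μ u - ∫ ξ, cutf r ξ * Real.exp (-⟪u, ξ⟫) ∂μ| ≤ Real.exp (-(c * r)) := by
  have := h.fin
  have hud : u ∈ dualCone K := mem_dual_iff.2 fun x hx => 
    le_trans (by positivity) (hu x hx)
  have hi2 : Integrable (fun ξ => cutf r ξ * Real.exp (-⟪u, ξ⟫)) μ := by
    refine (h.int_exp hud).mono (by have := cutf_cont (V := V) r; fun_prop) ?_
    refine Eventually.of_forall fun ξ => ?_
    rw [norm_mul]
    have : ‖cutf r ξ‖ ≤ 1 := by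
      rw [Real.norm_eq_abs, abs_of_nonneg (cutf_nonneg r ξ)]; exact cutf_le_one r ξ
    nlinarith [norm_nonneg (Real.exp (-⟪u, ξ⟫))]
  unfold LapT
  rw [← integral_sub (h.int_exp hud) hi2]
  refine (norm_integral_le_of_norm_le_const (μ := μ) 
    (f := fun ξ => Real.exp (-⟪u, ξ⟫) - cutf r ξ * Real.exp (-⟪u, ξ⟫))
    (C := Real.exp (-(c*r))) ?_).trans ?_
  · filter_upwards [h.ae] with ξ hξ
    rcases le_or_gt ‖ξ‖ r with h1 | h1
    · rw [cutf_eq_one h1]; simp; positivity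
    · have e1 : Real.exp (-⟪u, ξ⟫) - cutf r ξ * Real.exp (-⟪u, ξ⟫) 
          = (1 - cutf r ξ) * Real.exp (-⟪u, ξ⟫) := by ring
      rw [e1, Real.norm_eq_abs, abs_of_nonneg (mul_nonneg (by linarith [cutf_le_one r ξ])
        (Real.exp_pos _).le)]
      have h2 : Real.exp (-⟪u, ξ⟫) ≤ Real.exp (-(c*r)) := by
        apply Real.exp_le_exp.2
        have := hu ξ hξ
        nlinarith
      nlinarith [cutf_nonneg r ξ, Real.exp_pos (-⟪u, ξ⟫), cutf_le_one r ξ]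
  · have := h.real_le
    nlinarith [Real.exp_pos (-(c*r))]

end SPsec

theorem compactness {K : Set V} (hK : IsProperConvexCone K) {ι : Type*} (U : Ultrafilter ι)
    (μ : ι → Measure V) (hμ : ∀ i, SP K (μ i)) :
    ∃ μ' : Measure V, SP K μ' ∧
      (∀ f : V → ℝ, Continuous f → (∃ r, ∀ ξ, r < ‖ξ‖ → f ξ = 0) →
        Tendsto (fun i => ∫ ξ, f ξ ∂(μ i)) U (𝓝 (∫ ξ, f ξ ∂μ'))) ∧
      (∀ u ∈ interior (dualCone K), Tendsto (fun i => LapT (μ i) u) U (𝓝 (LapT μ' u))) := by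
  have := fun i => (hμ i).fin
  set w : V → NNReal := fun ξ => Real.toNNReal (Real.exp (-‖ξ‖)) with hw
  set w' : V → NNReal := fun ξ => Real.toNNReal (Real.exp (‖ξ‖)) with hw'
  have hwm : Measurable w := by fun_prop
  have hwm' : Measurable w' := by fun_prop
  have hw1 : ∀ ξ, (w ξ : ENNReal) ≤ 1 := by
    intro ξ
    rw [ENNReal.coe_le_one_iff, hw, Real.toNNReal_le_one]
    exact Real.exp_le_one_iff.2 (by simp)
  set νm : ι → Measure V := fun i => (μ i).withDensity (fun ξ => (w ξ : ENNReal)) with hνm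
  have hfin : ∀ i, IsFiniteMeasure (νm i) := fun i => by
    refine isFiniteMeasure_withDensity ?_
    exact ((lintegral_mono hw1).trans_lt (by simp)).ne
  set ν : ι → FiniteMeasure V := fun i => ⟨νm i, hfin i⟩ with hν
  have hcompl : ∀ i (n : ℕ), νm i (Metric.closedBall 0 n)ᶜ ≤ ENNReal.ofReal (Real.exp (-n)) := by
    intro i n
    rw [hνm, withDensity_apply _ Metric.isClosed_closedBall.measurableSet.compl]
    calc ∫⁻ ξ in (Metric.closedBall 0 n)ᶜ, (w ξ : ENNReal) ∂(μ i) 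
        ≤ ∫⁻ ξ in (Metric.closedBall 0 n)ᶜ, ENNReal.ofReal (Real.exp (-n)) ∂(μ i) := by
          refine setLIntegral_mono (by fun_prop) fun ξ hξ => ?_
          simp at hξ
          rw [hw]
          refine ENNReal.ofReal_le_ofReal (Real.exp_le_exp.2 (by linarith))
      _ ≤ ENNReal.ofReal (Real.exp (-n)) * 1 := by
          rw [setLIntegral_const]
          gcongr
          exact (measure_mono (Set.subset_univ _)).trans (hμ i).1
      _ = _ := mul_one _
  have hcomp := isCompact_setOfPred_finiteMeasure_mass_le_compl_isCompact_le (E := V) 1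
    (u := fun n : ℕ => Real.toNNReal (Real.exp (-n))) (K := fun n : ℕ => Metric.closedBall 0 n)
    (by
      have : Tendsto (fun n : ℕ => Real.exp (-n)) atTop (𝓝 0) :=
        Real.tendsto_exp_neg_atTop_nhds_zero.comp tendsto_natCast_atTop_atTop
      have h2 := (continuous_real_toNNReal.tendsto 0).comp this
      rw [Real.toNNReal_zero] at h2
      exact h2)
    (fun n => isCompact_closedBall _ _) (Or.inl inferInstance)
  obtain ⟨ν', hν'mem, hν' : Tendsto _ _ _⟩ := hcomp.ultrafilter_le_nhds (U.map ν) (by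
    simp only [Ultrafilter.coe_map, le_principal_iff, Filter.mem_map]
    refine Filter.Eventually.of_forall fun i => ⟨?_, fun n => ?_⟩
    · have : (νm i Set.univ) ≤ 1 := by
        rw [hνm, withDensity_apply _ MeasurableSet.univ, Measure.restrict_univ]
        exact (lintegral_mono hw1).trans (by simpa using (hμ i).1)
      rw [FiniteMeasure.mass, ← ENNReal.coe_le_coe]
      simpa [hν] using this
    · rw [← ENNReal.coe_le_coe]
      have h2 := hcompl i n
      rw [FiniteMeasure.ennreal_coeFn_eq_coeFn_toMeasure]
      exact h2)
  have hconv : ∀ f : BoundedContinuousFunction V ℝ,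
      Tendsto (fun i => ∫ ξ, f ξ ∂(νm i)) U (𝓝 (∫ ξ, f ξ ∂(ν' : Measure V))) := 
    fun f => (FiniteMeasure.tendsto_iff_forall_integral_tendsto.1 hν') f
  set μ' : Measure V := (ν' : Measure V).withDensity (fun ξ => (w' ξ : ENNReal)) with hμ'
  have hww : ∀ ξ, (w ξ : ℝ) * (w' ξ : ℝ) = 1 := by
    intro ξ
    rw [hw, hw']
    simp only [Real.coe_toNNReal _ (Real.exp_pos _).le]
    rw [← Real.exp_add]; simp
  have hbdd : ∀ f : V → ℝ, Continuous f → (∃ r, ∀ ξ, r < ‖ξ‖ → f ξ = 0) → 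
      ∃ C, ∀ ξ, |f ξ| ≤ C := by
    rintro f hf ⟨r, hr⟩
    obtain ⟨C, hC⟩ := (isCompact_closedBall (0:V) r).exists_bound_of_continuousOn hf.continuousOn
    refine ⟨max C 0, fun ξ => ?_⟩
    rcases le_or_gt ‖ξ‖ r with h | h
    · exact (hC ξ (by simpa using h)).trans (le_max_left _ _)
    · rw [hr ξ h]; simp
  have hvag : ∀ f : V → ℝ, Continuous f → (∃ r, ∀ ξ, r < ‖ξ‖ → f ξ = 0) →
        Tendsto (fun i => ∫ ξ, f ξ ∂(μ i)) U (𝓝 (∫ ξ, f ξ ∂μ')) := by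
    intro f hf hr
    have hcg : Continuous (fun ξ => (w' ξ : ℝ) * f ξ) := by
      rw [hw']; fun_prop
    obtain ⟨C, hC⟩ := hbdd _ hcg (by
      obtain ⟨r, hr⟩ := hr
      exact ⟨r, fun ξ h => by rw [hr ξ h, mul_zero]⟩)
    have h1 := hconv (BoundedContinuousFunction.ofNormedAddCommGroup _ hcg C hC)
    simp only [BoundedContinuousFunction.coe_ofNormedAddCommGroup] at h1
    have e1 : ∀ i, ∫ ξ, (w' ξ : ℝ) * f ξ ∂(νm i) = ∫ ξ, f ξ ∂(μ i) := by
      intro i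
      rw [hνm, integral_withDensity_eq_integral_smul hwm]
      congr 1; ext ξ
      rw [NNReal.smul_def, smul_eq_mul, ← mul_assoc, hww, one_mul]
    have e2 : ∫ ξ, (w' ξ : ℝ) * f ξ ∂(ν' : Measure V) = ∫ ξ, f ξ ∂μ' := by
      rw [hμ', integral_withDensity_eq_integral_smul hwm']
      rfl
    simp only [e1] at h1
    rwa [e2] at h1
  have hSP : SP K μ' := by
    constructor
    · have hb : ∀ n : ℕ, μ' (Metric.closedBall 0 n) ≤ 1 := by
        intro n
        have hcut : Tendsto (fun i => ∫ ξ, cutf n ξ ∂(μ i)) U (𝓝 (∫ ξ, cutf n ξ ∂μ')) :=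
          hvag _ (cutf_cont _) ⟨n + 1, fun ξ h => cutf_eq_zero h⟩
        have hle : ∫ ξ, cutf n ξ ∂μ' ≤ 1 := by
          refine le_of_tendsto hcut (Eventually.of_forall fun i => ?_)
          calc ∫ ξ, cutf n ξ ∂(μ i) ≤ ∫ ξ, (1:ℝ) ∂(μ i) := by
                refine integral_mono ((hμ i).int_bdd (cutf_cont _) (C := 1) fun ξ => ?_) 
                  (integrable_const _) fun ξ => cutf_le_one _ _
                rw [abs_of_nonneg (cutf_nonneg _ ξ)]; exact cutf_le_one _ ξ
            _ ≤ 1 := by simpa using (hμ i).real_le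
        have hint : Integrable (fun ξ => cutf n ξ) μ' := by
          rw [hμ', integrable_withDensity_iff_integrable_smul hwm']
          have hcg : Continuous (fun ξ => (w' ξ : ℝ) * cutf n ξ) := by
            have := cutf_cont (V := V) n
            rw [hw']; fun_prop
          obtain ⟨C, hC⟩ := hbdd _ hcg ⟨n + 1, fun ξ h => by rw [cutf_eq_zero h, mul_zero]⟩
          exact Integrable.of_bound hcg.aestronglyMeasurable C (Eventually.of_forall hC)
        calc μ' (Metric.closedBall 0 n) = ∫⁻ ξ in Metric.closedBall 0 n, 1 ∂μ' := by simp
          _ ≤ ∫⁻ ξ in Metric.closedBall 0 n, ENNReal.ofReal (cutf n ξ) ∂μ' := by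
              refine setLIntegral_mono (by have := cutf_cont (V := V) n; fun_prop) fun ξ hξ => ?_
              rw [cutf_eq_one (by simpa using hξ)]; simp
          _ ≤ ∫⁻ ξ, ENNReal.ofReal (cutf n ξ) ∂μ' := setLIntegral_le_lintegral _ _
          _ = ENNReal.ofReal (∫ ξ, cutf n ξ ∂μ') := by
              rw [ofReal_integral_eq_lintegral_ofReal hint (Eventually.of_forall (cutf_nonneg _))]
          _ ≤ 1 := by simpa using hle
      have hmono : Monotone (fun n : ℕ => Metric.closedBall (0:V) n) := fun a b hab =>
        Metric.closedBall_subset_closedBall (by exact_mod_cast hab)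
      have := tendsto_measure_iUnion_atTop (μ := μ') hmono
      rw [Metric.iUnion_closedBall_nat] at this
      exact le_of_tendsto' this hb
    · have hd : Continuous (fun ξ : V => min 1 (Metric.infDist ξ K)) := by
        have := Metric.continuous_infDist_pt K; fun_prop
      have h1 := hconv (BoundedContinuousFunction.ofNormedAddCommGroup _ hd 1 (fun ξ => by
        rw [Real.norm_eq_abs, abs_of_nonneg (le_min zero_le_one Metric.infDist_nonneg)]
        exact min_le_left _ _))
      simp only [BoundedContinuousFunction.coe_ofNormedAddCommGroup] at h1
      have e1 : ∀ i, ∫ ξ, min 1 (Metric.infDist ξ K) ∂(νm i) = 0 := by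
        intro i
        refine integral_eq_zero_of_ae ?_
        have : ∀ᵐ ξ ∂(νm i), ξ ∈ K := (withDensity_absolutelyContinuous _ _).ae_le (hμ i).ae
        filter_upwards [this] with ξ hξ
        simp [Metric.infDist_zero_of_mem hξ]
      simp only [e1] at h1
      have h2 := tendsto_nhds_unique h1 tendsto_const_nhds
      rw [integral_eq_zero_iff_of_nonneg (fun ξ => le_min zero_le_one Metric.infDist_nonneg)] at h2
      · have h3 : ∀ᵐ ξ ∂(ν' : Measure V), ξ ∈ K := by
          filter_upwards [h2] with ξ hξ
          rw [hK.isClosed.mem_iff_infDist_zero ⟨0, hK.zero_mem⟩]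
          by_contra hne
          have h5 : 0 < Metric.infDist ξ K := lt_of_le_of_ne Metric.infDist_nonneg (Ne.symm hne)
          have : 0 < min 1 (Metric.infDist ξ K) := lt_min one_pos h5
          exact this.ne' hξ
        have h4 : ∀ᵐ ξ ∂μ', ξ ∈ K := (withDensity_absolutelyContinuous _ _).ae_le h3
        exact ae_iff.1 h4
      · refine Integrable.of_bound hd.aestronglyMeasurable 1 (Eventually.of_forall fun ξ => ?_)
        rw [Real.norm_eq_abs, abs_of_nonneg (le_min zero_le_one Metric.infDist_nonneg)]
        exact min_le_left _ _
  refine ⟨μ', hSP, hvag, fun u hu => ?_⟩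
  obtain ⟨c, hc, hcu⟩ := IsProperConvexCone.mem_int_iff.1 hu
  rw [Metric.tendsto_nhds]
  intro ε hε
  obtain ⟨r, hr0, hr⟩ : ∃ r : ℝ, 0 ≤ r ∧ Real.exp (-(c*r)) < ε/4 := by
    have : Tendsto (fun r : ℝ => Real.exp (-(c*r))) atTop (𝓝 0) :=
      Real.tendsto_exp_neg_atTop_nhds_zero.comp (tendsto_id.const_mul_atTop hc)
    exact (((eventually_ge_atTop 0).and (this.eventually (gt_mem_nhds (by positivity : 0 < ε/4))))).exists
  have hv := hvag (fun ξ => cutf r ξ * Real.exp (-⟪u, ξ⟫)) 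
    (by have := cutf_cont (V := V) r; fun_prop) ⟨r + 1, fun ξ h => by rw [cutf_eq_zero h, zero_mul]⟩
  rw [Metric.tendsto_nhds] at hv
  filter_upwards [hv (ε/4) (by positivity)] with i hi
  have h1 := (hμ i).LT_cut hc hcu hr0
  have h2 := hSP.LT_cut hc hcu hr0
  rw [Real.dist_eq] at *
  rw [abs_le] at h1 h2
  rw [abs_lt] at hi ⊢
  constructor <;> linarith


theorem int_sub_dual {K : Set V} {u : V} (h : u ∈ interior (dualCone K)) : u ∈ dualCone K :=
  interior_subset h

theorem int_add {K : Set V} {u e : V} (hu : u ∈ dualCone K) (he : e ∈ interior (dualCone K)) :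
    u + e ∈ interior (dualCone K) := by
  obtain ⟨c, hc, h⟩ := IsProperConvexCone.mem_int_iff.1 he
  refine IsProperConvexCone.mem_int_iff.2 ⟨c, hc, fun x hx => ?_⟩
  rw [inner_add_left]
  linarith [h x hx, mem_dual_iff.1 hu x hx]

theorem int_smul {K : Set V} {a : ℝ} {e : V} (ha : 0 < a) (he : e ∈ interior (dualCone K)) :
    a • e ∈ interior (dualCone K) := by
  obtain ⟨c, hc, h⟩ := IsProperConvexCone.mem_int_iff.1 he
  refine IsProperConvexCone.mem_int_iff.2 ⟨a * c, by positivity, fun x hx => ?_⟩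
  rw [inner_smul_left]
  have := h x hx
  simp
  nlinarith

theorem SP.LT_cont {K : Set V} {μ : Measure V} (h : SP K μ) : ContinuousOn (LapT μ) (dualCone K) := by
  have := h.fin
  intro u hu
  refine tendsto_integral_filter_of_dominated_convergence (fun _ => (1:ℝ)) ?_ ?_ (integrable_const _) ?_
  · exact Eventually.of_forall fun v => by fun_prop
  · filter_upwards [self_mem_nhdsWithin] with v hv
    filter_upwards [h.ae] with ξ hξ
    rw [Real.norm_eq_abs, Real.abs_exp]
    exact Real.exp_le_one_iff.2 (by linarith [mem_dual_iff.1 hv ξ hξ])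
  · refine Eventually.of_forall fun ξ => ?_
    have : Continuous fun v : V => Real.exp (-⟪v, ξ⟫) := by fun_prop
    exact this.continuousWithinAt

theorem tendsto_add_e (u e : V) : 
    Tendsto (fun n : ℕ => u + ((n:ℝ)+1)⁻¹ • e) atTop (𝓝 u) := by
  have h : Tendsto (fun n : ℕ => ((n:ℝ)+1)⁻¹) atTop (𝓝 0) := by
    simpa using tendsto_one_div_add_atTop_nhds_zero_nat (𝕜 := ℝ)
  simpa using (tendsto_const_nhds (x := u)).add (h.smul_const e)

theorem exists_int {K : Set V} (hK : IsProperConvexCone K) : ∃ e, e ∈ interior (dualCone K) := by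
  obtain ⟨e, c, hc, h⟩ := hK.exists_e
  exact ⟨e, IsProperConvexCone.mem_int_iff.2 ⟨c, hc, h⟩⟩

theorem add_e_int {K : Set V} {u e : V} (hu : u ∈ dualCone K) (he : e ∈ interior (dualCone K)) 
    (n : ℕ) : u + ((n:ℝ)+1)⁻¹ • e ∈ interior (dualCone K) :=
  int_add hu (int_smul (by positivity) he)

theorem tendsto_add_e_within {K : Set V} {u e : V} (hu : u ∈ dualCone K)
    (he : e ∈ interior (dualCone K)) : 
    Tendsto (fun n : ℕ => u + ((n:ℝ)+1)⁻¹ • e) atTop (𝓝[dualCone K] u) :=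
  tendsto_nhdsWithin_iff.2 ⟨tendsto_add_e u e, Eventually.of_forall fun n => 
    int_sub_dual (add_e_int hu he n)⟩

theorem LT_eq_dual {K : Set V} (hK : IsProperConvexCone K) {μ ν : Measure V} (hμ : SP K μ)
    (hν : SP K ν) (h : ∀ u ∈ interior (dualCone K), LapT μ u = LapT ν u) {u : V} 
    (hu : u ∈ dualCone K) : LapT μ u = LapT ν u := by
  obtain ⟨e, he⟩ := exists_int hK
  have h1 := (hμ.LT_cont u hu).tendsto.comp (tendsto_add_e_within hu he)
  have h2 := (hν.LT_cont u hu).tendsto.comp (tendsto_add_e_within hu he)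
  refine tendsto_nhds_unique h1 (h2.congr fun n => ?_)
  exact (h _ (add_e_int hu he n)).symm

theorem LT_unique {K : Set V} (hK : IsProperConvexCone K) {μ ν : Measure V} (hμ : SP K μ)
    (hν : SP K ν) (h : ∀ u ∈ interior (dualCone K), LapT μ u = LapT ν u) : μ = ν := by
  have := hμ.fin
  have := hν.fin
  have hKm : MeasurableSet K := hK.isClosed.measurableSet
  have emb : MeasurableEmbedding (Subtype.val : K → V) := MeasurableEmbedding.subtype_coe hKm
  have hc : CompleteSpace K := hK.isClosed.completeSpace_coe
  have hcom : ∀ {ρ : Measure V}, SP K ρ → (ρ.comap (Subtype.val : K → V)).map Subtype.val = ρ := by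
    intro ρ hρ
    rw [emb.map_comap, Subtype.range_coe]
    exact Measure.restrict_eq_self_of_ae_mem hρ.ae
  suffices hh : μ.comap (Subtype.val : K → V) = ν.comap (Subtype.val : K → V) by
    rw [← hcom hμ, ← hcom hν, hh]
  have hfm : IsFiniteMeasure (μ.comap (Subtype.val : K → V)) := ⟨by
    rw [emb.comap_apply]; exact measure_lt_top _ _⟩
  have hfn : IsFiniteMeasure (ν.comap (Subtype.val : K → V)) := ⟨by
    rw [emb.comap_apply]; exact measure_lt_top _ _⟩
  have hE : ∀ u ∈ dualCone K, ∃ f : BoundedContinuousFunction K ℝ, 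
      ∀ ξ : K, f ξ = Real.exp (-⟪u, (ξ:V)⟫) := fun u hu =>
    ⟨BoundedContinuousFunction.ofNormedAddCommGroup (fun ξ : K => Real.exp (-⟪u, (ξ:V)⟫)) 
      (by fun_prop) 1 (fun ξ => by
        rw [Real.norm_eq_abs, Real.abs_exp]
        exact Real.exp_le_one_iff.2 (by linarith [mem_dual_iff.1 hu ξ ξ.2])), fun ξ => rfl⟩
  let S : Submonoid (BoundedContinuousFunction K ℝ) :=
    { carrier := {f | ∃ u ∈ dualCone K, ∀ ξ : K, f ξ = Real.exp (-⟪u, (ξ:V)⟫)}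
      one_mem' := ⟨0, dual_zero, fun ξ => by simp⟩
      mul_mem' := by
        rintro f g ⟨u, hu, hf⟩ ⟨v, hv, hg⟩
        refine ⟨u + v, dual_add hu hv, fun ξ => ?_⟩
        rw [BoundedContinuousFunction.mul_apply, hf, hg, ← Real.exp_add, inner_add_left]
        congr 1; ring }
  let A : StarSubalgebra ℝ (BoundedContinuousFunction K ℝ) :=
    { toSubalgebra := Algebra.adjoin ℝ (S : Set (BoundedContinuousFunction K ℝ))
      star_mem' := by
        intro a ha
        have : star a = a := by ext ξ; simp
        rw [this]; exact ha }
  have hint : ∀ {ρ : Measure V}, SP K ρ → ∀ f : K → ℝ, ∀ g : V → ℝ, (∀ ξ : K, f ξ = g ξ) → 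
      ∫ ξ, f ξ ∂(ρ.comap (Subtype.val : K → V)) = ∫ ξ, g ξ ∂ρ := by
    intro ρ hρ f g hfg
    conv_rhs => rw [← hcom hρ]
    rw [emb.integral_map]
    simp [hfg]
  refine ext_of_forall_mem_subalgebra_integral_eq_of_pseudoEMetric_complete_countable (𝕜 := ℝ) 
    (A := A) ?_ ?_
  · intro x y hxy
    have : ∃ u ∈ dualCone K, ⟪u, (x:V)⟫ ≠ ⟪u, (y:V)⟫ := by
      by_contra hcon
      push Not at hcon
      apply hxy
      have h1 : (x:V) - y ∈ K := hK.bidual fun u hu => by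
        rw [inner_sub_right, hcon u hu]; simp
      have h2 : (y:V) - x ∈ K := hK.bidual fun u hu => by
        rw [inner_sub_right, hcon u hu]; simp
      have h3 : (x:V) - y ∈ K ∩ (-K) := ⟨h1, by simpa using h2⟩
      rw [hK.proper] at h3
      exact Subtype.ext (sub_eq_zero.1 h3)
    obtain ⟨u, hu, hne⟩ := this
    obtain ⟨f, hf⟩ := hE u hu
    refine ⟨f, ⟨f.toContinuousMap, ?_, rfl⟩, ?_⟩
    · exact ⟨f, Algebra.subset_adjoin ⟨u, hu, hf⟩, rfl⟩
    · rw [hf x, hf y]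
      intro h
      exact hne (by linarith [Real.exp_injective h])
  · intro g hg
    have hg' : g ∈ Subalgebra.toSubmodule (Algebra.adjoin ℝ (S : Set (BoundedContinuousFunction K ℝ))) := hg
    rw [Algebra.adjoin_eq_span, Submonoid.closure_eq] at hg'
    induction hg' using Submodule.span_induction with
    | mem f hf =>
      obtain ⟨u, hu, hf⟩ := hf
      rw [hint hμ _ (fun ξ => Real.exp (-⟪u, ξ⟫)) hf, hint hν _ (fun ξ => Real.exp (-⟪u, ξ⟫)) hf]
      exact LT_eq_dual hK hμ hν h hu
    | zero => simp
    | add f g hf hg2 h1 h2 => 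
      simp only [BoundedContinuousFunction.add_apply]
      rw [integral_add (f.integrable _) (g.integrable _), integral_add (f.integrable _) (g.integrable _)]
      have hm : ∀ f ∈ Submodule.span ℝ (S : Set (BoundedContinuousFunction K ℝ)), f ∈ A := by
        intro f hf
        have : f ∈ Subalgebra.toSubmodule (Algebra.adjoin ℝ (S : Set (BoundedContinuousFunction K ℝ))) := by
          rw [Algebra.adjoin_eq_span, Submonoid.closure_eq]; exact hf
        exact this
      rw [h1 (hm f hf), h2 (hm g hg2)]
    | smul a f hf h1 => 
      have hm : ∀ f ∈ Submodule.span ℝ (S : Set (BoundedContinuousFunction K ℝ)), f ∈ A := by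
        intro f hf
        have : f ∈ Subalgebra.toSubmodule (Algebra.adjoin ℝ (S : Set (BoundedContinuousFunction K ℝ))) := by
          rw [Algebra.adjoin_eq_span, Submonoid.closure_eq]; exact hf
        exact this
      simp only [BoundedContinuousFunction.coe_smul, integral_smul, h1 (hm f hf)]

theorem LT_limit {K : Set V} (hK : IsProperConvexCone K) {ι : Type*} {l : Filter ι} [l.NeBot]
    {μ : ι → Measure V} (hμ : ∀ i, SP K (μ i)) {g : V → ℝ}
    (h : ∀ u ∈ interior (dualCone K), Tendsto (fun i => LapT (μ i) u) l (𝓝 (g u))) :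
    ∃ μ', SP K μ' ∧ ∀ u ∈ interior (dualCone K), LapT μ' u = g u := by
  obtain ⟨μ', h1, -, h3⟩ := compactness hK (Ultrafilter.of l) μ hμ
  exact ⟨μ', h1, fun u hu => tendsto_nhds_unique (h3 u hu) ((h u hu).mono_left (Ultrafilter.of_le l))⟩

theorem vague_tendsto {K : Set V} (hK : IsProperConvexCone K) {ι : Type*} {l : Filter ι}
    {μ : ι → Measure V} (hμ : ∀ i, SP K (μ i)) {μ' : Measure V} (hμ' : SP K μ')
    (h : ∀ u ∈ interior (dualCone K), Tendsto (fun i => LapT (μ i) u) l (𝓝 (LapT μ' u)))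
    {f : V → ℝ} (hf : Continuous f) (hfr : ∃ r, ∀ ξ, r < ‖ξ‖ → f ξ = 0) :
    Tendsto (fun i => ∫ ξ, f ξ ∂(μ i)) l (𝓝 (∫ ξ, f ξ ∂μ')) := by
  rw [tendsto_iff_ultrafilter]
  intro U hU
  obtain ⟨μ₂, h1, h2, h3⟩ := compactness hK U μ hμ
  have : μ₂ = μ' := LT_unique hK h1 hμ' fun u hu => 
    tendsto_nhds_unique (h3 u hu) ((h u hu).mono_left hU)
  rw [← this]
  exact h2 f hf hfr

theorem weak_tendsto {K : Set V} (hK : IsProperConvexCone K) {ι : Type*} {l : Filter ι}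
    {μ : ι → Measure V} (hμ : ∀ i, SP K (μ i)) {μ' : Measure V} (hμ' : SP K μ')
    (h : ∀ u ∈ interior (dualCone K), Tendsto (fun i => LapT (μ i) u) l (𝓝 (LapT μ' u)))
    (h0 : Tendsto (fun i => LapT (μ i) 0) l (𝓝 (LapT μ' 0)))
    (f : BoundedContinuousFunction V ℝ) :
    Tendsto (fun i => ∫ ξ, f ξ ∂(μ i)) l (𝓝 (∫ ξ, f ξ ∂μ')) := by
  have := hμ'.fin
  have := fun i => (hμ i).fin
  have hm : ∀ ρ : Measure V, LapT ρ 0 = ∫ ξ, (1:ℝ) ∂ρ := fun ρ => by simp [LapT]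
  simp only [hm] at h0
  have hcint : ∀ {ρ : Measure V}, SP K ρ → ∀ r, Integrable (cutf r) ρ := fun hρ r =>
    hρ.int_bdd (cutf_cont r) (C := 1) fun ξ => by
      rw [abs_of_nonneg (cutf_nonneg _ ξ)]; exact cutf_le_one _ ξ
  have hbd : ∀ {ρ : Measure V}, SP K ρ → ∀ r, |∫ ξ, f ξ ∂ρ - ∫ ξ, cutf r ξ * f ξ ∂ρ| ≤ 
      ‖f‖ * (∫ ξ, (1:ℝ) ∂ρ - ∫ ξ, cutf r ξ ∂ρ) := by
    intro ρ hρ r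
    have := hρ.fin
    have i2 : Integrable (fun ξ => cutf r ξ * f ξ) ρ := by
      refine hρ.int_bdd ((cutf_cont r).mul f.continuous) (C := ‖f‖) fun ξ => ?_
      rw [abs_mul, abs_of_nonneg (cutf_nonneg _ ξ)]
      have := f.norm_coe_le_norm ξ
      rw [Real.norm_eq_abs] at this
      nlinarith [cutf_le_one r ξ, cutf_nonneg r ξ, abs_nonneg (f ξ)]
    rw [← integral_sub (f.integrable _) i2, ← integral_sub (integrable_const _) (hcint hρ r),
      ← integral_const_mul]
    refine norm_integral_le_of_norm_le (f := fun ξ => f ξ - cutf r ξ * f ξ) (((integrable_const _).sub (hcint hρ r)).const_mul _) ?_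
    refine Eventually.of_forall fun ξ => ?_
    have e1 : f ξ - cutf r ξ * f ξ = (1 - cutf r ξ) * f ξ := by ring
    have := f.norm_coe_le_norm ξ
    simp only [e1, norm_mul, Real.norm_eq_abs] at *
    rw [abs_of_nonneg (by linarith [cutf_le_one r ξ] : 0 ≤ 1 - cutf r ξ)]
    nlinarith [cutf_le_one r ξ]
  rw [Metric.tendsto_nhds]
  intro ε hε
  have hcutlim : Tendsto (fun n : ℕ => ∫ ξ, cutf n ξ ∂μ') atTop (𝓝 (∫ ξ, (1:ℝ) ∂μ')) := by
    refine tendsto_integral_of_dominated_convergence (fun _ => (1:ℝ)) 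
      (fun n => (cutf_cont _).aestronglyMeasurable) (integrable_const _) 
      (fun n => Eventually.of_forall fun ξ => ?_) (Eventually.of_forall fun ξ => ?_)
    · rw [Real.norm_eq_abs, abs_of_nonneg (cutf_nonneg _ ξ)]; exact cutf_le_one _ ξ
    · refine tendsto_const_nhds.congr' ?_
      filter_upwards [eventually_ge_atTop ⌈‖ξ‖⌉₊] with n hn
      rw [cutf_eq_one]
      exact (Nat.le_ceil _).trans (by exact_mod_cast hn)
  set δ := ε / (4 * (‖f‖ + 1)) with hδ
  have hδ0 : 0 < δ := by positivity
  have hfδ : ‖f‖ * δ < ε / 4 := by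
    rw [hδ]
    have : 0 ≤ ‖f‖ := norm_nonneg _
    rw [mul_div_assoc', div_lt_div_iff₀ (by positivity) (by positivity)]
    nlinarith
  obtain ⟨n, hn⟩ := (Metric.tendsto_nhds.1 hcutlim (δ/2) (by positivity)).exists
  have v1 := vague_tendsto hK hμ hμ' h (cutf_cont (n:ℝ)) ⟨n+1, fun ξ h => cutf_eq_zero h⟩
  have v2 := vague_tendsto hK hμ hμ' h (f := fun ξ => cutf n ξ * f ξ) 
    ((cutf_cont (n:ℝ)).mul f.continuous) ⟨n+1, fun ξ h => by rw [cutf_eq_zero h, zero_mul]⟩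
  have v3 := h0.sub v1
  filter_upwards [Metric.tendsto_nhds.1 v2 (ε/4) (by positivity), 
    Metric.tendsto_nhds.1 v3 (δ/2) (by positivity)] with i hi1 hi2
  have b1 := hbd (hμ i) n
  have b2 := hbd hμ' n
  rw [Real.dist_eq] at *
  rw [abs_lt] at hn hi1 hi2 ⊢
  have c1 : ‖f‖ * (∫ ξ, (1:ℝ) ∂(μ i) - ∫ ξ, cutf n ξ ∂(μ i)) ≤ ‖f‖ * δ :=
    mul_le_mul_of_nonneg_left (by linarith [hn.1, hn.2, hi2.1, hi2.2]) (norm_nonneg _)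
  have c2 : ‖f‖ * (∫ ξ, (1:ℝ) ∂μ' - ∫ ξ, cutf n ξ ∂μ') ≤ ‖f‖ * δ :=
    mul_le_mul_of_nonneg_left (by linarith [hn.1, hn.2]) (norm_nonneg _)
  rw [abs_le] at b1 b2
  constructor <;> linarith [b1.1, b1.2, b2.1, b2.2, hi1.1, hi1.2]


theorem SP.zero {K : Set V} : SP K (0 : Measure V) := ⟨by simp, by simp⟩

theorem kernel_measurable {K : Set V} (hK : IsProperConvexCone K) {p : V → Measure V}
    (hp : ∀ x, SP K (p x)) (h0 : ∀ x ∉ K, p x = 0)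
    (hc : ∀ u ∈ interior (dualCone K), ContinuousOn (fun x => LapT (p x) u) K) : Measurable p := by
  have := fun x => (hp x).fin
  have hcl : ∀ s : Set V, IsClosed s → Measurable fun x => p x s := by
    intro s hs
    have key : ∀ f : V → ℝ, Continuous f → (∃ r, ∀ ξ, r < ‖ξ‖ → f ξ = 0) → 
        Measurable fun x => ∫ ξ, f ξ ∂(p x) := by
      intro f hf hr
      have hcon : ContinuousOn (fun x => ∫ ξ, f ξ ∂(p x)) K := fun x hx =>
        vague_tendsto hK hp (hp x) (fun u hu => hc u hu x hx) hf hr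
      have : (fun x => ∫ ξ, f ξ ∂(p x)) = K.indicator (fun x => ∫ ξ, f ξ ∂(p x)) := by
        ext x
        by_cases hx : x ∈ K
        · simp [hx]
        · simp [hx, h0 x hx]
      rw [this]
      have h2 : (fun x => ∫ ξ, f ξ ∂(p x)) = (fun x => ∫ ξ, f ξ ∂(p x)) := rfl
      have hKm := hK.isClosed.measurableSet
      refine measurable_of_restrict_of_restrict_compl hKm ?_ ?_
      · have := (continuousOn_iff_continuous_restrict.1 hcon).measurable
        convert this using 1
        ext x
        simp
      · convert measurable_const (a := (0:ℝ)) using 1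
        ext x
        have hx : (x:V) ∉ K := x.2
        simp only [Set.restrict_apply]
        exact Set.indicator_of_notMem hx _
    have hreal : Measurable fun x => (p x).real s := by
      have hlim : ∀ x, Tendsto (fun n : ℕ => ∫ ξ, (hs.apprSeq n ξ : ℝ) * cutf n ξ ∂(p x)) atTop 
          (𝓝 ((p x).real s)) := by
        intro x
        have e : (p x).real s = ∫ ξ, s.indicator (fun _ => (1:ℝ)) ξ ∂(p x) := by
          rw [integral_indicator_const _ hs.measurableSet]; simp
        rw [e]
        refine tendsto_integral_of_dominated_convergence (fun _ => (1:ℝ)) 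
          (fun n => ?_) (integrable_const _) 
          (fun n => Eventually.of_forall fun ξ => ?_) (Eventually.of_forall fun ξ => ?_)
        · refine Continuous.aestronglyMeasurable ?_
          have h1 := (hs.apprSeq n).continuous
          have h2 := cutf_cont (V := V) n
          fun_prop
        · have h1 : ((hs.apprSeq n ξ : NNReal):ℝ) ≤ 1 := by 
            exact_mod_cast HasOuterApproxClosed.apprSeq_apply_le_one hs n ξ
          have h2 : 0 ≤ ((hs.apprSeq n ξ : NNReal):ℝ) := NNReal.coe_nonneg _
          rw [Real.norm_eq_abs, abs_of_nonneg (mul_nonneg h2 (cutf_nonneg _ ξ))]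
          nlinarith [cutf_le_one (n:ℝ) ξ, cutf_nonneg (n:ℝ) ξ]
        · have t1 := tendsto_pi_nhds.1 (HasOuterApproxClosed.tendsto_apprSeq hs) ξ
          have t2 : Tendsto (fun n => ((hs.apprSeq n ξ : NNReal):ℝ)) atTop (𝓝 (s.indicator (fun _ => (1:ℝ)) ξ)) := by
            have h3 := (NNReal.continuous_coe.tendsto _).comp t1
            have h4 : ((s.indicator (fun _ => (1:NNReal)) ξ : NNReal) : ℝ) = s.indicator (fun _ => (1:ℝ)) ξ := by
              by_cases h : ξ ∈ s
              · rw [Set.indicator_of_mem h, Set.indicator_of_mem h]; rfl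
              · rw [Set.indicator_of_notMem h, Set.indicator_of_notMem h]; rfl
            rw [h4] at h3
            exact h3
          refine t2.congr' ?_
          filter_upwards [eventually_ge_atTop ⌈‖ξ‖⌉₊] with n hn
          rw [cutf_eq_one, mul_one]
          exact (Nat.le_ceil _).trans (by exact_mod_cast hn)
      refine measurable_of_tendsto_metrizable (fun n => ?_) (tendsto_pi_nhds.2 hlim)
      refine key _ ?_ ⟨n+1, fun ξ h => by rw [cutf_eq_zero h, mul_zero]⟩
      have h1 := (hs.apprSeq n).continuous
      have h2 := cutf_cont (V := V) n
      fun_prop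
    have : (fun x => p x s) = fun x => ENNReal.ofReal ((p x).real s) := by
      ext x; simp
    rw [this]
    exact hreal.ennreal_ofReal
  exact Measurable.measure_of_isPiSystem (S := {s | IsClosed s}) 
    (by rw [BorelSpace.measurable_eq (α := V), borel_eq_generateFrom_isClosed])
    isPiSystem_isClosed hcl (hcl _ isClosed_univ)

theorem SP.ofReal_LT {K : Set V} {μ : Measure V} (h : SP K μ) {u : V} (hu : u ∈ dualCone K) :
    ENNReal.ofReal (LapT μ u) = ∫⁻ ξ, ENNReal.ofReal (Real.exp (-⟪u, ξ⟫)) ∂μ :=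
  ofReal_integral_eq_lintegral_ofReal (h.int_exp hu) (Eventually.of_forall fun _ => (Real.exp_pos _).le)

theorem SP.bind {K : Set V} (hK : IsProperConvexCone K) {m : Measure V} (hm : SP K m) 
    {p : V → Measure V} (hp : ∀ x, SP K (p x)) (hpm : Measurable p) :
    SP K (m.bind p) := by
  constructor
  · rw [Measure.bind_apply MeasurableSet.univ hpm.aemeasurable]
    calc _ ≤ ∫⁻ a, 1 ∂m := lintegral_mono fun a => (hp a).1
      _ ≤ 1 := by simpa using hm.1
  · rw [Measure.bind_apply hK.isClosed.measurableSet.compl hpm.aemeasurable]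
    simp [fun a => (hp a).2]

theorem SP.LT_bind {K : Set V} (hK : IsProperConvexCone K) {m : Measure V} (hm : SP K m) 
    {p : V → Measure V} (hp : ∀ x, SP K (p x)) (hpm : Measurable p) {u : V} (hu : u ∈ dualCone K) :
    LapT (m.bind p) u = ∫ η, LapT (p η) u ∂m := by
  have := hm.fin
  have hmeas : Measurable fun ξ : V => ENNReal.ofReal (Real.exp (-⟪u, ξ⟫)) := by fun_prop
  have h1 := (hm.bind hK hp hpm).ofReal_LT hu
  rw [Measure.lintegral_bind hpm.aemeasurable hmeas.aemeasurable] at h1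
  have e : ∀ a, ∫⁻ ξ, ENNReal.ofReal (Real.exp (-⟪u, ξ⟫)) ∂(p a) = ENNReal.ofReal (LapT (p a) u) :=
    fun a => ((hp a).ofReal_LT hu).symm
  have hm2 : Measurable fun a => LapT (p a) u := by
    have : (fun a => LapT (p a) u) = fun a => (∫⁻ ξ, ENNReal.ofReal (Real.exp (-⟪u, ξ⟫)) ∂(p a)).toReal := by
      ext a; rw [e, ENNReal.toReal_ofReal (LapT_nonneg u)]
    rw [this]
    exact ((Measure.measurable_lintegral hmeas).comp hpm).ennreal_toReal
  simp only [e] at h1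
  rw [← ofReal_integral_eq_lintegral_ofReal ?_ (Eventually.of_forall fun _ => LapT_nonneg u)] at h1
  · rwa [ENNReal.ofReal_eq_ofReal_iff (LapT_nonneg u) (integral_nonneg fun _ => LapT_nonneg u)] at h1
  · refine Integrable.of_bound hm2.aestronglyMeasurable 1 (Eventually.of_forall fun a => ?_)
    rw [Real.norm_eq_abs, abs_of_nonneg (LapT_nonneg u)]
    exact (hp a).LT_le_one hu

/-- representable as a Laplace transform of a sub-probability on the interior of the dual cone -/
def LRep (K : Set V) (g : V → ℝ) : Prop := 
  ∃ μ, SP K μ ∧ ∀ u ∈ interior (dualCone K), LapT μ u = g u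

theorem LRep.congr {K : Set V} {f g : V → ℝ} (h : LRep K f) 
    (hfg : ∀ u ∈ interior (dualCone K), f u = g u) : LRep K g := by
  obtain ⟨μ, h1, h2⟩ := h
  exact ⟨μ, h1, fun u hu => (h2 u hu).trans (hfg u hu)⟩

theorem LRep.limit {K : Set V} (hK : IsProperConvexCone K) {ι : Type*} {l : Filter ι} [l.NeBot]
    {g : ι → V → ℝ} {g' : V → ℝ} (hg : ∀ᶠ i in l, LRep K (g i))
    (h : ∀ u ∈ interior (dualCone K), Tendsto (fun i => g i u) l (𝓝 (g' u))) : LRep K g' := by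
  classical
  let μ : ι → Measure V := fun i => if h : LRep K (g i) then h.choose else 0
  refine LT_limit hK (l := l) (μ := μ) (fun i => ?_) fun u hu => ?_
  · by_cases h : LRep K (g i)
    · simp only [μ, h, dif_pos]; exact h.choose_spec.1
    · simp only [μ, h, dif_neg, not_false_eq_true]; exact SP.zero
  · refine (h u hu).congr' ?_
    filter_upwards [hg] with i hi
    simp only [μ, hi, dif_pos]
    exact (hi.choose_spec.2 u hu).symm

theorem LRep.mul {K : Set V} (hK : IsProperConvexCone K) {f g : V → ℝ} (hf : LRep K f) (hg : LRep K g) :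
    LRep K (fun u => f u * g u) := by
  obtain ⟨μ, hμ, h1⟩ := hf
  obtain ⟨ν, hν, h2⟩ := hg
  have := hμ.fin
  have := hν.fin
  have hm : Measurable fun q : V × V => q.1 + q.2 := by fun_prop
  refine ⟨(μ.prod ν).map (fun q => q.1 + q.2), ⟨?_, ?_⟩, fun u hu => ?_⟩
  · rw [Measure.map_apply hm MeasurableSet.univ, Set.preimage_univ, ← Set.univ_prod_univ, Measure.prod_prod]
    exact mul_le_one' hμ.1 hν.1
  · have : ∀ᵐ q ∂(μ.prod ν), q.1 + q.2 ∈ K := by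
      have a1 : ∀ᵐ q ∂(μ.prod ν), q.1 ∈ K := Measure.quasiMeasurePreserving_fst.ae hμ.ae
      have a2 : ∀ᵐ q ∂(μ.prod ν), q.2 ∈ K := Measure.quasiMeasurePreserving_snd.ae hν.ae
      filter_upwards [a1, a2] with q h1 h2 using hK.add_mem h1 h2
    rw [Measure.map_apply hm hK.isClosed.measurableSet.compl]
    exact ae_iff.1 this
  · beta_reduce
    rw [← h1 u hu, ← h2 u hu]
    unfold LapT
    rw [integral_map hm.aemeasurable (by fun_prop), ← integral_prod_mul]
    congr 1; ext q
    rw [← Real.exp_add, inner_add_right]; congr 1; ring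

theorem LRep.dirac {K : Set V} (hK : IsProperConvexCone K) {y : V} (hy : y ∈ K) :
    LRep K (fun u => Real.exp (-⟪u, y⟫)) :=
  ⟨Measure.dirac y, ⟨by simp, by rw [Measure.dirac_apply' _ hK.isClosed.measurableSet.compl]; simp [hy]⟩,
    fun u hu => by unfold LapT; rw [integral_dirac]⟩

theorem LRep.one {K : Set V} (hK : IsProperConvexCone K) : LRep K (fun _ => 1) :=
  (LRep.dirac hK hK.zero_mem).congr fun u _ => by simp

theorem LRep.const {K : Set V} (hK : IsProperConvexCone K) {a : ℝ} (ha0 : 0 ≤ a) (ha : a ≤ 1) : 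
    LRep K (fun _ => a) := by
  obtain ⟨μ, h1, h2⟩ := LRep.one hK
  refine ⟨ENNReal.ofReal a • μ, ⟨?_, ?_⟩, fun u hu => ?_⟩
  · simp only [Measure.smul_apply, smul_eq_mul]
    exact mul_le_one' (by simpa using ha) h1.1
  · simp [h1.2]
  · have := h2 u hu
    unfold LapT at *
    rw [integral_smul_measure, this]; simp [ha0]

theorem LRep.pow {K : Set V} (hK : IsProperConvexCone K) {f : V → ℝ} (hf : LRep K f) (n : ℕ) :
    LRep K (fun u => f u ^ n) := by
  induction n with
  | zero => simpa using LRep.one hK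
  | succ n ih => simpa [pow_succ] using ih.mul hK hf

theorem LRep.poisson {K : Set V} (hK : IsProperConvexCone K) {lam : Measure V} [IsFiniteMeasure lam]
    (h : lam Kᶜ = 0) : LRep K (fun u => Real.exp (-∫ ξ, (1 - Real.exp (-⟪u, ξ⟫)) ∂lam)) := by
  refine LRep.limit hK (l := atTop) 
    (g := fun (n:ℕ) u => (1 + (-∫ ξ, (1 - Real.exp (-⟪u, ξ⟫)) ∂lam)/n)^n) ?_ ?_
  · filter_upwards [eventually_ge_atTop (⌈lam.real Set.univ⌉₊ + 1)] with n hn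
    refine LRep.pow hK (f := fun u => 1 + (-∫ ξ, (1 - Real.exp (-⟪u, ξ⟫)) ∂lam)/n) ?_ n
    have hn0 : (0:ℝ) < n := by exact_mod_cast (by omega : 0 < n)
    have hle : lam.real Set.univ ≤ n := (Nat.le_ceil _).trans (by exact_mod_cast (by omega))
    have hq0 : 0 ≤ 1 - lam.real Set.univ / n := by
      rw [sub_nonneg, div_le_one hn0]; exact hle
    have hq1 : 0 ≤ lam.real Set.univ / n := by positivity
    have hlam : lam Set.univ = ENNReal.ofReal (lam.real Set.univ) := by simp
    refine ⟨ENNReal.ofReal (1 - lam.real Set.univ / n) • Measure.dirac 0 + ENNReal.ofReal (1/n) • lam, 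
      ⟨?_, ?_⟩, fun u hu => ?_⟩
    · simp only [Measure.add_apply, Measure.smul_apply, smul_eq_mul, measure_univ, mul_one]
      rw [hlam, ← ENNReal.ofReal_mul (by positivity), ← ENNReal.ofReal_add hq0 (by positivity)]
      apply ENNReal.ofReal_le_one.2
      rw [one_div, inv_mul_eq_div]; linarith
    · simp only [Measure.add_apply, Measure.smul_apply, smul_eq_mul, h]
      rw [Measure.dirac_apply' _ hK.isClosed.measurableSet.compl]; simp [hK.zero_mem]
    · have hi : Integrable (fun ξ => Real.exp (-⟪u, ξ⟫)) lam := by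
        refine Integrable.of_bound (by fun_prop) 1 ?_
        have : ∀ᵐ ξ ∂lam, ξ ∈ K := by rw [ae_iff]; exact h
        filter_upwards [this] with ξ hξ
        rw [Real.norm_eq_abs, Real.abs_exp]
        exact Real.exp_le_one_iff.2 (by linarith [mem_dual_iff.1 (int_sub_dual hu) ξ hξ])
      have hi2 : Integrable (fun ξ => Real.exp (-⟪u, ξ⟫)) (Measure.dirac (0:V)) := integrable_dirac (by simp)
      unfold LapT
      beta_reduce
      rw [integral_add_measure (hi2.smul_measure (by simp)) (hi.smul_measure (by simp)), integral_smul_measure,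
        integral_smul_measure, integral_dirac, ENNReal.toReal_ofReal hq0, 
        ENNReal.toReal_ofReal (by positivity), integral_sub (integrable_const _) hi]
      simp
      field_simp
      ring
  · intro u hu
    exact Real.tendsto_one_add_div_pow_exp _

/-- affine representability -/
def AffRep (K : Set V) (φ : V → ℝ) (ψ : V → V) : Prop :=
  ∀ x ∈ K, LRep K (fun u => Real.exp (-φ u - ⟪ψ u, x⟫))

theorem AffRep.kernel {K : Set V} (hK : IsProperConvexCone K) {φ : V → ℝ} {ψ : V → V} 
    (h : AffRep K φ ψ) : ∃ p : V → Measure V, (∀ x, SP K (p x)) ∧ Measurable p ∧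
      (∀ x ∈ K, ∀ u ∈ interior (dualCone K), LapT (p x) u = Real.exp (-φ u - ⟪ψ u, x⟫)) := by
  classical
  let p : V → Measure V := fun x => if hx : x ∈ K then (h x hx).choose else 0
  have e1 : ∀ x (hx : x ∈ K), p x = (h x hx).choose := fun x hx => by simp [p, hx]
  have e0 : ∀ x ∉ K, p x = 0 := fun x hx => by simp [p, hx]
  have hp : ∀ x, SP K (p x) := fun x => by
    by_cases hx : x ∈ K
    · rw [e1 x hx]; exact (h x hx).choose_spec.1
    · rw [e0 x hx]; exact SP.zero
  have hL : ∀ x ∈ K, ∀ u ∈ interior (dualCone K), LapT (p x) u = Real.exp (-φ u - ⟪ψ u, x⟫) := 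
    fun x hx u hu => by rw [e1 x hx]; exact (h x hx).choose_spec.2 u hu
  refine ⟨p, hp, kernel_measurable hK hp e0 fun u hu => ?_, hL⟩
  have : ContinuousOn (fun x => Real.exp (-φ u - ⟪ψ u, x⟫)) K := by fun_prop
  exact this.congr fun x hx => hL x hx u hu

theorem AffRep.comp {K : Set V} (hK : IsProperConvexCone K) {φ₁ φ₂ : V → ℝ} {ψ₁ ψ₂ : V → V} 
    (h1 : AffRep K φ₁ ψ₁) (h2 : AffRep K φ₂ ψ₂) 
    (hi : ∀ u ∈ interior (dualCone K), ψ₁ u ∈ interior (dualCone K)) :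
    AffRep K (fun u => φ₁ u + φ₂ (ψ₁ u)) (fun u => ψ₂ (ψ₁ u)) := by
  intro x hx
  obtain ⟨p, hp, hpm, hpL⟩ := h1.kernel hK
  obtain ⟨m, hm, hmL⟩ := h2 x hx
  refine ⟨m.bind p, hm.bind hK hp hpm, fun u hu => ?_⟩
  rw [hm.LT_bind hK hp hpm (int_sub_dual hu)]
  have : ∫ η, LapT (p η) u ∂m = ∫ η, Real.exp (-φ₁ u) * Real.exp (-⟪ψ₁ u, η⟫) ∂m := by
    refine integral_congr_ae ?_
    filter_upwards [hm.ae] with η hη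
    rw [hpL η hη u hu, ← Real.exp_add]; congr 1
  rw [this, integral_const_mul]
  have h3 := hmL _ (hi u hu)
  unfold LapT at h3
  rw [h3, ← Real.exp_add]; congr 1; ring


theorem vec_ext {K : Set V} (hK : IsProperConvexCone K) {u v : V} (h : ∀ x ∈ K, ⟪u, x⟫ = ⟪v, x⟫) : u = v := by
  refine ext_inner_right ℝ fun w => ?_
  obtain ⟨x, hx, y, hy, rfl⟩ := hK.generating w
  rw [inner_sub_right, inner_sub_right, h x hx, h y hy]

theorem exists_vec {K : Set V} (hK : IsProperConvexCone K) (f : V → ℝ)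
    (hadd : ∀ x ∈ K, ∀ y ∈ K, f (x + y) = f x + f y) 
    (hsmul : ∀ c : ℝ, 0 ≤ c → ∀ x ∈ K, f (c • x) = c * f x) : ∃ g : V, ∀ x ∈ K, ⟪g, x⟫ = f x := by
  obtain ⟨L, hL⟩ := hK.exists_ext f hadd (fun c hc x hx => by rw [hsmul c hc x hx]; rfl)
  refine ⟨(InnerProductSpace.toDual ℝ V).symm (LinearMap.toContinuousLinearMap L), fun x hx => ?_⟩
  rw [InnerProductSpace.toDual_symm_apply]
  exact hL x hx

theorem exists_vec_int {K : Set V} (hK : IsProperConvexCone K) {χ : V → V} {R : V → V} 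
    (PR : RParams K χ R) (A : Set V) (f : V → ℝ) (hf : ∀ x ∈ K, IntegrableOn f A (PR.M x)) :
    ∃ g : V, ∀ x ∈ K, ⟪g, x⟫ = ∫ ξ in A, f ξ ∂(PR.M x) := by
  refine exists_vec hK (fun x => ∫ ξ in A, f ξ ∂(PR.M x)) (fun x hx y hy => ?_) (fun c hc x hx => ?_)
  · rw [PR.M_add x hx y hy, Measure.restrict_add, integral_add_measure (hf x hx) (hf y hy)]
  · rw [PR.M_smul c hc x hx, Measure.restrict_smul, integral_smul_measure, ENNReal.toReal_ofReal hc]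
    rfl

section bounds
variable {K : Set V} {χ : V → V} {ρ : ℝ}

theorem exp_sub_bd {a b : ℝ} : |Real.exp (-a) - Real.exp (-b)| ≤ Real.exp (-min a b) * |a - b| := by
  wlog h : a ≤ b generalizing a b
  · have := this (a := b) (b := a) (by linarith)
    rwa [abs_sub_comm, min_comm, abs_sub_comm a b]
  rw [min_eq_left h, abs_of_nonneg (sub_nonneg.2 (Real.exp_le_exp.2 (by linarith))), 
    abs_of_nonpos (by linarith)]
  have h1 : Real.exp (-b) = Real.exp (-a) * Real.exp (a - b) := by rw [← Real.exp_add]; ring_nf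
  have h2 := Real.add_one_le_exp (a - b)
  rw [h1]
  nlinarith [Real.exp_pos (-a)]

theorem g_lower (a : ℝ) : 0 ≤ Real.exp (-a) - 1 + a := by linarith [Real.add_one_le_exp (-a)]

theorem g_upper {a : ℝ} (ha : 0 ≤ a) : Real.exp (-a) - 1 + a ≤ a ^ 2 := by
  -- e^{-a} ≤ 1/(1+a)
  have h1 : Real.exp (-a) ≤ 1 / (1 + a) := by
    rw [Real.exp_neg, one_div]
    apply inv_anti₀ (by positivity)
    linarith [Real.add_one_le_exp a]
  have h2 : 1 / (1 + a) ≤ 1 - a + a^2 := by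
    rw [div_le_iff₀ (by positivity)]
    nlinarith [pow_nonneg ha 3]
  linarith

theorem g_lip {a b : ℝ} (ha : 0 ≤ a) (hb : 0 ≤ b) :
    |(Real.exp (-a) - 1 + a) - (Real.exp (-b) - 1 + b)| ≤ max a b * |a - b| := by
  wlog h : a ≤ b generalizing a b
  · have := this hb ha (by linarith)
    rwa [abs_sub_comm, max_comm, abs_sub_comm a b]
  rw [max_eq_right h, abs_of_nonpos (by linarith : a - b ≤ 0)]
  have h1 : Real.exp (-b) = Real.exp (-a) * Real.exp (a - b) := by rw [← Real.exp_add]; ring_nf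
  have h1' : Real.exp (-a) = Real.exp (-b) * Real.exp (b - a) := by rw [← Real.exp_add]; ring_nf
  have h2 := Real.add_one_le_exp (a - b)
  have h3 := Real.add_one_le_exp (b - a)
  have h4 : Real.exp (-a) ≤ 1 := Real.exp_le_one_iff.2 (by linarith)
  have h5 : 1 - b ≤ Real.exp (-b) := by linarith [Real.add_one_le_exp (-b)]
  have e1 : 0 ≤ (b - a) - (Real.exp (-a) - Real.exp (-b)) := by
    rw [h1]; nlinarith [Real.exp_pos (-a)]
  have e2 : (b - a) - (Real.exp (-a) - Real.exp (-b)) ≤ b * (b - a) := by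
    have : Real.exp (-b) * (b - a) ≤ Real.exp (-a) - Real.exp (-b) := by
      rw [h1']; nlinarith [Real.exp_pos (-b)]
    nlinarith
  rw [abs_of_nonpos (by linarith)]
  linarith

theorem q_ge {ξ : V} (hρ0 : 0 < ρ) (hρ1 : ρ ≤ 1) (h : ρ ≤ ‖ξ‖) : 1 ≤ (ρ^2)⁻¹ * min (‖ξ‖^2) 1 := by
  rw [inv_mul_eq_div, one_le_div (by positivity)]
  exact le_min (by gcongr) (by nlinarith)

theorem q_small {ξ : V} (hρ1 : ρ ≤ 1) (h : ‖ξ‖ < ρ) : min (‖ξ‖^2) 1 = ‖ξ‖^2 := by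
  apply min_eq_left
  nlinarith [norm_nonneg ξ]

theorem h_bounds (hρ0 : 0 < ρ) (hρ1 : ρ ≤ 1) (hχ1 : ∀ ξ, ‖χ ξ‖ ≤ 1) (hχρ : ∀ ξ, ‖ξ‖ < ρ → χ ξ = ξ)
    {u ξ : V} (hu : u ∈ dualCone K) (hξ : ξ ∈ K) :
    -((1 + ‖u‖) * ((ρ^2)⁻¹ * min (‖ξ‖^2) 1)) ≤ Real.exp (-⟪u, ξ⟫) - 1 + ⟪χ ξ, u⟫ ∧
    Real.exp (-⟪u, ξ⟫) - 1 + ⟪χ ξ, u⟫ ≤ (‖u‖^2 + ‖u‖) * ((ρ^2)⁻¹ * min (‖ξ‖^2) 1) := by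
  have ha := mem_dual_iff.1 hu ξ hξ
  have hn := norm_nonneg u
  have hq : 0 ≤ min (‖ξ‖^2) 1 := le_min (by positivity) (by norm_num)
  rcases lt_or_ge ‖ξ‖ ρ with h | h
  · rw [hχρ ξ h, real_inner_comm u ξ]
    have hle : (1:ℝ) ≤ (ρ^2)⁻¹ := (one_le_inv₀ (by positivity)).2 (by nlinarith)
    have h1 := g_lower ⟪u, ξ⟫
    have h2 := g_upper ha
    have h3 : ⟪u, ξ⟫ ≤ ‖u‖ * ‖ξ‖ := real_inner_le_norm u ξ
    have h4 : ⟪u, ξ⟫ ^ 2 ≤ ‖u‖^2 * ‖ξ‖^2 := by rw [← mul_pow]; gcongr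
    constructor
    · have : 0 ≤ (1 + ‖u‖) * ((ρ^2)⁻¹ * min (‖ξ‖^2) 1) := by positivity
      linarith
    · rw [q_small hρ1 h]
      have : ‖u‖^2 * ‖ξ‖^2 ≤ (‖u‖^2 + ‖u‖) * ((ρ^2)⁻¹ * ‖ξ‖^2) := by
        have : ‖ξ‖^2 ≤ (ρ^2)⁻¹ * ‖ξ‖^2 := le_mul_of_one_le_left (by positivity) hle
        apply mul_le_mul _ this (by positivity) (by positivity)
        linarith
      linarith
  · have h1 := q_ge hρ0 hρ1 h
    have h2 : |⟪χ ξ, u⟫| ≤ ‖u‖ := (abs_real_inner_le_norm _ _).trans (by nlinarith [hχ1 ξ])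
    rw [abs_le] at h2
    have h3 : Real.exp (-⟪u, ξ⟫) ≤ 1 := Real.exp_le_one_iff.2 (by linarith)
    have h4 := Real.exp_pos (-⟪u, ξ⟫)
    constructor
    · nlinarith
    · nlinarith

theorem h_abs (hρ0 : 0 < ρ) (hρ1 : ρ ≤ 1) (hχ1 : ∀ ξ, ‖χ ξ‖ ≤ 1) (hχρ : ∀ ξ, ‖ξ‖ < ρ → χ ξ = ξ)
    {u ξ : V} (hu : u ∈ dualCone K) (hξ : ξ ∈ K) :
    |Real.exp (-⟪u, ξ⟫) - 1 + ⟪χ ξ, u⟫| ≤ (1 + ‖u‖ + ‖u‖^2) * (ρ^2)⁻¹ * min (‖ξ‖^2) 1 := by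
  have := h_bounds hρ0 hρ1 hχ1 hχρ hu hξ
  have hq : 0 ≤ (ρ^2)⁻¹ * min (‖ξ‖^2) 1 := mul_nonneg (by positivity) (le_min (by positivity) (by norm_num))
  rw [abs_le]
  constructor <;> nlinarith [norm_nonneg u, sq_nonneg ‖u‖, mul_nonneg hq (norm_nonneg u), mul_nonneg hq (sq_nonneg ‖u‖)]

/-- closed convex set on which the vector fields are Lipschitz -/
def Bx (K : Set V) (κ N : ℝ) : Set V := {u | (∀ ξ ∈ K, κ * ‖ξ‖ ≤ ⟪u, ξ⟫) ∧ ‖u‖ ≤ N}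

theorem Bx.dual {κ N : ℝ} (hκ : 0 < κ) {u : V} (hu : u ∈ Bx K κ N) : u ∈ dualCone K :=
  mem_dual_iff.2 fun x hx => le_trans (by positivity) (hu.1 x hx)

theorem exp_lin {κ r : ℝ} (hκ : 0 < κ) : Real.exp (-(κ * r)) * r ≤ κ⁻¹ := by
  have h1 : κ * r ≤ Real.exp (κ * r) := by linarith [Real.add_one_le_exp (κ * r)]
  rw [Real.exp_neg, inv_mul_eq_div, div_le_iff₀ (Real.exp_pos _), inv_mul_eq_div, le_div_iff₀ hκ]
  linarith

theorem e_lip {κ N : ℝ} (hκ : 0 < κ) {u v ξ : V} (hu : u ∈ Bx K κ N) (hv : v ∈ Bx K κ N) (hξ : ξ ∈ K) :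
    |Real.exp (-⟪u, ξ⟫) - Real.exp (-⟪v, ξ⟫)| ≤ min ‖ξ‖ κ⁻¹ * ‖u - v‖ := by
  have h1 := exp_sub_bd (a := ⟪u, ξ⟫) (b := ⟪v, ξ⟫)
  have h2 : |⟪u, ξ⟫ - ⟪v, ξ⟫| ≤ ‖u - v‖ * ‖ξ‖ := by
    rw [← inner_sub_left]; exact abs_real_inner_le_norm _ _
  have h3 : Real.exp (-min ⟪u, ξ⟫ ⟪v, ξ⟫) ≤ Real.exp (-(κ * ‖ξ‖)) :=
    Real.exp_le_exp.2 (neg_le_neg (le_min (hu.1 ξ hξ) (hv.1 ξ hξ)))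
  have h4 := exp_lin (r := ‖ξ‖) hκ
  have h5 : Real.exp (-(κ * ‖ξ‖)) ≤ 1 := Real.exp_le_one_iff.2 (by have := norm_nonneg ξ; simp; positivity)
  refine h1.trans ((mul_le_mul h3 h2 (abs_nonneg _) (Real.exp_pos _).le).trans ?_)
  have h6 : Real.exp (-(κ * ‖ξ‖)) * ‖ξ‖ ≤ min ‖ξ‖ κ⁻¹ := le_min (by nlinarith [norm_nonneg ξ]) h4
  calc _ = Real.exp (-(κ * ‖ξ‖)) * ‖ξ‖ * ‖u - v‖ := by ring
    _ ≤ _ := by gcongr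

theorem h_lip (hρ0 : 0 < ρ) (hρ1 : ρ ≤ 1) (hχ1 : ∀ ξ, ‖χ ξ‖ ≤ 1) (hχρ : ∀ ξ, ‖ξ‖ < ρ → χ ξ = ξ)
    {κ N : ℝ} (hκ : 0 < κ) (hN : 0 ≤ N)
    {u v ξ : V} (hu : u ∈ Bx K κ N) (hv : v ∈ Bx K κ N) (hξ : ξ ∈ K) :
    |(Real.exp (-⟪u, ξ⟫) - 1 + ⟪χ ξ, u⟫) - (Real.exp (-⟪v, ξ⟫) - 1 + ⟪χ ξ, v⟫)| ≤ 
      ((N + κ⁻¹ + 1) * (ρ^2)⁻¹ * ‖u - v‖) * min (‖ξ‖^2) 1 := by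
  have ha := mem_dual_iff.1 (Bx.dual hκ hu) ξ hξ
  have hb := mem_dual_iff.1 (Bx.dual hκ hv) ξ hξ
  have hle : (1:ℝ) ≤ (ρ^2)⁻¹ := (one_le_inv₀ (by positivity)).2 (by nlinarith)
  rcases lt_or_ge ‖ξ‖ ρ with h | h
  · rw [hχρ ξ h, real_inner_comm u ξ, real_inner_comm v ξ, q_small hρ1 h]
    have h1 := g_lip ha hb
    have h2 : |⟪u, ξ⟫ - ⟪v, ξ⟫| ≤ ‖u - v‖ * ‖ξ‖ := by
      rw [← inner_sub_left]; exact abs_real_inner_le_norm _ _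
    have h3 : max ⟪u, ξ⟫ ⟪v, ξ⟫ ≤ N * ‖ξ‖ := max_le 
      ((real_inner_le_norm _ _).trans (by gcongr; exact hu.2)) 
      ((real_inner_le_norm _ _).trans (by gcongr; exact hv.2))
    refine h1.trans ((mul_le_mul h3 h2 (abs_nonneg _) (by positivity)).trans ?_)
    have h4 : N ≤ (N + κ⁻¹ + 1) * (ρ^2)⁻¹ := by
      have : 0 < κ⁻¹ := by positivity
      nlinarith
    calc _ = N * (‖u - v‖ * ‖ξ‖^2) := by ring
      _ ≤ (N + κ⁻¹ + 1) * (ρ^2)⁻¹ * (‖u - v‖ * ‖ξ‖^2) := by gcongr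
      _ = _ := by ring
  · have h1 := e_lip hκ hu hv hξ
    have h2 : |⟪χ ξ, u⟫ - ⟪χ ξ, v⟫| ≤ ‖u - v‖ := by
      rw [← inner_sub_right]
      exact (abs_real_inner_le_norm _ _).trans (by nlinarith [hχ1 ξ, norm_nonneg (u - v)])
    have h3 := q_ge hρ0 hρ1 h
    have h4 : min ‖ξ‖ κ⁻¹ * ‖u - v‖ ≤ κ⁻¹ * ‖u - v‖ := by gcongr; exact min_le_right _ _
    have h5 : |(Real.exp (-⟪u, ξ⟫) - 1 + ⟪χ ξ, u⟫) - (Real.exp (-⟪v, ξ⟫) - 1 + ⟪χ ξ, v⟫)| ≤ 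
        (N + κ⁻¹ + 1) * ‖u - v‖ := by
      have := mul_nonneg hN (norm_nonneg (u - v))
      rw [abs_le] at h1 h2 ⊢
      constructor <;> nlinarith
    refine h5.trans ?_
    calc _ = (N + κ⁻¹ + 1) * ‖u - v‖ * 1 := by ring
      _ ≤ (N + κ⁻¹ + 1) * ‖u - v‖ * ((ρ^2)⁻¹ * min (‖ξ‖^2) 1) := by
        apply mul_le_mul_of_nonneg_left h3; positivity
      _ = _ := by ring
end bounds


theorem exists_rho {χ : V → V} (hχ : IsTruncation χ) : ∃ ρ : ℝ, 0 < ρ ∧ ρ ≤ 1 ∧ ∀ ξ, ‖ξ‖ < ρ → χ ξ = ξ := by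
  obtain ⟨r, hr, h⟩ := Metric.eventually_nhds_iff.1 hχ.2.2
  refine ⟨min r 1, by positivity, min_le_right _ _, fun ξ hξ => h ?_⟩
  rw [dist_zero_right]; exact hξ.trans_le (min_le_left _ _)

section Rfacts
variable {K : Set V} {χ : V → V} {F : V → ℝ} {R : V → V}

theorem PR_ae (PR : RParams K χ R) {x : V} (hx : x ∈ K) : ∀ᵐ ξ ∂(PR.M x), ξ ∈ K := by
  rw [ae_iff]; exact PR.M_supp x hx

theorem PF_ae (PF : FParams K F) : ∀ᵐ ξ ∂PF.m, ξ ∈ K := by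
  rw [ae_iff]; exact PF.m_supp

theorem PR_intq (PR : RParams K χ R) {x : V} (hx : x ∈ K) : 
    Integrable (fun ξ => min (‖ξ‖^2) 1) (PR.M x) := by
  refine ⟨by fun_prop, ?_⟩
  rw [hasFiniteIntegral_iff_ofReal (Eventually.of_forall fun ξ => le_min (by positivity) (by norm_num))]
  exact PR.M_int x hx

theorem PF_intq (PF : FParams K F) : Integrable (fun ξ => min ‖ξ‖ 1) PF.m := by
  refine ⟨by fun_prop, ?_⟩
  rw [hasFiniteIntegral_iff_ofReal (Eventually.of_forall fun ξ => le_min (by positivity) (by norm_num))]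
  exact PF.m_int

theorem exists_Theta (hK : IsProperConvexCone K) (PR : RParams K χ R) : 
    ∃ Θ : ℝ, 0 ≤ Θ ∧ ∀ x ∈ K, ∫ ξ, min (‖ξ‖^2) 1 ∂(PR.M x) ≤ Θ * ‖x‖ := by
  obtain ⟨g, hg⟩ := exists_vec_int hK PR Set.univ (fun ξ => min (‖ξ‖^2) 1) 
    (fun x hx => (PR_intq PR hx).integrableOn)
  refine ⟨‖g‖, norm_nonneg _, fun x hx => ?_⟩
  have := hg x hx
  rw [Measure.restrict_univ] at this
  rw [← this]
  exact real_inner_le_norm _ _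

theorem PR_inth (hχ : IsTruncation χ) (PR : RParams K χ R) {x u : V} (hx : x ∈ K) (hu : u ∈ dualCone K) :
    Integrable (fun ξ => Real.exp (-⟪u, ξ⟫) - 1 + ⟪χ ξ, u⟫) (PR.M x) := by
  obtain ⟨ρ, h0, h1, h2⟩ := exists_rho hχ
  have hc := hχ.1
  refine ((PR_intq PR hx).const_mul ((1 + ‖u‖ + ‖u‖^2) * (ρ^2)⁻¹)).mono' (by fun_prop) ?_
  filter_upwards [PR_ae PR hx] with ξ hξ
  exact h_abs h0 h1 hχ.2.1 h2 hu hξ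

theorem one_sub_exp_bd {u ξ : V} (hu : u ∈ dualCone K) (hξ : ξ ∈ K) :
    |Real.exp (-⟪u, ξ⟫) - 1| ≤ (1 + ‖u‖) * min ‖ξ‖ 1 := by
  have ha := mem_dual_iff.1 hu ξ hξ
  have h1 : Real.exp (-⟪u, ξ⟫) ≤ 1 := Real.exp_le_one_iff.2 (by linarith)
  have h2 := Real.add_one_le_exp (-⟪u, ξ⟫)
  have h3 := Real.exp_pos (-⟪u, ξ⟫)
  have h4 := real_inner_le_norm u ξ
  have hn := norm_nonneg u
  have hn2 := norm_nonneg ξ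
  rw [abs_of_nonpos (by linarith)]
  rcases le_total ‖ξ‖ 1 with h | h
  · rw [min_eq_left h]; nlinarith
  · rw [min_eq_right h]; nlinarith

theorem PF_inth (PF : FParams K F) {u : V} (hu : u ∈ dualCone K) :
    Integrable (fun ξ => Real.exp (-⟪u, ξ⟫) - 1) PF.m := by
  refine ((PF_intq PF).const_mul (1 + ‖u‖)).mono' (by fun_prop) ?_
  filter_upwards [PF_ae PF] with ξ hξ
  exact one_sub_exp_bd hu hξ

theorem F_nonneg (PF : FParams K F) {u : V} (hu : u ∈ dualCone K) : 0 ≤ F u := by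
  rw [PF.eq u hu]
  have h1 : 0 ≤ ⟪PF.b, u⟫ := hu _ PF.b_mem
  have h2 : ∫ ξ, (Real.exp (-⟪u, ξ⟫) - 1) ∂PF.m ≤ 0 := by
    refine integral_nonpos_of_ae ?_
    filter_upwards [PF_ae PF] with ξ hξ
    have := mem_dual_iff.1 hu ξ hξ
    simp only [Pi.zero_apply]
    linarith [Real.exp_le_one_iff.2 (by linarith : -⟪u, ξ⟫ ≤ 0)]
  linarith [PF.c_nonneg]

theorem F_bdd (PF : FParams K F) (N : ℝ) (hN : 0 ≤ N) : 
    ∃ L : ℝ, 0 ≤ L ∧ ∀ u ∈ dualCone K, ‖u‖ ≤ N → |F u| ≤ L := by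
  have hI : 0 ≤ ∫ ξ, min ‖ξ‖ 1 ∂PF.m := integral_nonneg fun ξ => le_min (by positivity) (by norm_num)
  have hc := PF.c_nonneg
  refine ⟨‖PF.b‖ * N + PF.c + (1 + N) * ∫ ξ, min ‖ξ‖ 1 ∂PF.m, by positivity, fun u hu hun => ?_⟩
  rw [PF.eq u hu]
  have h1 : |⟪PF.b, u⟫| ≤ ‖PF.b‖ * N := (abs_real_inner_le_norm _ _).trans (by gcongr)
  have h2 : |∫ ξ, (Real.exp (-⟪u, ξ⟫) - 1) ∂PF.m| ≤ ∫ ξ, (1 + N) * min ‖ξ‖ 1 ∂PF.m := by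
    refine norm_integral_le_of_norm_le (f := fun ξ => Real.exp (-⟪u, ξ⟫) - 1) ((PF_intq PF).const_mul _) ?_
    filter_upwards [PF_ae PF] with ξ hξ
    refine (one_sub_exp_bd hu hξ).trans ?_
    have : 0 ≤ min ‖ξ‖ 1 := le_min (by positivity) (by norm_num)
    gcongr
  rw [integral_const_mul] at h2
  rw [abs_le] at *
  constructor <;> linarith

theorem F_lip (PF : FParams K F) {κ N : ℝ} (hκ : 0 < κ) : 
    ∃ L : ℝ, 0 ≤ L ∧ ∀ u ∈ Bx K κ N, ∀ v ∈ Bx K κ N, |F u - F v| ≤ L * ‖u - v‖ := by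
  have hI : 0 ≤ ∫ ξ, min ‖ξ‖ 1 ∂PF.m := integral_nonneg fun ξ => le_min (by positivity) (by norm_num)
  refine ⟨‖PF.b‖ + (1 + κ⁻¹) * ∫ ξ, min ‖ξ‖ 1 ∂PF.m, by positivity, fun u hu v hv => ?_⟩
  rw [PF.eq u (Bx.dual hκ hu), PF.eq v (Bx.dual hκ hv)]
  have h1 : |⟪PF.b, u⟫ - ⟪PF.b, v⟫| ≤ ‖PF.b‖ * ‖u - v‖ := by
    rw [← inner_sub_right]; exact abs_real_inner_le_norm _ _
  have h2 : |∫ ξ, (Real.exp (-⟪u, ξ⟫) - 1) ∂PF.m - ∫ ξ, (Real.exp (-⟪v, ξ⟫) - 1) ∂PF.m| ≤ 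
      ∫ ξ, ((1 + κ⁻¹) * ‖u - v‖) * min ‖ξ‖ 1 ∂PF.m := by
    rw [← integral_sub (PF_inth PF (Bx.dual hκ hu)) (PF_inth PF (Bx.dual hκ hv))]
    refine norm_integral_le_of_norm_le (f := fun ξ => Real.exp (-⟪u, ξ⟫) - 1 - (Real.exp (-⟪v, ξ⟫) - 1)) 
      ((PF_intq PF).const_mul _) ?_
    filter_upwards [PF_ae PF] with ξ hξ
    have e1 := e_lip hκ hu hv hξ
    have e2 : Real.exp (-⟪u, ξ⟫) - 1 - (Real.exp (-⟪v, ξ⟫) - 1) = Real.exp (-⟪u, ξ⟫) - Real.exp (-⟪v, ξ⟫) := by ring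
    rw [e2, Real.norm_eq_abs]
    refine e1.trans ?_
    have hk : 0 < κ⁻¹ := by positivity
    have e3 : min ‖ξ‖ κ⁻¹ ≤ (1 + κ⁻¹) * min ‖ξ‖ 1 := by
      rcases le_total ‖ξ‖ 1 with h | h
      · rw [min_eq_left h]; refine (min_le_left _ _).trans ?_; nlinarith [norm_nonneg ξ]
      · rw [min_eq_right h]; refine (min_le_right _ _).trans ?_; linarith
    calc _ ≤ ((1 + κ⁻¹) * min ‖ξ‖ 1) * ‖u - v‖ := by gcongr
      _ = _ := by ring
  rw [integral_const_mul] at h2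
  rw [abs_le] at *
  constructor <;> nlinarith

theorem R_inner (PR : RParams K χ R) (hQ : PR.Q = 0) {u x : V} (hu : u ∈ dualCone K) (hx : x ∈ K) :
    ⟪R u, x⟫ = ⟪PR.B u, x⟫ + ⟪PR.γ, x⟫ - ∫ ξ, (Real.exp (-⟪u, ξ⟫) - 1 + ⟪χ ξ, u⟫) ∂(PR.M x) := by
  rw [PR.eq u hu x hx, hQ]; simp

theorem B_bd (B : V →ₗ[ℝ] V) : ∃ b : ℝ, 0 ≤ b ∧ ∀ u, ‖B u‖ ≤ b * ‖u‖ :=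
  ⟨‖LinearMap.toContinuousLinearMap B‖, norm_nonneg _, fun u => (LinearMap.toContinuousLinearMap B).le_opNorm u⟩

theorem R_bdd (hK : IsProperConvexCone K) (hχ : IsTruncation χ) (PR : RParams K χ R) (hQ : PR.Q = 0) 
    (N : ℝ) (hN : 0 ≤ N) : 
    ∃ L : ℝ, 0 ≤ L ∧ ∀ u ∈ dualCone K, ‖u‖ ≤ N → ‖R u‖ ≤ L := by
  obtain ⟨ρ, h0, h1, h2⟩ := exists_rho hχ
  obtain ⟨C, hC, hCn⟩ := hK.exists_normbd
  obtain ⟨Θ, hΘ0, hΘ⟩ := exists_Theta hK PR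
  obtain ⟨b, hb0, hb⟩ := B_bd PR.B
  set a := b * N + ‖PR.γ‖ + (1 + N + N^2) * (ρ^2)⁻¹ * Θ with ha
  have ha0 : 0 ≤ a := by positivity
  refine ⟨C * a, by positivity, fun u hu hun => hCn _ _ ha0 fun x hx => ?_⟩
  rw [R_inner PR hQ hu hx]
  have e1 : |⟪PR.B u, x⟫| ≤ b * N * ‖x‖ := (abs_real_inner_le_norm _ _).trans (by
    gcongr; exact (hb u).trans (by gcongr))
  have e2 : |⟪PR.γ, x⟫| ≤ ‖PR.γ‖ * ‖x‖ := abs_real_inner_le_norm _ _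
  have e3 : |∫ ξ, (Real.exp (-⟪u, ξ⟫) - 1 + ⟪χ ξ, u⟫) ∂(PR.M x)| ≤ 
      ∫ ξ, ((1 + N + N^2) * (ρ^2)⁻¹) * min (‖ξ‖^2) 1 ∂(PR.M x) := by
    refine norm_integral_le_of_norm_le (f := fun ξ => Real.exp (-⟪u, ξ⟫) - 1 + ⟪χ ξ, u⟫) 
      ((PR_intq PR hx).const_mul _) ?_
    filter_upwards [PR_ae PR hx] with ξ hξ
    refine (h_abs h0 h1 hχ.2.1 h2 hu hξ).trans ?_
    have : 0 ≤ min (‖ξ‖^2) 1 := le_min (by positivity) (by norm_num)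
    gcongr
  rw [integral_const_mul] at e3
  have e4 : ((1 + N + N^2) * (ρ^2)⁻¹) * ∫ ξ, min (‖ξ‖^2) 1 ∂(PR.M x) ≤ ((1 + N + N^2) * (ρ^2)⁻¹) * (Θ * ‖x‖) := by
    have := hΘ x hx
    gcongr
  rw [abs_le] at *
  rw [ha]
  constructor <;> linarith

theorem R_lip (hK : IsProperConvexCone K) (hχ : IsTruncation χ) (PR : RParams K χ R) (hQ : PR.Q = 0) 
    {κ N : ℝ} (hκ : 0 < κ) (hN : 0 ≤ N) : 
    ∃ L : ℝ, 0 ≤ L ∧ ∀ u ∈ Bx K κ N, ∀ v ∈ Bx K κ N, ‖R u - R v‖ ≤ L * ‖u - v‖ := by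
  obtain ⟨ρ, h0, h1, h2⟩ := exists_rho hχ
  obtain ⟨C, hC, hCn⟩ := hK.exists_normbd
  obtain ⟨Θ, hΘ0, hΘ⟩ := exists_Theta hK PR
  obtain ⟨b, hb0, hb⟩ := B_bd PR.B
  refine ⟨C * (b + (N + κ⁻¹ + 1) * (ρ^2)⁻¹ * Θ), by positivity, fun u hu v hv => ?_⟩
  have := hCn (R u - R v) ((b + (N + κ⁻¹ + 1) * (ρ^2)⁻¹ * Θ) * ‖u - v‖) (by positivity) fun x hx => ?_
  · rwa [← mul_assoc] at this
  have hud := Bx.dual hκ hu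
  have hvd := Bx.dual hκ hv
  rw [inner_sub_left, R_inner PR hQ hud hx, R_inner PR hQ hvd hx]
  have e1 : |⟪PR.B u, x⟫ - ⟪PR.B v, x⟫| ≤ b * ‖u - v‖ * ‖x‖ := by
    rw [← inner_sub_left, ← map_sub]
    exact (abs_real_inner_le_norm _ _).trans (by gcongr; exact hb _)
  have e3 : |∫ ξ, (Real.exp (-⟪u, ξ⟫) - 1 + ⟪χ ξ, u⟫) ∂(PR.M x) - ∫ ξ, (Real.exp (-⟪v, ξ⟫) - 1 + ⟪χ ξ, v⟫) ∂(PR.M x)| ≤ 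
      ∫ ξ, ((N + κ⁻¹ + 1) * (ρ^2)⁻¹ * ‖u - v‖) * min (‖ξ‖^2) 1 ∂(PR.M x) := by
    rw [← integral_sub (PR_inth hχ PR hx hud) (PR_inth hχ PR hx hvd)]
    refine norm_integral_le_of_norm_le (f := fun ξ => (Real.exp (-⟪u, ξ⟫) - 1 + ⟪χ ξ, u⟫) - (Real.exp (-⟪v, ξ⟫) - 1 + ⟪χ ξ, v⟫)) 
      ((PR_intq PR hx).const_mul _) ?_
    filter_upwards [PR_ae PR hx] with ξ hξ
    exact h_lip h0 h1 hχ.2.1 h2 hκ hN hu hv hξ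
  rw [integral_const_mul] at e3
  have e4 : ((N + κ⁻¹ + 1) * (ρ^2)⁻¹ * ‖u - v‖) * ∫ ξ, min (‖ξ‖^2) 1 ∂(PR.M x) ≤ 
      ((N + κ⁻¹ + 1) * (ρ^2)⁻¹ * ‖u - v‖) * (Θ * ‖x‖) := by
    have := hΘ x hx
    gcongr
  rw [abs_le] at *
  constructor <;> linarith
end Rfacts


structure Appr (K : Set V) (e : V) (R : V → V) (F : V → ℝ) (C N ε : ℝ) (B : V →ₗ[ℝ] V) (G : V → V)
    (Φ : V → ℝ) : Prop where
  qm : ∀ u ∈ dualCone K, ∀ x ∈ K, ⟪u, x⟫ = 0 → 0 ≤ ⟪B u, x⟫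
  G_mem : ∀ u ∈ dualCone K, G u ∈ dualCone K
  G_mono : ∀ u ∈ dualCone K, ∀ v ∈ dualCone K, v - u ∈ dualCone K → G v - G u ∈ dualCone K
  rep : ∀ h : ℝ, 0 ≤ h → ∀ y ∈ K, LRep K (fun u => Real.exp (-(h * Φ u) - ⟪h • G u, y⟫))
  low : ∀ s : ℝ, 0 ≤ s → s ≤ 1 → ∀ x ∈ K, -(C * s) * ⟪e, x⟫ ≤ ⟪B (s • e) + G (s • e), x⟫
  up : ∀ s : ℝ, 0 ≤ s → ∀ x ∈ K, ⟪B (s • e) + G (s • e), x⟫ ≤ C * (1 + s) * ⟪e, x⟫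
  close : ∀ u ∈ dualCone K, ‖u‖ ≤ N → ‖B u + G u - R u‖ ≤ ε ∧ |Φ u - F u| ≤ ε

section Build
variable {K : Set V} {χ : V → V} {F : V → ℝ} {R : V → V}

theorem A_meas (δ : ℝ) : MeasurableSet {ξ : V | δ ≤ ‖ξ‖} := measurableSet_le measurable_const measurable_norm

theorem PR_fin (PR : RParams K χ R) {x : V} (hx : x ∈ K) {δ : ℝ} (h0 : 0 < δ) (h1 : δ ≤ 1) :
    IsFiniteMeasure ((PR.M x).restrict {ξ | δ ≤ ‖ξ‖}) := by
  refine ⟨?_⟩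
  rw [Measure.restrict_apply_univ]
  refine (measure_mono ?_).trans_lt ((PR_intq PR hx).measure_ge_lt_top (ε := δ^2) (by positivity))
  intro ξ hξ
  exact le_min (pow_le_pow_left₀ h0.le hξ 2) (by nlinarith)

theorem PF_fin (PF : FParams K F) {δ : ℝ} (h0 : 0 < δ) (h1 : δ ≤ 1) :
    IsFiniteMeasure (PF.m.restrict {ξ | δ ≤ ‖ξ‖}) := by
  refine ⟨?_⟩
  rw [Measure.restrict_apply_univ]
  refine (measure_mono ?_).trans_lt ((PF_intq PF).measure_ge_lt_top (ε := δ) (by positivity))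
  intro ξ hξ
  exact le_min hξ h1

theorem int_one_sub {μ : Measure V} [IsFiniteMeasure μ] (h : ∀ᵐ ξ ∂μ, ξ ∈ K) {u : V} (hu : u ∈ dualCone K) :
    Integrable (fun ξ => 1 - Real.exp (-⟪u, ξ⟫)) μ := by
  refine (integrable_const (1:ℝ)).mono' (by fun_prop) ?_
  filter_upwards [h] with ξ hξ
  have ha := mem_dual_iff.1 hu ξ hξ
  have h1 : Real.exp (-⟪u, ξ⟫) ≤ 1 := Real.exp_le_one_iff.2 (by linarith)
  have h3 := Real.exp_pos (-⟪u, ξ⟫)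
  rw [Real.norm_eq_abs, abs_le]; constructor <;> linarith

theorem build (hK : IsProperConvexCone K) (hχ : IsTruncation χ) (PF : FParams K F) (PR : RParams K χ R) 
    (hadm : PR.Admissible) (hQ : PR.Q = 0) {δ : ℝ} (h0 : 0 < δ) (h1 : δ ≤ 1) 
    (h2 : ∀ ξ, ‖ξ‖ < δ → χ ξ = ξ) :
    ∃ (B : V →ₗ[ℝ] V) (G : V → V) (Φ : V → ℝ), 
      (∀ u ∈ dualCone K, ∀ x ∈ K, ⟪u, x⟫ = 0 → 0 ≤ ⟪B u, x⟫) ∧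
      (∀ u ∈ dualCone K, G u ∈ dualCone K) ∧
      (∀ u ∈ dualCone K, ∀ v ∈ dualCone K, v - u ∈ dualCone K → G v - G u ∈ dualCone K) ∧ 
      (∀ h : ℝ, 0 ≤ h → ∀ y ∈ K, LRep K (fun u => Real.exp (-(h * Φ u) - ⟪h • G u, y⟫))) ∧
      (∀ u ∈ dualCone K, ∀ x ∈ K, ⟪B u + G u, x⟫ = ⟪PR.B u, x⟫ + ⟪PR.γ, x⟫ - 
        ∫ ξ in {ξ | δ ≤ ‖ξ‖}, (Real.exp (-⟪u, ξ⟫) - 1 + ⟪χ ξ, u⟫) ∂(PR.M x)) ∧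
      (∀ u ∈ dualCone K, Φ u = ⟪PF.b, u⟫ + PF.c - 
        ∫ ξ in {ξ | δ ≤ ‖ξ‖}, (Real.exp (-⟪u, ξ⟫) - 1) ∂PF.m) := by
  have hc := hχ.1
  set A : Set V := {ξ : V | δ ≤ ‖ξ‖} with hA
  have hAm : MeasurableSet A := A_meas δ
  have aeA : ∀ x ∈ K, ∀ᵐ ξ ∂((PR.M x).restrict A), ξ ∈ K := fun x hx => ae_restrict_of_ae (PR_ae PR hx)
  have iχ : ∀ u : V, ∀ x ∈ K, IntegrableOn (fun ξ => ⟪χ ξ, u⟫) A (PR.M x) := by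
    intro u x hx
    haveI := PR_fin PR hx h0 h1
    refine (integrable_const ‖u‖).mono' (by fun_prop) (Eventually.of_forall fun ξ => ?_)
    refine (norm_inner_le_norm _ _).trans ?_
    nlinarith [hχ.2.1 ξ, norm_nonneg u]
  choose g hg using fun u => exists_vec_int hK PR A (fun ξ => ⟪χ ξ, u⟫) (iχ u)
  have iG : ∀ u ∈ dualCone K, ∀ x ∈ K, IntegrableOn (fun ξ => 1 - Real.exp (-⟪u, ξ⟫)) A (PR.M x) := by
    intro u hu x hx
    haveI := PR_fin PR hx h0 h1
    exact int_one_sub (aeA x hx) hu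
  have hGex : ∀ u, ∃ g : V, u ∈ dualCone K → ∀ x ∈ K, ⟪g, x⟫ = ∫ ξ in A, (1 - Real.exp (-⟪u, ξ⟫)) ∂(PR.M x) := by
    intro u
    by_cases hu : u ∈ dualCone K
    · obtain ⟨g, hg⟩ := exists_vec_int hK PR A _ (iG u hu)
      exact ⟨g, fun _ => hg⟩
    · exact ⟨0, fun h => absurd h hu⟩
  choose G hG using hGex
  let L : V →ₗ[ℝ] V := 
    { toFun := g
      map_add' := by
        intro u v
        refine vec_ext hK fun x hx => ?_
        rw [inner_add_left, hg _ x hx, hg _ x hx, hg _ x hx, ← integral_add (iχ u x hx) (iχ v x hx)]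
        simp only [inner_add_right]
      map_smul' := by
        intro r u
        refine vec_ext hK fun x hx => ?_
        rw [RingHom.id_apply, inner_smul_left, hg _ x hx, hg _ x hx]
        simp only [inner_smul_right, integral_const_mul]
        simp }
  have hL : ∀ u, L u = g u := fun u => rfl
  refine ⟨PR.B - L, fun u => PR.γ + G u, fun u => ⟪PF.b, u⟫ + PF.c + 
        ∫ ξ in A, (1 - Real.exp (-⟪u, ξ⟫)) ∂PF.m, ?_, ?_, ?_, ?_, ?_, ?_⟩
  · intro u hu x hx hux
    obtain ⟨-, hi, hp⟩ := hadm u hu x hx hux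
    rw [LinearMap.sub_apply, inner_sub_left, hL, hg u x hx]
    have : ∫ ξ in A, ⟪χ ξ, u⟫ ∂(PR.M x) ≤ ∫ ξ, ⟪χ ξ, u⟫ ∂(PR.M x) := by
      rw [← integral_add_compl hAm hi]
      have : 0 ≤ ∫ ξ in Aᶜ, ⟪χ ξ, u⟫ ∂(PR.M x) := by
        refine integral_nonneg_of_ae ?_
        filter_upwards [ae_restrict_of_ae (PR_ae PR hx), ae_restrict_mem hAm.compl] with ξ hξ hξA
        have : ‖ξ‖ < δ := not_le.1 hξA
        rw [h2 ξ this]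
        exact hu ξ hξ
      linarith
    linarith
  · intro u hu
    refine dual_add PR.γ_mem (mem_dual_iff.2 fun x hx => ?_)
    rw [hG u hu x hx]
    refine integral_nonneg_of_ae ?_
    filter_upwards [aeA x hx] with ξ hξ
    have ha := mem_dual_iff.1 hu ξ hξ
    have h1 : Real.exp (-⟪u, ξ⟫) ≤ 1 := Real.exp_le_one_iff.2 (by linarith)
    simp only [Pi.zero_apply]; linarith
  · intro u hu v hv huv
    refine mem_dual_iff.2 fun x hx => ?_
    rw [add_sub_add_left_eq_sub, inner_sub_left, hG u hu x hx, hG v hv x hx, sub_nonneg]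
    refine integral_mono_ae (iG u hu x hx) (iG v hv x hx) ?_
    filter_upwards [aeA x hx] with ξ hξ
    have ha := mem_dual_iff.1 huv ξ hξ
    rw [inner_sub_left] at ha
    have : Real.exp (-⟪v, ξ⟫) ≤ Real.exp (-⟪u, ξ⟫) := Real.exp_le_exp.2 (by linarith)
    beta_reduce
    linarith
  · intro h hh y hy
    haveI := PR_fin PR hy h0 h1
    haveI := PF_fin PF h0 h1
    haveI : IsFiniteMeasure (ENNReal.ofReal h • (PR.M y).restrict A) := Measure.smul_finite _ (by simp)
    haveI : IsFiniteMeasure (ENNReal.ofReal h • (PF.m).restrict A) := Measure.smul_finite _ (by simp)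
    have s1 : ((ENNReal.ofReal h • (PR.M y).restrict A) : Measure V) Kᶜ = 0 := by
      rw [Measure.smul_apply]
      simp only [smul_eq_mul, mul_eq_zero]
      right
      exact le_antisymm ((Measure.restrict_apply_le _ _).trans (PR.M_supp y hy).le) zero_le
    have s2 : ((ENNReal.ofReal h • (PF.m).restrict A) : Measure V) Kᶜ = 0 := by
      rw [Measure.smul_apply]
      simp only [smul_eq_mul, mul_eq_zero]
      right
      exact le_antisymm ((Measure.restrict_apply_le _ _).trans PF.m_supp.le) zero_le
    have hγ : 0 ≤ ⟪PR.γ, y⟫ := mem_dual_iff.1 PR.γ_mem y hy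
    have r1 := LRep.poisson hK s1
    have r2 := LRep.poisson hK s2
    have r3 := LRep.dirac hK (hK.smul_mem h hh _ PF.b_mem)
    have r4 := LRep.const hK (a := Real.exp (-(h * PF.c) - h * ⟪PR.γ, y⟫)) (Real.exp_nonneg _) 
      (Real.exp_le_one_iff.2 (by have := PF.c_nonneg; nlinarith [mul_nonneg hh this, mul_nonneg hh hγ]))
    refine (((r1.mul hK r2).mul hK r3).mul hK r4).congr fun u hu => ?_
    have hu' := interior_subset hu
    beta_reduce
    rw [← Real.exp_add, ← Real.exp_add, ← Real.exp_add]
    congr 1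
    rw [integral_smul_measure, integral_smul_measure, ENNReal.toReal_ofReal hh, inner_smul_left, inner_add_left, 
      hG u hu' y hy, inner_smul_right, real_inner_comm PF.b u]
    simp only [smul_eq_mul, conj_trivial]
    ring
  · intro u hu x hx
    have : ∫ ξ in A, (Real.exp (-⟪u, ξ⟫) - 1 + ⟪χ ξ, u⟫) ∂(PR.M x) = 
       ∫ ξ in A, ⟪χ ξ, u⟫ ∂(PR.M x) - ∫ ξ in A, (1 - Real.exp (-⟪u, ξ⟫)) ∂(PR.M x) := by
      rw [← integral_sub (iχ u x hx) (iG u hu x hx)]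
      congr 1; ext ξ; ring
    rw [this, LinearMap.sub_apply, inner_add_left, inner_sub_left, inner_add_left, hL, hg u x hx, hG u hu x hx]
    ring
  · intro u hu
    rw [sub_eq_add_neg, ← integral_neg]
    simp only [neg_sub]

theorem small_tendsto {μ : Measure V} (h0 : μ {0} = 0) {f : V → ℝ} (hf : Integrable f μ) {ρ : ℝ} (hρ : 0 < ρ) :
    Tendsto (fun n : ℕ => ∫ ξ in {ξ : V | ρ / ((n:ℝ) + 1) ≤ ‖ξ‖}ᶜ, f ξ ∂μ) atTop (𝓝 0) := by
  have h1 := tendsto_setIntegral_of_antitone (μ := μ) (f := f) 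
    (s := fun n : ℕ => {ξ : V | ρ / ((n:ℝ) + 1) ≤ ‖ξ‖}ᶜ) (fun n => (A_meas _).compl) 
    (by
      intro n m hnm ξ hξ
      simp only [mem_compl_iff, mem_setOf_eq, not_le] at hξ ⊢
      refine hξ.trans_le ?_
      have : (n:ℝ) ≤ m := by exact_mod_cast hnm
      gcongr) ⟨0, hf.integrableOn⟩
  have h2 : (⋂ n : ℕ, {ξ : V | ρ / ((n:ℝ) + 1) ≤ ‖ξ‖}ᶜ) ⊆ {0} := by
    intro ξ hξ
    simp only [mem_iInter, mem_compl_iff, mem_setOf_eq, not_le] at hξ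
    have h3 : Tendsto (fun n : ℕ => ρ / ((n:ℝ) + 1)) atTop (𝓝 0) := by
      have := (tendsto_one_div_add_atTop_nhds_zero_nat (𝕜 := ℝ)).const_mul ρ
      simpa [div_eq_mul_inv] using this
    have h4 : ‖ξ‖ ≤ 0 := ge_of_tendsto h3 (Eventually.of_forall fun n => (hξ n).le)
    simpa using h4
  rwa [setIntegral_measure_zero _ (measure_mono_null h2 h0)] at h1

theorem exists_Appr (hK : IsProperConvexCone K) (hχ : IsTruncation χ) (PF : FParams K F) (PR : RParams K χ R) 
    (hadm : PR.Admissible) (hQ : PR.Q = 0) {e : V} {c : ℝ} (hc : 0 < c) (he : ∀ x ∈ K, c * ‖x‖ ≤ ⟪e, x⟫) :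
    ∃ C : ℝ, 0 ≤ C ∧ ∀ N ε : ℝ, 0 ≤ N → 0 < ε → ∃ (B : V →ₗ[ℝ] V) (G : V → V) (Φ : V → ℝ), 
      Appr K e R F C N ε B G Φ := by
  obtain ⟨ρ, h0, h1, h2⟩ := exists_rho hχ
  obtain ⟨Θ, hΘ0, hΘ⟩ := exists_Theta hK PR
  have hed : e ∈ dualCone K := mem_dual_iff.2 fun x hx => le_trans (by positivity) (he x hx)
  set C₀ := ‖PR.B e‖ + ‖PR.γ‖ + (1 + ‖e‖ + ‖e‖^2) * (ρ^2)⁻¹ * Θ with hC₀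
  have hC₀0 : 0 ≤ C₀ := by positivity
  refine ⟨C₀ / c, by positivity, fun N ε hN hε => ?_⟩
  obtain ⟨n, xs, ys, hxs, hys, hframe⟩ := hK.exists_frame
  have hq0 : ∀ ξ : V, 0 ≤ min (‖ξ‖^2) 1 := fun ξ => le_min (by positivity) (by norm_num)
  have hq0' : ∀ ξ : V, 0 ≤ min ‖ξ‖ 1 := fun ξ => le_min (by positivity) (by norm_num)
  set cN := (1 + N + N^2) * (ρ^2)⁻¹ with hcN
  have hcN0 : 0 ≤ cN := by positivity
  have t1 : Tendsto (fun k : ℕ => ∑ i, (cN * ∫ ξ in {ξ : V | ρ / ((k:ℝ) + 1) ≤ ‖ξ‖}ᶜ, min (‖ξ‖^2) 1 ∂(PR.M (xs i)) 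
      + cN * ∫ ξ in {ξ : V | ρ / ((k:ℝ) + 1) ≤ ‖ξ‖}ᶜ, min (‖ξ‖^2) 1 ∂(PR.M (ys i)))) atTop (𝓝 0) := by
    have : (0:ℝ) = ∑ i : Fin n, (cN * 0 + cN * 0) := by simp
    rw [this]
    refine tendsto_finsetSum _ fun i _ => ?_
    exact ((small_tendsto (PR.M_zero _ (hxs i)) (PR_intq PR (hxs i)) h0).const_mul _).add 
      ((small_tendsto (PR.M_zero _ (hys i)) (PR_intq PR (hys i)) h0).const_mul _)
  have t2 : Tendsto (fun k : ℕ => (1 + N) * ∫ ξ in {ξ : V | ρ / ((k:ℝ) + 1) ≤ ‖ξ‖}ᶜ, min ‖ξ‖ 1 ∂PF.m) atTop (𝓝 0) := by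
    simpa using (small_tendsto PF.m_zero (PF_intq PF) h0).const_mul (1 + N)
  obtain ⟨k, hk1, hk2⟩ := ((t1.eventually (gt_mem_nhds hε)).and (t2.eventually (gt_mem_nhds hε))).exists
  set δ := ρ / ((k:ℝ) + 1) with hδ
  have hδ0 : 0 < δ := by positivity
  have hδρ : δ ≤ ρ := div_le_self h0.le (by linarith [(Nat.cast_nonneg k : (0:ℝ) ≤ k)])
  obtain ⟨B, G, Φ, b1, b2, b3, b4, b5, b6⟩ := build hK hχ PF PR hadm hQ hδ0 (hδρ.trans h1) 
    (fun ξ hξ => h2 ξ (hξ.trans_le hδρ))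
  set A : Set V := {ξ : V | δ ≤ ‖ξ‖} with hA
  have hAm : MeasurableSet A := A_meas δ
  have hup : ∀ x ∈ K, ∀ s : Set V, ∫ ξ in s, min (‖ξ‖^2) 1 ∂(PR.M x) ≤ Θ * ‖x‖ := fun x hx s => 
    (setIntegral_le_integral (PR_intq PR hx) (Eventually.of_forall hq0)).trans (hΘ x hx)
  have hnx : ∀ x ∈ K, C₀ * ‖x‖ ≤ C₀ / c * ⟪e, x⟫ := by
    intro x hx
    rw [div_mul_eq_mul_div, le_div_iff₀ hc]
    nlinarith [mul_le_mul_of_nonneg_left (he x hx) hC₀0]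
  have hr2 : 0 < (ρ^2)⁻¹ := by positivity
  have hne := norm_nonneg e
  refine ⟨B, G, Φ, b1, b2, b3, b4, ?_, ?_, ?_⟩
  · intro s hs0 hs1 x hx
    have hsd := dual_smul hs0 hed
    rw [b5 _ hsd x hx]
    have g1 : -(‖PR.B e‖ * ‖x‖) ≤ ⟪PR.B e, x⟫ := (abs_le.1 (abs_real_inner_le_norm _ _)).1
    have g2 : 0 ≤ ⟪PR.γ, x⟫ := mem_dual_iff.1 PR.γ_mem x hx
    have g3 : ∫ ξ in A, (Real.exp (-⟪s • e, ξ⟫) - 1 + ⟪χ ξ, s • e⟫) ∂(PR.M x) ≤ 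
        ∫ ξ in A, (‖s • e‖^2 + ‖s • e‖) * (ρ^2)⁻¹ * min (‖ξ‖^2) 1 ∂(PR.M x) := by
      refine integral_mono_ae (PR_inth hχ PR hx hsd).integrableOn ((PR_intq PR hx).const_mul _).integrableOn ?_
      filter_upwards [ae_restrict_of_ae (PR_ae PR hx)] with ξ hξ
      have := (h_bounds h0 h1 hχ.2.1 h2 hsd hξ).2
      beta_reduce; linarith
    rw [integral_const_mul] at g3
    have g4 := hup x hx A
    rw [norm_smul, Real.norm_eq_abs, abs_of_nonneg hs0] at g3
    have g5 : ((s*‖e‖)^2 + s * ‖e‖) * (ρ^2)⁻¹ * ∫ ξ in A, min (‖ξ‖^2) 1 ∂(PR.M x) ≤ 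
        s * ((1 + ‖e‖ + ‖e‖^2) * (ρ^2)⁻¹) * (Θ * ‖x‖) := by
      refine mul_le_mul ?_ g4 (integral_nonneg hq0) (by positivity)
      rw [← mul_assoc]
      refine mul_le_mul_of_nonneg_right ?_ hr2.le
      nlinarith [mul_nonneg hs0 (sub_nonneg.2 hs1), sq_nonneg ‖e‖, mul_nonneg (mul_nonneg hs0 (sub_nonneg.2 hs1)) (sq_nonneg ‖e‖)]
    have g6 := mul_le_mul_of_nonneg_left (hnx x hx) hs0
    have g7 := mul_le_mul_of_nonneg_left g1 hs0
    rw [map_smul, inner_smul_left, conj_trivial]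
    have g8 : 0 ≤ s * (‖PR.γ‖ * ‖x‖) := by positivity
    rw [hC₀] at g6 
    have e1 : s * ((‖PR.B e‖ + ‖PR.γ‖ + (1 + ‖e‖ + ‖e‖ ^ 2) * (ρ ^ 2)⁻¹ * Θ) * ‖x‖) = 
      s * (‖PR.B e‖ * ‖x‖) + s * (‖PR.γ‖ * ‖x‖) + s * ((1 + ‖e‖ + ‖e‖^2) * (ρ^2)⁻¹) * (Θ * ‖x‖) := by ring
    rw [e1] at g6
    linarith
  · intro s hs0 x hx
    have hsd := dual_smul hs0 hed
    rw [b5 _ hsd x hx]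
    have g1 : ⟪PR.B e, x⟫ ≤ ‖PR.B e‖ * ‖x‖ := real_inner_le_norm _ _
    have g2 : ⟪PR.γ, x⟫ ≤ ‖PR.γ‖ * ‖x‖ := real_inner_le_norm _ _
    have g3 : ∫ ξ in A, (-((1 + ‖s • e‖) * (ρ^2)⁻¹)) * min (‖ξ‖^2) 1 ∂(PR.M x) ≤ 
       ∫ ξ in A, (Real.exp (-⟪s • e, ξ⟫) - 1 + ⟪χ ξ, s • e⟫) ∂(PR.M x) := by
      refine integral_mono_ae ((PR_intq PR hx).const_mul _).integrableOn (PR_inth hχ PR hx hsd).integrableOn ?_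
      filter_upwards [ae_restrict_of_ae (PR_ae PR hx)] with ξ hξ
      have := (h_bounds h0 h1 hχ.2.1 h2 hsd hξ).1
      beta_reduce; linarith
    rw [integral_const_mul] at g3
    have g4 := hup x hx A
    rw [norm_smul, Real.norm_eq_abs, abs_of_nonneg hs0] at g3
    have g5 : ((1 + s * ‖e‖) * (ρ^2)⁻¹) * ∫ ξ in A, min (‖ξ‖^2) 1 ∂(PR.M x) ≤ 
        (1 + s) * ((1 + ‖e‖ + ‖e‖^2) * (ρ^2)⁻¹) * (Θ * ‖x‖) := by
      refine mul_le_mul ?_ g4 (integral_nonneg hq0) (by positivity)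
      rw [← mul_assoc]
      refine mul_le_mul_of_nonneg_right ?_ hr2.le
      nlinarith [sq_nonneg ‖e‖, mul_nonneg hs0 (sq_nonneg ‖e‖)]
    have g6 := mul_le_mul_of_nonneg_left (hnx x hx) (by linarith : 0 ≤ 1 + s)
    have g7 := mul_le_mul_of_nonneg_left g1 hs0
    rw [map_smul, inner_smul_left, conj_trivial]
    have g8 : 0 ≤ s * (‖PR.γ‖ * ‖x‖) := by positivity
    have g9 : 0 ≤ ‖PR.B e‖ * ‖x‖ := by positivity
    rw [hC₀] at g6 
    have e1 : (1 + s) * ((‖PR.B e‖ + ‖PR.γ‖ + (1 + ‖e‖ + ‖e‖ ^ 2) * (ρ ^ 2)⁻¹ * Θ) * ‖x‖) = 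
      ‖PR.B e‖ * ‖x‖ + ‖PR.γ‖ * ‖x‖ + s * (‖PR.B e‖ * ‖x‖) + s * (‖PR.γ‖ * ‖x‖) 
        + (1 + s) * ((1 + ‖e‖ + ‖e‖^2) * (ρ^2)⁻¹) * (Θ * ‖x‖) := by ring
    rw [e1] at g6
    linarith
  · intro u hu hun
    have hin : ∀ x ∈ K, |⟪B u + G u - R u, x⟫| ≤ cN * ∫ ξ in Aᶜ, min (‖ξ‖^2) 1 ∂(PR.M x) := by
      intro x hx
      rw [inner_sub_left, b5 u hu x hx, R_inner PR hQ hu hx, ← integral_add_compl hAm (PR_inth hχ PR hx hu)]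
      rw [show ∀ a b c d : ℝ, a + b - c - (a + b - (c + d)) = d from fun a b c d => by ring, ← integral_const_mul]
      refine norm_integral_le_of_norm_le (f := fun ξ => Real.exp (-⟪u, ξ⟫) - 1 + ⟪χ ξ, u⟫) 
        ((PR_intq PR hx).const_mul _).integrableOn ?_
      filter_upwards [ae_restrict_of_ae (PR_ae PR hx)] with ξ hξ
      refine (h_abs h0 h1 hχ.2.1 h2 hu hξ).trans ?_
      have := hq0 ξ
      rw [hcN]
      gcongr
    constructor
    · refine (hframe _).trans (le_trans (Finset.sum_le_sum fun i _ => ?_) hk1.le)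
      exact add_le_add (hin _ (hxs i)) (hin _ (hys i))
    · rw [b6 u hu, PF.eq u hu, ← integral_add_compl hAm (PF_inth PF hu)]
      rw [show ∀ a b c d : ℝ, a + b - c - (a + b - (c + d)) = d from fun a b c d => by ring]
      refine le_trans ?_ hk2.le
      rw [← integral_const_mul]
      refine norm_integral_le_of_norm_le (f := fun ξ => Real.exp (-⟪u, ξ⟫) - 1) 
        ((PF_intq PF).const_mul _).integrableOn ?_
      filter_upwards [ae_restrict_of_ae (PF_ae PF)] with ξ hξ
      refine (one_sub_exp_bd hu hξ).trans ?_
      have := hq0' ξ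
      gcongr

end Build


section Scheme
variable {K : Set V} {χ : V → V} {F : V → ℝ} {R : V → V}

theorem pos_inv (hK : IsProperConvexCone K) {e : V} {c : ℝ} (hc : 0 < c) (he : ∀ x ∈ K, c * ‖x‖ ≤ ⟪e, x⟫) 
    {B : V →ₗ[ℝ] V} (qm : ∀ u ∈ dualCone K, ∀ x ∈ K, ⟪u, x⟫ = 0 → 0 ≤ ⟪B u, x⟫) {h D : ℝ} (hh : 0 ≤ h) 
    (hD : ∀ x ∈ K, ⟪B e, x⟫ ≤ D * ⟪e, x⟫) (hhD : h * D < 1) {w : V} (hw : w - h • B w ∈ dualCone K) :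
    w ∈ dualCone K := by
  by_contra hcon
  rw [mem_dual_iff] at hcon
  push Not at hcon
  obtain ⟨x, hx, hxw⟩ := hcon
  have hpos : ∀ x ∈ K ∩ Metric.sphere 0 1, 0 < ⟪e, x⟫ := by
    intro x hx
    have h1 := he x hx.1
    have h2 : ‖x‖ = 1 := by simpa using hx.2
    rw [h2] at h1; linarith
  have hcomp : IsCompact (K ∩ Metric.sphere (0:V) 1) := (isCompact_sphere _ _).inter_left hK.isClosed
  have hx0 : x ≠ 0 := by rintro rfl; simp at hxw
  have hnx : 0 < ‖x‖ := norm_pos_iff.2 hx0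
  have nrm : ∀ z ∈ K, z ≠ 0 → ‖z‖⁻¹ • z ∈ K ∩ Metric.sphere (0:V) 1 := by
    intro z hz hz0
    refine ⟨hK.smul_mem _ (by positivity) _ hz, ?_⟩
    have := norm_pos_iff.2 hz0
    simp [norm_smul, this.ne']
  obtain ⟨x0, hx0m, hmin⟩ := hcomp.exists_isMinOn ⟨_, nrm x hx hx0⟩ (f := fun x => ⟪w, x⟫ / ⟪e, x⟫)
    (ContinuousOn.div (by fun_prop) (by fun_prop) fun x hx => (hpos x hx).ne')
  set s := -(⟪w, x0⟫ / ⟪e, x0⟫) with hs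
  have key : ∀ z ∈ K, -s * ⟪e, z⟫ ≤ ⟪w, z⟫ := by
    intro z hz
    by_cases hz0 : z = 0
    · simp [hz0]
    have hm := nrm z hz hz0
    have h1 := isMinOn_iff.1 hmin _ hm
    have h2 := hpos _ hm
    rw [le_div_iff₀ h2] at h1
    have hnz : 0 < ‖z‖ := norm_pos_iff.2 hz0
    rw [inner_smul_right, inner_smul_right] at h1
    have : ‖z‖⁻¹ * (-s * ⟪e, z⟫) ≤ ‖z‖⁻¹ * ⟪w, z⟫ := by rw [hs]; linarith
    exact le_of_mul_le_mul_left this (by positivity)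
  have hspos : 0 < s := by
    have h1 := key x hx
    have h2 : 0 ≤ ⟪e, x⟫ := le_trans (by positivity) (he x hx)
    by_contra hn
    nlinarith [mul_nonneg (by linarith : 0 ≤ -s) h2]
  have hd : w + s • e ∈ dualCone K := mem_dual_iff.2 fun z hz => by
    rw [inner_add_left, inner_smul_left, conj_trivial]; linarith [key z hz]
  have h0 : ⟪w, x0⟫ = -s * ⟪e, x0⟫ := by
    rw [hs]; field_simp [(hpos x0 hx0m).ne']
  have h1 := qm _ hd x0 hx0m.1 (by rw [inner_add_left, inner_smul_left, conj_trivial, h0]; ring)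
  rw [map_add, map_smul, inner_add_left, inner_smul_left, conj_trivial] at h1
  have h2 := mem_dual_iff.1 hw x0 hx0m.1
  rw [inner_sub_left, inner_smul_left, conj_trivial, h0] at h2
  have h3 := hD x0 hx0m.1
  have h4 := hpos x0 hx0m
  have h5 := mul_nonneg hh h1
  have h6 := mul_le_mul_of_nonneg_left h3 (mul_nonneg hh hspos.le)
  have h7 : 0 < (1 - h * D) * (s * ⟪e, x0⟫) := mul_pos (by linarith) (mul_pos hspos h4)
  nlinarith

structure Sch (K : Set V) (e : V) (R : V → V) (F : V → ℝ) (C N ε h : ℝ) (S : V → V)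
    (Φ : V → ℝ) : Prop where
  rep : AffRep K (fun u => h * Φ u) S
  mem : ∀ u ∈ dualCone K, S u ∈ dualCone K
  low : ∀ u ∈ dualCone K, ∀ s : ℝ, 0 ≤ s → s ≤ 1 → u - s • e ∈ dualCone K → 
    S u - (s * (1 + C * h)⁻¹) • e ∈ dualCone K
  up : ∀ u ∈ dualCone K, ∀ s : ℝ, 0 ≤ s → s • e - u ∈ dualCone K → 
    ((1 + s) * (1 - C * h)⁻¹ - 1) • e - S u ∈ dualCone K
  close : ∀ u ∈ dualCone K, ‖u‖ ≤ N → ‖S u‖ ≤ N → ‖S u - u - h • R u‖ ≤ h * (2 * ε) ∧ |Φ u - F u| ≤ ε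

theorem Appr.sch (hK : IsProperConvexCone K) {e : V} {c : ℝ} (hc : 0 < c) (he : ∀ x ∈ K, c * ‖x‖ ≤ ⟪e, x⟫) 
    {C N ε : ℝ} (hC : 0 ≤ C) (hN : 0 ≤ N) (hε : 0 < ε) {B : V →ₗ[ℝ] V} {G : V → V} {Φ : V → ℝ} 
    (hA : Appr K e R F C N ε B G Φ) {L : ℝ} (hL : 0 ≤ L) (hR : ∀ u ∈ dualCone K, ‖u‖ ≤ N → ‖R u‖ ≤ L) :
    ∃ h₀ : ℝ, 0 < h₀ ∧ ∀ h, 0 ≤ h → h ≤ h₀ → 2 * (C * h) < 1 ∧ ∃ S, Sch K e R F C N ε h S Φ := by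
  obtain ⟨b, hb0, hb⟩ := B_bd B
  have hed : e ∈ dualCone K := mem_dual_iff.2 fun x hx => le_trans (by positivity) (he x hx)
  refine ⟨min ((2 * C + 1)⁻¹ / 2) (ε / (b * (2 * b * N + L + ε) + 1)), by positivity, fun h hh hhle => ?_⟩
  have hh1 : 2 * (C * h) < 1 := by
    have h1 := hhle.trans (min_le_left _ _)
    have h2 : 0 < 2 * C + 1 := by linarith
    have h3 : (2 * C + 1)⁻¹ * (2 * C + 1) = 1 := inv_mul_cancel₀ h2.ne'
    nlinarith [mul_le_mul_of_nonneg_left h1 h2.le]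
  have hh2 : b * (2 * b * N + L + ε) * h ≤ ε := by
    have h1 := hhle.trans (min_le_right _ _)
    have h2 : 0 ≤ b * (2 * b * N + L + ε) := by positivity
    rw [le_div_iff₀ (by linarith)] at h1
    linarith
  refine ⟨hh1, ?_⟩
  have hD : ∀ x ∈ K, ⟪B e, x⟫ ≤ 2 * C * ⟪e, x⟫ := by
    intro x hx
    have h1 := hA.up 1 zero_le_one x hx
    have h2 := mem_dual_iff.1 (hA.G_mem e hed) x hx
    rw [one_smul, inner_add_left] at h1
    linarith
  have hpos : ∀ {w : V}, w - h • B w ∈ dualCone K → w ∈ dualCone K := fun {w} hw => 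
    pos_inv hK hc he hA.qm hh hD (by linarith) hw
  have hinj : Function.Injective (LinearMap.id - h • B : V →ₗ[ℝ] V) := by
    rw [← LinearMap.ker_eq_bot, LinearMap.ker_eq_bot']
    intro w hw
    have h1 : w - h • B w = 0 := hw
    have h2 : w ∈ dualCone K := hpos (by rw [h1]; exact dual_zero)
    have h3 : -w ∈ dualCone K := hpos (by
      rw [map_neg, smul_neg, sub_neg_eq_add, neg_add_eq_sub, ← neg_sub, h1, neg_zero]; exact dual_zero)
    refine vec_ext hK fun x hx => ?_
    have h4 := mem_dual_iff.1 h2 x hx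
    have h5 := mem_dual_iff.1 h3 x hx
    rw [inner_neg_left] at h5
    rw [inner_zero_left]; linarith
  let Eq := LinearEquiv.ofInjectiveEndo _ hinj
  have hE : ∀ v, Eq.symm v - h • B (Eq.symm v) = v := fun v => Eq.apply_symm_apply v
  have hJ : ∀ v ∈ dualCone K, Eq.symm v ∈ dualCone K := fun v hv => hpos (by rw [hE]; exact hv)
  have hSeq : ∀ u, Eq.symm (u + h • G u) - h • B (Eq.symm (u + h • G u)) = u + h • G u := fun u => hE _
  have hmem : ∀ u ∈ dualCone K, Eq.symm (u + h • G u) ∈ dualCone K := fun u hu => 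
    hJ _ (dual_add hu (dual_smul hh (hA.G_mem u hu)))
  have heK : ∀ x ∈ K, 0 ≤ ⟪e, x⟫ := mem_dual_iff.1 hed
  refine ⟨fun u => Eq.symm (u + h • G u), ?_, hmem, ?_, ?_, ?_⟩
  · intro x hx
    set y := LinearMap.adjoint Eq.symm.toLinearMap x with hy
    have hyu : ∀ v, ⟪v, y⟫ = ⟪Eq.symm v, x⟫ := fun v => by rw [hy, LinearMap.adjoint_inner_right]; rfl
    have hyK : y ∈ K := hK.bidual fun u hu => by rw [hyu]; exact mem_dual_iff.1 (hJ u hu) x hx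
    refine ((LRep.dirac hK hyK).mul hK (hA.rep h hh y hyK)).congr fun u hu => ?_
    beta_reduce
    rw [← Real.exp_add, ← hyu, inner_add_left]
    congr 1; ring
  · intro u hu s hs0 hs1 hus
    refine hpos ?_
    have hse := dual_smul hs0 hed
    set θ := (1 + C * h)⁻¹ with hθ
    have hCh : 0 ≤ C * h := mul_nonneg hC hh
    have hθ0 : 0 < θ := by rw [hθ]; positivity
    have hθ1 : θ * (1 + C * h) = 1 := inv_mul_cancel₀ (by positivity)
    have e1 : Eq.symm (u + h • G u) - (s * θ) • e - h • B (Eq.symm (u + h • G u) - (s * θ) • e) = 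
        u + h • G u - (s * θ) • e + (h * (s * θ)) • B e := by
      rw [map_sub, map_smul]; linear_combination (norm := module) (1:ℝ) • hSeq u
    rw [e1, mem_dual_iff]
    intro x hx
    have g1 := mem_dual_iff.1 hus x hx
    have g2 := mem_dual_iff.1 (hA.G_mono _ hse _ hu hus) x hx
    have g3 := hA.low s hs0 hs1 x hx
    have g4 := mem_dual_iff.1 (hA.G_mem _ hse) x hx
    rw [map_smul] at g3
    simp only [inner_add_left, inner_sub_left, inner_smul_left, conj_trivial] at g1 g2 g3 g4 ⊢
    have g5 := mul_le_mul_of_nonneg_left g3 (mul_nonneg hh hθ0.le)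
    have g6 := mul_nonneg hh g2
    have hθ' : θ ≤ 1 := by nlinarith
    have g7 := mul_nonneg (mul_nonneg hh (sub_nonneg.2 hθ')) g4
    have g8 : s * ⟪e, x⟫ * (θ * (1 + C * h)) = s * ⟪e, x⟫ := by rw [hθ1, mul_one]
    nlinarith
  · intro u hu s hs0 hus
    refine hpos ?_
    set θ := (1 - C * h)⁻¹ with hθ
    have hCh : 0 ≤ C * h := mul_nonneg hC hh
    have hθ0 : 0 < θ := by rw [hθ]; exact inv_pos.2 (by linarith)
    have hθ1 : θ * (1 - C * h) = 1 := inv_mul_cancel₀ (by linarith)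
    have hθ' : 1 ≤ θ := by nlinarith
    set s' := (1 + s) * θ - 1 with hs'
    have hss : s ≤ s' := by rw [hs']; nlinarith
    have hs'0 : 0 ≤ s' := hs0.trans hss
    have hse := dual_smul hs'0 hed
    have hus' : s' • e - u ∈ dualCone K := by
      have : s' • e - u = (s' - s) • e + (s • e - u) := by module
      rw [this]; exact dual_add (dual_smul (by linarith) hed) hus
    have e1 : s' • e - Eq.symm (u + h • G u) - h • B (s' • e - Eq.symm (u + h • G u)) = 
        s' • e - (h * s') • B e - (u + h • G u) := by
      rw [map_sub, map_smul]; linear_combination (norm := module) (-1:ℝ) • hSeq u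
    rw [e1, mem_dual_iff]
    intro x hx
    have g1 := mem_dual_iff.1 hus x hx
    have g2 := mem_dual_iff.1 (hA.G_mono _ hu _ hse hus') x hx
    have g3 := hA.up s' hs'0 x hx
    rw [map_smul] at g3
    simp only [inner_add_left, inner_sub_left, inner_smul_left, conj_trivial] at g1 g2 g3 ⊢
    have g5 := mul_le_mul_of_nonneg_left g3 hh
    have g6 := mul_nonneg hh g2
    have g8 : (1 + s') * (1 - C * h) = 1 + s := by
      rw [hs']; linear_combination (1 + s) * hθ1
    have g9 : (1 + s') * (1 - C * h) * ⟪e, x⟫ = (1 + s) * ⟪e, x⟫ := by rw [g8]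
    nlinarith
  · intro u hu hun hSn
    obtain ⟨c1, c2⟩ := hA.close u hu hun
    refine ⟨?_, c2⟩
    set w := Eq.symm (u + h • G u) with hw
    have q1 : w - u = h • (B w + G u) := by
      have := hSeq u; rw [← hw] at this
      rw [smul_add, ← sub_eq_zero]; rw [← sub_eq_zero] at this
      rw [← this]; abel
    have q2 : w - u - h • R u = h • ((B u + G u - R u) + B (w - u)) := by
      rw [q1]; rw [← smul_sub]; congr 1
      rw [← q1, map_sub]; abel
    have q3 : ‖B w + G u‖ ≤ 2 * b * N + L + ε := by
      have : B w + G u = B w - B u + (B u + G u - R u) + R u := by abel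
      rw [this]
      have h1 := norm_add_le (B w - B u + (B u + G u - R u)) (R u)
      have h2 := norm_add_le (B w - B u) (B u + G u - R u)
      have h3 := norm_sub_le (B w) (B u)
      have h4 := hb w
      have h5 := hb u
      have h6 := hR u hu hun
      have h7 := mul_le_mul_of_nonneg_left hSn hb0
      have h8 := mul_le_mul_of_nonneg_left hun hb0
      linarith
    have q4 : ‖B (w - u)‖ ≤ ε := by
      refine (hb _).trans ?_
      rw [q1, norm_smul, Real.norm_eq_abs, abs_of_nonneg hh]
      calc b * (h * ‖B w + G u‖) ≤ b * (h * (2 * b * N + L + ε)) := by gcongr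
        _ ≤ ε := by linarith
    rw [q2, norm_smul, Real.norm_eq_abs, abs_of_nonneg hh]
    refine mul_le_mul_of_nonneg_left ?_ hh
    linarith [norm_add_le (B u + G u - R u) (B (w - u))]

theorem exists_Sch (hK : IsProperConvexCone K) (hχ : IsTruncation χ) (PF : FParams K F) (PR : RParams K χ R) 
    (hadm : PR.Admissible) (hQ : PR.Q = 0) {e : V} {c : ℝ} (hc : 0 < c) (he : ∀ x ∈ K, c * ‖x‖ ≤ ⟪e, x⟫) :
    ∃ C : ℝ, 0 ≤ C ∧ ∀ N ε T : ℝ, 0 ≤ N → 0 < ε → 0 ≤ T → ∃ (n : ℕ) (S : V → V) (Φ : V → ℝ), 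
      0 < n ∧ T / n ≤ ε ∧ 2 * (C * (T / n)) < 1 ∧ Sch K e R F C N ε (T / n) S Φ := by
  obtain ⟨C, hC, hA⟩ := exists_Appr hK hχ PF PR hadm hQ hc he
  refine ⟨C, hC, fun N ε T hN hε hT => ?_⟩
  obtain ⟨B, G, Φ, hA⟩ := hA N ε hN hε
  obtain ⟨L, hL, hR⟩ := R_bdd hK hχ PR hQ N hN
  obtain ⟨h₀, hh0, H⟩ := hA.sch hK hc he hC hN hε hL hR
  have ht := tendsto_const_div_atTop_nhds_zero_nat T
  obtain ⟨n, ⟨h1, h2⟩, h3⟩ := (((ht.eventually (gt_mem_nhds hε)).and (ht.eventually (gt_mem_nhds hh0))).and 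
    (eventually_gt_atTop 0)).exists
  obtain ⟨h4, S, hS⟩ := H (T / n) (by positivity) h2.le
  exact ⟨n, S, Φ, h3, h1.le, h4, hS⟩

end Scheme


theorem euler_err {E : Type*} [NormedAddCommGroup E] [NormedSpace ℝ E] {f : E → E} {L M : ℝ} (hL0 : 0 ≤ L)
    (hL : ∀ x y, ‖f x - f y‖ ≤ L * ‖x - y‖) (hM : ∀ x, ‖f x‖ ≤ M) {T : ℝ} (hT : 0 ≤ T) {y : ℝ → E}
    (hy : ∀ t ∈ Icc 0 T, HasDerivWithinAt y (f (y t)) (Icc 0 T) t) {n : ℕ} (hn : 0 < n) {h : ℝ} (hh : h = T / n)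
    {a : ℕ → E} (ha0 : a 0 = y 0) {η : ℝ} (hη : 0 ≤ η) 
    (ha : ∀ k < n, ‖a (k+1) - a k - h • f (a k)‖ ≤ h * η) :
    ‖a n - y T‖ ≤ T * (η + L * M * h) * Real.exp (L * T) := by
  have hn0 : (0:ℝ) < n := by exact_mod_cast hn
  have hh0 : 0 ≤ h := by rw [hh]; positivity
  have hM0 : 0 ≤ M := (norm_nonneg _).trans (hM 0)
  have hnh : n * h = T := by rw [hh]; field_simp
  have loc : ∀ t, 0 ≤ t → t + h ≤ T → ‖y (t + h) - y t - h • f (y t)‖ ≤ L * M * h * h := by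
    intro t ht hth
    have hsub : Icc t (t + h) ⊆ Icc 0 T := Icc_subset_Icc ht hth
    have hd : ∀ s ∈ Icc t (t+h), HasDerivWithinAt y (f (y s)) (Icc t (t + h)) s := fun s hs => 
      (hy s (hsub hs)).mono hsub
    have b1 := norm_image_sub_le_of_norm_deriv_le_segment' hd (fun s _ => hM (y s))
    have hd2 : ∀ s ∈ Icc t (t+h), HasDerivWithinAt (fun s => y s - (s - t) • f (y t)) (f (y s) - f (y t)) 
        (Icc t (t + h)) s := by
      intro s hs
      have h1 : HasDerivWithinAt (fun s : ℝ => (s - t) • f (y t)) ((1:ℝ) • f (y t)) (Icc t (t+h)) s := 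
        ((hasDerivWithinAt_id s _).sub_const t).smul_const _
      rw [one_smul] at h1
      exact (hd s hs).sub h1
    have b2 := norm_image_sub_le_of_norm_deriv_le_segment' hd2 (C := L * M * h) (fun s hs => by
      refine (hL _ _).trans ?_
      have h1 := b1 s (Ico_subset_Icc_self hs)
      have h2 : M * (s - t) ≤ M * h := mul_le_mul_of_nonneg_left (by linarith [hs.2]) hM0
      rw [mul_assoc]
      exact mul_le_mul_of_nonneg_left (h1.trans h2) hL0) (t + h) (right_mem_Icc.2 (by linarith))
    have e1 : y (t + h) - (t + h - t) • f (y t) - (y t - (t - t) • f (y t)) = y (t + h) - y t - h • f (y t) := by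
      rw [add_sub_cancel_left, sub_self, zero_smul, sub_zero]; abel
    rw [e1, add_sub_cancel_left] at b2
    exact b2
  set ζ := η + L * M * h with hζ
  have hζ0 : 0 ≤ ζ := by positivity
  have ind : ∀ k : ℕ, k ≤ n → ‖a k - y (k * h)‖ ≤ k * (h * ζ) * (1 + L * h)^k := by
    intro k
    induction k with
    | zero => intro _; simp [ha0]
    | succ k ih =>
      intro hk
      have ih := ih (by omega)
      have h1 := ha k (by omega)
      have hk' : ((k:ℝ) + 1) * h ≤ T := by
        rw [← hnh]; refine mul_le_mul_of_nonneg_right ?_ hh0; exact_mod_cast hk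
      have h2 := loc (k * h) (by positivity) (by linarith)
      have h3 := hL (a k) (y (k * h))
      have e1 : a (k+1) - y (k * h + h) = (a (k+1) - a k - h • f (a k)) + (a k - y (k*h)) + 
        h • (f (a k) - f (y (k * h))) - (y (k * h + h) - y (k * h) - h • f (y (k * h))) := by
        rw [smul_sub]; abel
      have e2 : ((k + 1 : ℕ) : ℝ) * h = k * h + h := by push_cast; ring
      rw [e2, e1]
      have n1 := norm_sub_le ((a (k+1) - a k - h • f (a k)) + (a k - y (k*h)) + 
        h • (f (a k) - f (y (k * h)))) (y (k * h + h) - y (k * h) - h • f (y (k * h)))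
      have n2 := norm_add_le ((a (k+1) - a k - h • f (a k)) + (a k - y (k*h))) (h • (f (a k) - f (y (k * h))))
      have n3 := norm_add_le (a (k+1) - a k - h • f (a k)) (a k - y (k*h))
      rw [norm_smul, Real.norm_eq_abs, abs_of_nonneg hh0] at n2
      have n4 := mul_le_mul_of_nonneg_left h3 hh0
      have n5 : ‖a k - y (k*h)‖ * (1 + L * h) ≤ k * (h * ζ) * (1 + L * h)^k * (1 + L * h) := 
        mul_le_mul_of_nonneg_right ih (by positivity)
      have n6 : (1:ℝ) ≤ (1 + L * h)^(k+1) := one_le_pow₀ (by nlinarith [mul_nonneg hL0 hh0])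
      have n7 := mul_le_mul_of_nonneg_left n6 (mul_nonneg hh0 hζ0)
      have e3 : h * ζ = h * η + L * M * h * h := by rw [hζ]; ring
      push_cast
      rw [pow_succ] at n7 ⊢
      nlinarith
  have fin := ind n le_rfl
  rw [hnh] at fin
  refine fin.trans ?_
  have e1 : n * (h * ζ) = T * ζ := by rw [← mul_assoc, hnh]
  rw [e1]
  refine mul_le_mul_of_nonneg_left ?_ (by positivity)
  have : (1 + L * h) ≤ Real.exp (L * h) := by linarith [Real.add_one_le_exp (L * h)]
  calc (1 + L * h)^n ≤ (Real.exp (L * h))^n := pow_le_pow_left₀ (by positivity) this n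
    _ = Real.exp (L * T) := by rw [← Real.exp_nat_mul, ← hnh]; congr 1; ring

theorem picard_global {E : Type*} [NormedAddCommGroup E] [NormedSpace ℝ E] [CompleteSpace E] {f : E → E} 
    {L M : ℝ} (hL0 : 0 ≤ L)
    (hL : ∀ x y, ‖f x - f y‖ ≤ L * ‖x - y‖) (hM : ∀ x, ‖f x‖ ≤ M) {T : ℝ} (hT : 0 ≤ T) (x₀ : E) :
    ∃ y : ℝ → E, y 0 = x₀ ∧ ∀ t ∈ Icc 0 T, HasDerivWithinAt y (f (y t)) (Icc 0 T) t := by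
  have hM0 : 0 ≤ M := (norm_nonneg _).trans (hM 0)
  have hP : IsPicardLindelof (fun _ => f) (⟨0, left_mem_Icc.2 hT⟩ : Icc (0:ℝ) T) x₀ 
      (⟨M * T, by positivity⟩ : NNReal) 0 (⟨M, hM0⟩ : NNReal) (⟨L, hL0⟩ : NNReal) := by
    refine IsPicardLindelof.of_time_independent (fun x _ => hM x) ?_ ?_
    · refine LipschitzWith.lipschitzOnWith (LipschitzWith.of_dist_le_mul fun x y => ?_)
      rw [dist_eq_norm, dist_eq_norm]; exact hL x y
    · simp [hT]
      exact le_rfl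
  exact hP.exists_eq_forall_mem_Icc_hasDerivWithinAt₀

theorem exists_proj {A : Set V} (hne : A.Nonempty) (hc : IsClosed A) (hconv : Convex ℝ A) :
    ∃ P : V → V, (∀ u, P u ∈ A) ∧ (∀ u ∈ A, P u = u) ∧ ∀ u v, ‖P u - P v‖ ≤ ‖u - v‖ := by
  choose P hPA hP using exists_norm_eq_iInf_of_complete_convex hne hc.isComplete hconv
  have hP' : ∀ u, ∀ w ∈ A, ⟪u - P u, w - P u⟫ ≤ 0 := fun u => 
    (norm_eq_iInf_iff_real_inner_le_zero hconv (hPA u)).1 (hP u)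
  refine ⟨P, hPA, fun u hu => ?_, fun u v => ?_⟩
  · have := hP' u u hu
    rw [real_inner_self_eq_norm_sq] at this
    have h2 : ‖u - P u‖ = 0 := by nlinarith [norm_nonneg (u - P u)]
    exact (sub_eq_zero.1 (norm_eq_zero.1 h2)).symm
  · have h1 := hP' u _ (hPA v)
    have h2 := hP' v _ (hPA u)
    have h3 : ⟪u - v, P u - P v⟫ - ‖P u - P v‖^2 ≥ 0 := by
      rw [← real_inner_self_eq_norm_sq, ← inner_sub_left]
      have e1 : u - v - (P u - P v) = (u - P u) - (v - P v) := by abel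
      rw [e1, inner_sub_left]
      have e2 : ⟪u - P u, P u - P v⟫ = - ⟪u - P u, P v - P u⟫ := by rw [← inner_neg_right, neg_sub]
      rw [e2]; linarith
    have h4 := real_inner_le_norm (u - v) (P u - P v)
    by_contra hcon
    push Not at hcon
    nlinarith [norm_nonneg (u - v), norm_nonneg (P u - P v)]

section Flow
variable {K : Set V} {χ : V → V} {F : V → ℝ} {R : V → V}

theorem Bx.isClosed {κ N : ℝ} : IsClosed (Bx K κ N) := by
  have : Bx K κ N = (⋂ ξ ∈ K, {u : V | κ * ‖ξ‖ ≤ ⟪u, ξ⟫}) ∩ {u | ‖u‖ ≤ N} := by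
    ext u; simp [Bx]
  rw [this]
  refine IsClosed.inter (isClosed_biInter fun ξ _ => isClosed_le (by fun_prop) (by fun_prop)) 
    (isClosed_le (by fun_prop) (by fun_prop))

theorem Bx.convex {κ N : ℝ} : Convex ℝ (Bx K κ N) := by
  intro u hu v hv a b ha hb hab
  refine ⟨fun ξ hξ => ?_, ?_⟩
  · rw [inner_add_left, inner_smul_left, inner_smul_left, conj_trivial, conj_trivial]
    have h1 := mul_le_mul_of_nonneg_left (hu.1 ξ hξ) ha
    have h2 := mul_le_mul_of_nonneg_left (hv.1 ξ hξ) hb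
    have h3 : κ * ‖ξ‖ = a * (κ * ‖ξ‖) + b * (κ * ‖ξ‖) := by rw [← add_mul, hab, one_mul]
    linarith
  · refine (norm_add_le _ _).trans ?_
    rw [norm_smul, norm_smul, Real.norm_eq_abs, Real.norm_eq_abs, abs_of_nonneg ha, abs_of_nonneg hb]
    have h1 := mul_le_mul_of_nonneg_left hu.2 ha
    have h2 := mul_le_mul_of_nonneg_left hv.2 hb
    have h3 : N = a * N + b * N := by rw [← add_mul, hab, one_mul]
    linarith

theorem Bx.mono {κ N κ' N' : ℝ} (h1 : κ' ≤ κ) (h2 : N ≤ N') : Bx K κ N ⊆ Bx K κ' N' := fun u hu => 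
  ⟨fun ξ hξ => (mul_le_mul_of_nonneg_right h1 (norm_nonneg _)).trans (hu.1 ξ hξ), hu.2.trans h2⟩

/-- `f` is a bounded Lipschitz extension of the vector field -/
structure Fld (K : Set V) (R : V → V) (F : V → ℝ) (κ N : ℝ) (L M : ℝ) (f : V × ℝ → V × ℝ) : Prop where
  nn : 0 ≤ L
  lip : ∀ x y, ‖f x - f y‖ ≤ L * ‖x - y‖
  bdd : ∀ x, ‖f x‖ ≤ M
  agree : ∀ x, x.1 ∈ Bx K κ N → f x = (R x.1, F x.1)

theorem exists_Fld (hK : IsProperConvexCone K) (hχ : IsTruncation χ) (PF : FParams K F) (PR : RParams K χ R) 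
    (hQ : PR.Q = 0) {κ N : ℝ} (hκ : 0 < κ) (hne : (Bx K κ N).Nonempty) : 
    ∃ L M f, Fld K R F κ N L M f := by
  have hN : 0 ≤ N := by obtain ⟨u, hu⟩ := hne; exact (norm_nonneg _).trans hu.2
  obtain ⟨P, p1, p2, p3⟩ := exists_proj hne Bx.isClosed Bx.convex
  obtain ⟨L1, hL1, l1⟩ := R_lip hK hχ PR hQ hκ hN
  obtain ⟨L2, hL2, l2⟩ := F_lip PF (N := N) hκ
  obtain ⟨M1, hM1, m1⟩ := R_bdd hK hχ PR hQ N hN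
  obtain ⟨M2, hM2, m2⟩ := F_bdd PF N hN
  refine ⟨max L1 L2, max M1 M2, fun x => (R (P x.1), F (P x.1)), le_max_of_le_left hL1, fun x y => ?_, 
    fun x => ?_, fun x hx => by rw [p2 _ hx]⟩
  · have h0 : ‖P x.1 - P y.1‖ ≤ ‖x - y‖ := (p3 _ _).trans (norm_fst_le (x - y))
    rw [Prod.mk_sub_mk, Prod.norm_mk]
    refine max_le ((l1 _ (p1 _) _ (p1 _)).trans ?_) ((l2 _ (p1 _) _ (p1 _)).trans ?_)
    · exact mul_le_mul (le_max_left _ _) h0 (norm_nonneg _) (le_max_of_le_left hL1)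
    · exact mul_le_mul (le_max_right _ _) h0 (norm_nonneg _) (le_max_of_le_left hL1)
  · rw [Prod.norm_mk]
    exact max_le_max (m1 _ (Bx.dual hκ (p1 _)) (p1 _).2) (m2 _ (Bx.dual hκ (p1 _)) (p1 _).2)

theorem Sch.int (hK : IsProperConvexCone K) {e : V} {c : ℝ} (hc : 0 < c) (he : ∀ x ∈ K, c * ‖x‖ ≤ ⟪e, x⟫) 
    {C N ε h : ℝ} (hC : 0 ≤ C) (hh : 0 ≤ h) {S : V → V} {Φ : V → ℝ} (hS : Sch K e R F C N ε h S Φ) {u : V} 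
    (hu : u ∈ interior (dualCone K)) : S u ∈ interior (dualCone K) := by
  obtain ⟨a, ha, hau⟩ := IsProperConvexCone.mem_int_iff.1 hu
  have hed : e ∈ interior (dualCone K) := IsProperConvexCone.mem_int_iff.2 ⟨c, hc, he⟩
  set s := min 1 (a / (‖e‖ + 1)) with hs
  have hs0 : 0 < s := by positivity
  have h1 : u - s • e ∈ dualCone K := mem_dual_iff.2 fun x hx => by
    rw [inner_sub_left, inner_smul_left, conj_trivial]
    have h1 := hau x hx
    have h2 : s * (‖e‖ + 1) ≤ a := by
      rw [← le_div_iff₀ (by positivity)]; exact min_le_right _ _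
    have h3 := mul_le_mul_of_nonneg_left (real_inner_le_norm e x) hs0.le
    nlinarith [norm_nonneg x, mul_le_mul_of_nonneg_right h2 (norm_nonneg x), mul_nonneg hs0.le (norm_nonneg x)]
  have h2 := hS.low u (int_sub_dual hu) s hs0.le (min_le_left _ _) h1
  have h3 : 0 < s * (1 + C * h)⁻¹ := by positivity
  have := int_add h2 (int_smul h3 hed)
  simpa using this

theorem Sch.iter_rep (hK : IsProperConvexCone K) {e : V} {c : ℝ} (hc : 0 < c) (he : ∀ x ∈ K, c * ‖x‖ ≤ ⟪e, x⟫) 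
    {C N ε h : ℝ} (hC : 0 ≤ C) (hh : 0 ≤ h) {S : V → V} {Φ : V → ℝ} (hS : Sch K e R F C N ε h S Φ) (n : ℕ) : 
    AffRep K (fun u => ∑ k ∈ Finset.range n, h * Φ (S^[k] u)) (S^[n]) := by
  induction n with
  | zero => 
    intro x hx
    refine (LRep.dirac hK hx).congr fun u _ => by simp
  | succ n ih => 
    have := AffRep.comp hK hS.rep ih (fun u hu => hS.int hK hc he hC hh hu)
    intro x hx
    refine (this x hx).congr fun u _ => ?_
    beta_reduce
    rw [Finset.sum_range_succ', Function.iterate_succ_apply]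
    simp only [Function.iterate_succ_apply, Function.iterate_zero, id]
    rw [add_comm]

theorem Sch.iter_low {e : V} 
    {C N ε h : ℝ} (hC : 0 ≤ C) (hh : 0 ≤ h) {S : V → V} {Φ : V → ℝ} (hS : Sch K e R F C N ε h S Φ) {u : V} 
    (hu : u ∈ dualCone K) {s₀ : ℝ} (hs : 0 ≤ s₀) (hs1 : s₀ ≤ 1) (h0 : u - s₀ • e ∈ dualCone K) (k : ℕ) :
    S^[k] u ∈ dualCone K ∧ S^[k] u - (s₀ * ((1 + C * h)⁻¹)^k) • e ∈ dualCone K := by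
  induction k with
  | zero => simpa using ⟨hu, h0⟩
  | succ k ih => 
    rw [Function.iterate_succ_apply', pow_succ, ← mul_assoc]
    have hle : (1 + C * h)⁻¹ ≤ 1 := inv_le_one_of_one_le₀ (by nlinarith [mul_nonneg hC hh])
    have hpos : 0 ≤ (1 + C * h)⁻¹ := by positivity
    exact ⟨hS.mem _ ih.1, hS.low _ ih.1 _ (by positivity) (mul_le_one₀ hs1 (by positivity) (pow_le_one₀ hpos hle)) ih.2⟩

theorem Sch.iter_up {e : V} 
    {C N ε h : ℝ} (hC : 0 ≤ C) (hh : 0 ≤ h) (hCh : C * h < 1) {S : V → V} {Φ : V → ℝ} 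
    (hS : Sch K e R F C N ε h S Φ) {u : V} 
    (hu : u ∈ dualCone K) {s₁ : ℝ} (hs : 0 ≤ s₁) (h0 : s₁ • e - u ∈ dualCone K) (k : ℕ) :
    S^[k] u ∈ dualCone K ∧ ((1 + s₁) * ((1 - C * h)⁻¹)^k - 1) • e - S^[k] u ∈ dualCone K := by
  induction k with
  | zero => simpa using ⟨hu, h0⟩
  | succ k ih => 
    rw [Function.iterate_succ_apply', pow_succ, ← mul_assoc]
    have hle : 1 ≤ (1 - C * h)⁻¹ := (one_le_inv₀ (by linarith)).2 (by linarith [mul_nonneg hC hh])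
    have h1 : 1 ≤ (1 + s₁) * ((1 - C * h)⁻¹)^k := one_le_mul_of_one_le_of_one_le (by linarith) (one_le_pow₀ hle)
    have := hS.up _ ih.1 _ (by linarith) ih.2
    rw [add_sub_cancel] at this
    exact ⟨hS.mem _ ih.1, this⟩

theorem Sch.iter_box {e : V} (hed : e ∈ dualCone K) {c Cn : ℝ} (hc : 0 < c) (he : ∀ x ∈ K, c * ‖x‖ ≤ ⟪e, x⟫) 
    (hCn0 : 0 < Cn) (hCn : ∀ (v : V) (a : ℝ), 0 ≤ a → (∀ x ∈ K, |⟪v, x⟫| ≤ a * ‖x‖) → ‖v‖ ≤ Cn * a)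
    {C N ε h T : ℝ} (hC : 0 ≤ C) (hh : 0 ≤ h) (hCh : 2 * (C * h) < 1) {S : V → V} {Φ : V → ℝ} 
    (hS : Sch K e R F C N ε h S Φ) {u : V} (hu : u ∈ dualCone K) 
    {s₀ : ℝ} (hs : 0 ≤ s₀) (hs1 : s₀ ≤ 1) (h0 : u - s₀ • e ∈ dualCone K) 
    {s₁ : ℝ} (hs1 : 0 ≤ s₁) (h1 : s₁ • e - u ∈ dualCone K) (k : ℕ) (hkT : k * h ≤ T) :
    S^[k] u ∈ Bx K (s₀ * Real.exp (-(C * T)) * c) (Cn * ((1 + s₁) * Real.exp (2 * C * T) * ‖e‖)) := by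
  have hCh0 := mul_nonneg hC hh
  obtain ⟨l0, l1⟩ := hS.iter_low hC hh hu hs (by assumption) h0 k
  obtain ⟨-, l2⟩ := hS.iter_up hC hh (by linarith) hu hs1 h1 k
  have b1 : Real.exp (-(C * T)) ≤ ((1 + C * h)⁻¹)^k := by
    have : (1 + C * h)^k ≤ Real.exp (C * T) := by
      calc (1 + C * h)^k ≤ (Real.exp (C * h))^k := 
            pow_le_pow_left₀ (by positivity) (by linarith [Real.add_one_le_exp (C * h)]) k
        _ = Real.exp (C * (k * h)) := by rw [← Real.exp_nat_mul]; congr 1; ring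
        _ ≤ Real.exp (C * T) := Real.exp_le_exp.2 (mul_le_mul_of_nonneg_left hkT hC)
    rw [Real.exp_neg, inv_pow]
    exact inv_anti₀ (by positivity) this
  have b2 : ((1 - C * h)⁻¹)^k ≤ Real.exp (2 * C * T) := by
    have q : (1 - C * h)⁻¹ ≤ Real.exp (2 * (C * h)) := by
      rw [inv_le_comm₀ (by linarith) (Real.exp_pos _), ← Real.exp_neg]
      have g1 : Real.exp (-(2 * (C * h))) ≤ (1 + 2 * (C * h))⁻¹ := by
        rw [Real.exp_neg]
        exact inv_anti₀ (by positivity) (by linarith [Real.add_one_le_exp (2 * (C * h))])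
      refine g1.trans ?_
      rw [inv_le_iff_one_le_mul₀ (by positivity)]
      nlinarith
    calc ((1 - C * h)⁻¹)^k ≤ (Real.exp (2 * (C * h)))^k := 
            pow_le_pow_left₀ (inv_nonneg.2 (by linarith)) q k
        _ = Real.exp (2 * C * (k * h)) := by rw [← Real.exp_nat_mul]; congr 1; ring
        _ ≤ Real.exp (2 * C * T) := Real.exp_le_exp.2 (mul_le_mul_of_nonneg_left hkT (by positivity))
  refine ⟨fun x hx => ?_, hCn _ _ (by positivity) fun x hx => ?_⟩
  · have g1 := mem_dual_iff.1 l1 x hx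
    rw [inner_sub_left, inner_smul_left, conj_trivial] at g1
    have g2 := he x hx
    have g3 := mem_dual_iff.1 hed x hx
    calc s₀ * Real.exp (-(C * T)) * c * ‖x‖ = s₀ * Real.exp (-(C * T)) * (c * ‖x‖) := by ring
      _ ≤ s₀ * ((1 + C * h)⁻¹)^k * ⟪e, x⟫ := by gcongr
      _ ≤ _ := by linarith
  · have g1 := mem_dual_iff.1 l2 x hx
    rw [inner_sub_left, inner_smul_left, conj_trivial] at g1
    have g3 := mem_dual_iff.1 hed x hx
    rw [abs_of_nonneg (mem_dual_iff.1 l0 x hx)]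
    calc ⟪S^[k] u, x⟫ ≤ ((1 + s₁) * ((1 - C * h)⁻¹)^k) * ⟪e, x⟫ := by linarith
      _ ≤ (1 + s₁) * Real.exp (2 * C * T) * (‖e‖ * ‖x‖) := by 
        gcongr
        exact real_inner_le_norm _ _
      _ = _ := by ring

end Flow


section Flow2
variable {K : Set V} {χ : V → V} {F : V → ℝ} {R : V → V}

/-- `A i t` are affine approximations converging to solutions of the Riccati equations -/
structure Conv (K : Set V) (R : V → V) (F : V → ℝ) (A : ℕ → ℝ → V → V × ℝ) (Nb : ℝ → ℝ → ℝ) : Prop where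
  mono : ∀ a b T, a ≤ b → Nb a T ≤ Nb b T
  rep : ∀ i t, 0 ≤ t → AffRep K (fun u => (A i t u).2) (fun u => (A i t u).1)
  conv : ∀ v ∈ interior (dualCone K), ∀ T : ℝ, 0 ≤ T → ∃ κ : ℝ, 0 < κ ∧ v ∈ Bx K κ (Nb ‖v‖ T) ∧ 
    ∀ κ' N', 0 < κ' → κ' ≤ κ → Nb ‖v‖ T ≤ N' → ∀ L M f, Fld K R F κ' N' L M f → ∀ t, 0 ≤ t → t ≤ T → 
    ∀ y : ℝ → V × ℝ, y 0 = (v, 0) → (∀ s ∈ Icc 0 t, HasDerivWithinAt y (f (y s)) (Icc 0 t) s) → 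
    Tendsto (fun i => A i t v) atTop (𝓝 (y t)) ∧ (y t).1 ∈ Bx K κ' N'

theorem exists_Conv (hK : IsProperConvexCone K) (hχ : IsTruncation χ) (PF : FParams K F) (PR : RParams K χ R) 
    (hadm : PR.Admissible) (hQ : PR.Q = 0) : ∃ A Nb, Conv K R F A Nb := by
  obtain ⟨e, c, hc, he⟩ := hK.exists_e
  have hei : e ∈ interior (dualCone K) := IsProperConvexCone.mem_int_iff.2 ⟨c, hc, he⟩
  have hed := int_sub_dual hei
  obtain ⟨C, hC, hSch⟩ := exists_Sch hK hχ PF PR hadm hQ hc he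
  obtain ⟨Cn, hCn0, hCn⟩ := hK.exists_normbd
  choose n S Φ hn hnε hnC hS using fun (i : ℕ) (t : ℝ) => 
    hSch i ((i:ℝ) + 1)⁻¹ |t| (by positivity) (by positivity) (abs_nonneg t)
  have hh0 : ∀ i t, 0 ≤ |t| / (n i t : ℝ) := fun i t => by positivity
  refine ⟨fun i t u => ((S i t)^[n i t] u, ∑ k ∈ Finset.range (n i t), |t| / (n i t) * Φ i t ((S i t)^[k] u)), 
    fun r T => Cn * ((1 + r / c) * Real.exp (2 * C * T) * ‖e‖), fun a b T hab => by gcongr,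
    fun i t ht => (hS i t).iter_rep hK hc he hC (hh0 i t) _, fun v hv T hT => ?_⟩
  obtain ⟨a, ha, hav⟩ := IsProperConvexCone.mem_int_iff.1 hv
  have hvd := int_sub_dual hv
  set s₀ := min 1 (a / (‖e‖ + 1)) with hs
  have hs0 : 0 < s₀ := by positivity
  have hsl : v - s₀ • e ∈ dualCone K := mem_dual_iff.2 fun x hx => by
    rw [inner_sub_left, inner_smul_left, conj_trivial]
    have h1 := hav x hx
    have h2 : s₀ * (‖e‖ + 1) ≤ a := by
      rw [← le_div_iff₀ (by positivity)]; exact min_le_right _ _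
    have h3 := mul_le_mul_of_nonneg_left (real_inner_le_norm e x) hs0.le
    nlinarith [norm_nonneg x, mul_le_mul_of_nonneg_right h2 (norm_nonneg x), mul_nonneg hs0.le (norm_nonneg x)]
  set s₁ := ‖v‖ / c with hs1
  have hs10 : 0 ≤ s₁ := by positivity
  have hsu : s₁ • e - v ∈ dualCone K := mem_dual_iff.2 fun x hx => by
    rw [inner_sub_left, inner_smul_left, conj_trivial]
    have h1 := mul_le_mul_of_nonneg_left (he x hx) hs10
    have h2 := real_inner_le_norm v x
    have h3 : s₁ * (c * ‖x‖) = ‖v‖ * ‖x‖ := by rw [hs1]; field_simp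
    linarith
  have hbox : ∀ i t, 0 ≤ t → t ≤ T → ∀ k ≤ n i t, (S i t)^[k] v ∈ 
      Bx K (s₀ * Real.exp (-(C * T)) * c) (Cn * ((1 + s₁) * Real.exp (2 * C * T) * ‖e‖)) := by
    intro i t ht htT k hk
    refine (hS i t).iter_box hed hc he hCn0 hCn hC (hh0 i t) (hnC i t) hvd hs0.le (min_le_left _ _) hsl hs10 hsu k ?_
    have h1 : (0:ℝ) < n i t := by exact_mod_cast hn i t
    have h2 : (k:ℝ) ≤ n i t := by exact_mod_cast hk
    rw [abs_of_nonneg ht]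
    calc (k:ℝ) * (t / n i t) ≤ n i t * (t / n i t) := by gcongr
      _ = t := by field_simp
      _ ≤ T := htT
  refine ⟨s₀ * Real.exp (-(C * T)) * c, by positivity, 
    by simpa using hbox 0 0 le_rfl hT 0 (Nat.zero_le _), ?_⟩
  intro κ' N' hκ' hκ hN L M f hf t ht htT y hy0 hy
  have hM0 : 0 ≤ M := (norm_nonneg _).trans (hf.bdd 0)
  have hbox' : ∀ i, ∀ k ≤ n i t, (S i t)^[k] v ∈ Bx K κ' N' := fun i k hk => 
    Bx.mono hκ hN (hbox i t ht htT k hk)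
  have hten : Tendsto (fun i : ℕ => ((S i t)^[n i t] v, 
      ∑ k ∈ Finset.range (n i t), |t| / (n i t) * Φ i t ((S i t)^[k] v))) atTop (𝓝 (y t)) := by
    rw [tendsto_iff_norm_sub_tendsto_zero]
    have hz : Tendsto (fun i : ℕ => t * (2 * ((i:ℝ) + 1)⁻¹ + L * M * ((i:ℝ) + 1)⁻¹) * Real.exp (L * t)) 
        atTop (𝓝 0) := by
      have h0 : Tendsto (fun i : ℕ => ((i:ℝ) + 1)⁻¹) atTop (𝓝 0) := by
        simpa using tendsto_one_div_add_atTop_nhds_zero_nat (𝕜 := ℝ)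
      have := (((h0.const_mul 2).add (h0.const_mul (L * M))).const_mul t).mul_const (Real.exp (L * t))
      simpa using this
    refine squeeze_zero' (Eventually.of_forall fun i => norm_nonneg _) ?_ hz
    filter_upwards [eventually_ge_atTop ⌈N'⌉₊] with i hi
    have hiN : N' ≤ i := (Nat.le_ceil _).trans (by exact_mod_cast hi)
    have hε0 : 0 ≤ ((i:ℝ) + 1)⁻¹ := by positivity
    have key := euler_err (a := fun m => ((S i t)^[m] v, 
        ∑ k ∈ Finset.range m, |t| / (n i t) * Φ i t ((S i t)^[k] v))) 
      (h := |t| / n i t) (η := 2 * ((i:ℝ) + 1)⁻¹) hf.nn hf.lip hf.bdd ht hy (hn i t) 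
      (by rw [abs_of_nonneg ht]) (by simp [hy0]) (by positivity) ?_
    · refine key.trans ?_
      have := hnε i t
      have h2 := mul_le_mul_of_nonneg_left this (mul_nonneg hf.nn hM0)
      refine mul_le_mul_of_nonneg_right (mul_le_mul_of_nonneg_left ?_ ht) (Real.exp_nonneg _)
      linarith
    · intro k hk
      beta_reduce
      have b1 := hbox' i k hk.le
      have b2 := hbox' i (k+1) hk
      rw [hf.agree _ b1]
      rw [Function.iterate_succ_apply'] at b2 ⊢
      rw [Finset.sum_range_succ]
      obtain ⟨c1, c2⟩ := (hS i t).close _ (Bx.dual hκ' b1) (b1.2.trans hiN) (b2.2.trans hiN)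
      rw [Prod.mk_sub_mk, Prod.smul_mk, Prod.mk_sub_mk, Prod.norm_mk]
      refine max_le c1 ?_
      rw [add_sub_cancel_left, smul_eq_mul, ← mul_sub, Real.norm_eq_abs, abs_mul, abs_of_nonneg (hh0 i t)]
      refine mul_le_mul_of_nonneg_left (c2.trans (by linarith)) (hh0 i t)
  refine ⟨hten, ?_⟩
  have h1 := (continuous_fst.tendsto _).comp hten
  exact Bx.isClosed.mem_of_tendsto h1 (Eventually.of_forall fun i => hbox' i _ le_rfl)

theorem exists_z (hK : IsProperConvexCone K) (hχ : IsTruncation χ) (PF : FParams K F) (PR : RParams K χ R) 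
    (hQ : PR.Q = 0) {A : ℕ → ℝ → V → V × ℝ} {Nb : ℝ → ℝ → ℝ} (hA : Conv K R F A Nb) {v : V} (hv : v ∈ interior (dualCone K)) :
    ∃ z : ℝ → V × ℝ, z 0 = (v, 0) ∧ (∀ t, 0 ≤ t → Tendsto (fun i => A i t v) atTop (𝓝 (z t))) ∧ 
      (∀ t, 0 ≤ t → HasDerivWithinAt z (R (z t).1, F (z t).1) (Ici 0) t) ∧ 
      (∀ T, 0 ≤ T → ∃ κ : ℝ, 0 < κ ∧ ∀ t, 0 ≤ t → t ≤ T → (z t).1 ∈ Bx K κ (Nb ‖v‖ T)) := by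
  have ex : ∀ T : ℝ, ∃ y : ℝ → V × ℝ, 0 ≤ T → y 0 = (v, 0) ∧ ∃ κ : ℝ, 0 < κ ∧ 
      ∀ t, 0 ≤ t → t ≤ T → Tendsto (fun i => A i t v) atTop (𝓝 (y t)) ∧ (y t).1 ∈ Bx K κ (Nb ‖v‖ T) ∧ 
        HasDerivWithinAt y (R (y t).1, F (y t).1) (Icc 0 T) t := by
    intro T
    by_cases hT : 0 ≤ T
    swap
    · exact ⟨0, fun h => absurd h hT⟩
    obtain ⟨κ, hκ, hvB, H⟩ := hA.conv v hv T hT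
    obtain ⟨L, M, f, hf⟩ := exists_Fld hK hχ PF PR hQ hκ ⟨v, hvB⟩
    obtain ⟨y, hy0, hy⟩ := picard_global hf.nn hf.lip hf.bdd hT (v, (0:ℝ))
    refine ⟨y, fun _ => ⟨hy0, κ, hκ, fun t ht htT => ?_⟩⟩
    obtain ⟨h1, h2⟩ := H κ _ hκ le_rfl le_rfl L M f hf t ht htT y hy0 
      (fun s hs => (hy s ⟨hs.1, hs.2.trans htT⟩).mono (Icc_subset_Icc_right htT))
    refine ⟨h1, h2, ?_⟩
    rw [← hf.agree _ h2]
    exact hy t ⟨ht, htT⟩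
  choose Y hY using ex
  have hz : ∀ T, 0 ≤ T → ∀ t, 0 ≤ t → t ≤ T → Y (t+1) t = Y T t := by
    intro T hT t ht htT
    obtain ⟨-, κ, -, h⟩ := hY T hT
    obtain ⟨-, κ', -, h'⟩ := hY (t+1) (by linarith)
    exact tendsto_nhds_unique (h' t ht (by linarith)).1 (h t ht htT).1
  refine ⟨fun t => Y (t+1) t, ?_, ?_, ?_, ?_⟩
  · exact (hY (0+1) (by norm_num)).1
  · intro t ht
    obtain ⟨-, κ', -, h'⟩ := hY (t+1) (by linarith)
    exact (h' t ht (by linarith)).1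
  · intro t ht
    obtain ⟨-, κ', -, h'⟩ := hY (t+1) (by linarith)
    have h1 := (h' t ht (by linarith)).2.2
    have h2 : HasDerivWithinAt (fun t => Y (t+1) t) (R (Y (t+1) t).1, F (Y (t+1) t).1) (Icc 0 (t+1)) t := 
      h1.congr (fun s hs => hz (t+1) (by linarith) s hs.1 hs.2) rfl
    refine h2.mono_of_mem_nhdsWithin ?_
    rw [← Ici_inter_Iic]
    exact inter_mem_nhdsWithin _ (Iic_mem_nhds (by linarith))
  · intro T hT
    obtain ⟨-, κ, hκ, h⟩ := hY T hT
    refine ⟨κ, hκ, fun t ht htT => ?_⟩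
    beta_reduce
    rw [hz T hT t ht htT]
    exact (h t ht htT).2.1

theorem z_flow (hK : IsProperConvexCone K) (hχ : IsTruncation χ) (PF : FParams K F) (PR : RParams K χ R) 
    (hQ : PR.Q = 0) {A : ℕ → ℝ → V → V × ℝ} {Nb : ℝ → ℝ → ℝ} (hA : Conv K R F A Nb)
    {z : ℝ → V × ℝ}
    (hd : ∀ t, 0 ≤ t → HasDerivWithinAt z (R (z t).1, F (z t).1) (Ici 0) t) 
    (hB : ∀ T, 0 ≤ T → ∃ κ N : ℝ, 0 < κ ∧ ∀ t, 0 ≤ t → t ≤ T → (z t).1 ∈ Bx K κ N) {s t : ℝ} (hs : 0 ≤ s) 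
    (ht : 0 ≤ t) : Tendsto (fun i => A i t (z s).1) atTop (𝓝 (z (t + s) - (0, (z s).2))) := by
  obtain ⟨κ, N, hκ, hz⟩ := hB (t + s) (by linarith)
  have hzs := hz s hs (by linarith)
  obtain ⟨κ₂, hκ₂, hvB, H⟩ := hA.conv (z s).1 (IsProperConvexCone.mem_int_iff.2 ⟨κ, hκ, hzs.1⟩) t ht
  have hκ' : 0 < min κ κ₂ := lt_min hκ hκ₂
  obtain ⟨L, M, f, hf⟩ := exists_Fld hK hχ PF PR hQ (κ := min κ κ₂) (N := max N (Nb ‖(z s).1‖ t)) hκ' 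
    ⟨_, Bx.mono (min_le_right _ _) (le_max_right _ _) hvB⟩
  refine (H _ _ hκ' (min_le_right _ _) (le_max_right _ _) L M f hf t ht le_rfl 
    (fun τ => z (τ + s) - (0, (z s).2)) ?_ ?_).1
  · ext <;> simp
  · intro τ hτ
    have e1 : f (z (τ + s) - (0, (z s).2)) = (R (z (τ + s)).1, F (z (τ + s)).1) := by
      rw [hf.agree]
      · simp
      · simpa using Bx.mono (min_le_left _ _) (le_max_left _ _) (hz (τ + s) (by linarith [hτ.1]) (by linarith [hτ.2]))
    rw [e1]
    have h1 := hd (τ + s) (by linarith [hτ.1])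
    have h2 : HasDerivWithinAt (fun τ : ℝ => τ + s) 1 (Icc 0 t) τ := (hasDerivWithinAt_id τ _).add_const s
    have h3 := HasDerivWithinAt.scomp τ h1 h2 (fun r hr => by simp only [mem_Ici]; linarith [hr.1])
    rw [one_smul] at h3
    exact h3.sub_const _

end Flow2


section Final
variable {K : Set V} {χ : V → V} {F : V → ℝ} {R : V → V}

theorem LapT_pos {μ : Measure V} (h : SP K μ) {u v : V} (hu : u ∈ dualCone K) (hv : 0 < LapT μ v) :
    0 < LapT μ u := by
  have := h.fin
  have hne : NeZero μ := ⟨fun h0 => by simp [LapT, h0] at hv⟩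
  exact integral_exp_pos (h.int_exp hu)

/-- extension of an affine transform from the interior to the whole dual cone -/
structure AExt (K : Set V) (φ : V → ℝ) (ψ : V → V) (φ' : V → ℝ) (ψ' : V → V) (p : V → Measure V) : Prop where
  meas : Measurable p
  lap : ∀ u ∈ dualCone K, ∀ x ∈ K, LapT (p x) u = Real.exp (-φ' u - ⟪ψ' u, x⟫)
  eqφ : ∀ u ∈ interior (dualCone K), φ' u = φ u
  eqψ : ∀ u ∈ interior (dualCone K), ψ' u = ψ u
  cφ : ContinuousOn φ' (dualCone K)
  cψ : ContinuousOn ψ' (dualCone K)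
  nn : ∀ u ∈ dualCone K, 0 ≤ φ' u
  mem : ∀ u ∈ dualCone K, ψ' u ∈ dualCone K

theorem exists_AExt (hK : IsProperConvexCone K) {φ : V → ℝ} {ψ : V → V} (h : AffRep K φ ψ) 
    (hψ : ∀ u ∈ interior (dualCone K), ψ u ∈ dualCone K) :
    ∃ φ' ψ' p, (∀ x, SP K (p x)) ∧ AExt K φ ψ φ' ψ' p := by
  obtain ⟨p, hp, hpm, hpL⟩ := h.kernel hK
  obtain ⟨e, he⟩ := exists_int hK
  have hpos : ∀ u ∈ dualCone K, ∀ x ∈ K, 0 < LapT (p x) u := fun u hu x hx => 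
    LapT_pos (hp x) hu (v := e) (by rw [hpL x hx e he]; exact Real.exp_pos _)
  set g : V → V → ℝ := fun u x => -Real.log (LapT (p x) u) with hg
  have gc : ∀ x ∈ K, ContinuousOn (fun u => g u x) (dualCone K) := fun x hx => 
    ((hp x).LT_cont.log fun u hu => (hpos u hu x hx).ne').neg
  have gi : ∀ u ∈ interior (dualCone K), ∀ x ∈ K, g u x = φ u + ⟪ψ u, x⟫ := fun u hu x hx => by
    simp only [hg, hpL x hx u hu, Real.log_exp]; ring
  have g0 := hK.zero_mem
  have lim : ∀ u ∈ dualCone K, ∀ x ∈ K, 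
      Tendsto (fun j : ℕ => ⟪ψ (u + ((j:ℝ)+1)⁻¹ • e), x⟫) atTop (𝓝 (g u x - g u 0)) := by
    intro u hu x hx
    have h1 := (gc x hx u hu).tendsto.comp (tendsto_add_e_within hu he)
    have h2 := (gc 0 g0 u hu).tendsto.comp (tendsto_add_e_within hu he)
    refine (h1.sub h2).congr fun j => ?_
    simp only [Function.comp_def]
    rw [gi _ (add_e_int hu he j) x hx, gi _ (add_e_int hu he j) 0 g0, inner_zero_right]; ring
  have ex : ∀ u, ∃ w : V, u ∈ dualCone K → ∀ x ∈ K, ⟪w, x⟫ = g u x - g u 0 := by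
    intro u
    by_cases hu : u ∈ dualCone K
    · obtain ⟨w, hw⟩ := exists_vec hK (fun x => g u x - g u 0) (fun x hx y hy => by
        refine tendsto_nhds_unique (lim u hu _ (hK.add_mem hx hy)) ?_
        simp only [inner_add_right]
        exact (lim u hu x hx).add (lim u hu y hy)) (fun c hc x hx => by
        refine tendsto_nhds_unique (lim u hu _ (hK.smul_mem c hc x hx)) ?_
        simp only [inner_smul_right]
        exact (lim u hu x hx).const_mul c)
      exact ⟨w, fun _ => hw⟩
    · exact ⟨0, fun h => absurd h hu⟩
  choose ψ' hψ' using ex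
  refine ⟨fun u => g u 0, ψ', p, hp, hpm, ?_, ?_, ?_, gc 0 g0, ?_, ?_, ?_⟩
  · intro u hu x hx
    rw [hψ' u hu x hx]
    have : -g u 0 - (g u x - g u 0) = Real.log (LapT (p x) u) := by simp only [hg]; ring
    rw [this, Real.exp_log (hpos u hu x hx)]
  · intro u hu
    simp [gi u hu 0 g0]
  · intro u hu
    refine vec_ext hK fun x hx => ?_
    rw [hψ' u (int_sub_dual hu) x hx, gi u hu x hx, gi u hu 0 g0, inner_zero_right]; ring
  · intro u hu
    obtain ⟨n, a, b, ha, hb, hf⟩ := hK.exists_frame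
    have key : ∀ x ∈ K, Tendsto (fun v => |⟪ψ' v - ψ' u, x⟫|) (𝓝[dualCone K] u) (𝓝 0) := by
      intro x hx
      have h1 := ((gc x hx u hu).tendsto.sub (gc 0 g0 u hu).tendsto).sub_const (g u x - g u 0)
      rw [sub_self] at h1
      have h2 := h1.abs
      rw [abs_zero] at h2
      refine h2.congr' ?_
      filter_upwards [self_mem_nhdsWithin] with v hv
      rw [inner_sub_left, hψ' v hv x hx, hψ' u hu x hx]
    rw [ContinuousWithinAt, tendsto_iff_norm_sub_tendsto_zero]
    refine squeeze_zero (fun _ => norm_nonneg _) (fun v => hf _) ?_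
    have := tendsto_finset_sum (Finset.univ : Finset (Fin n)) (fun i _ => (key _ (ha i)).add (key _ (hb i)))
    simpa using this
  · intro u hu
    simp only [hg]
    rw [neg_nonneg]
    exact Real.log_nonpos (LapT_nonneg _) ((hp 0).LT_le_one hu)
  · intro u hu
    refine mem_dual_iff.2 fun x hx => ?_
    rw [hψ' u hu x hx]
    exact ge_of_tendsto' (lim u hu x hx) fun j => mem_dual_iff.1 (hψ _ (add_e_int hu he j)) x hx

/-- interior solution package -/
structure Sol (K : Set V) (R : V → V) (F : V → ℝ) (φ : ℝ → V → ℝ) (ψ : ℝ → V → V) : Prop where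
  rep : ∀ t, 0 ≤ t → AffRep K (φ t) (ψ t)
  int : ∀ t, 0 ≤ t → ∀ u ∈ interior (dualCone K), ψ t u ∈ interior (dualCone K)
  initφ : ∀ u ∈ interior (dualCone K), φ 0 u = 0
  initψ : ∀ u ∈ interior (dualCone K), ψ 0 u = u
  dφ : ∀ u ∈ interior (dualCone K), ∀ t, 0 ≤ t → HasDerivWithinAt (fun s => φ s u) (F (ψ t u)) (Ici 0) t
  dψ : ∀ u ∈ interior (dualCone K), ∀ t, 0 ≤ t → HasDerivWithinAt (fun s => ψ s u) (R (ψ t u)) (Ici 0) t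
  flowφ : ∀ u ∈ interior (dualCone K), ∀ s t, 0 ≤ s → 0 ≤ t → φ (t + s) u = φ t u + φ s (ψ t u)
  flowψ : ∀ u ∈ interior (dualCone K), ∀ s t, 0 ≤ s → 0 ≤ t → ψ (t + s) u = ψ s (ψ t u)
  bd : ∀ T r, 0 ≤ T → ∃ N, ∀ u ∈ interior (dualCone K), ‖u‖ ≤ r → ∀ t, 0 ≤ t → t ≤ T → ‖ψ t u‖ ≤ N

theorem exists_Sol (hK : IsProperConvexCone K) (hχ : IsTruncation χ) (PF : FParams K F) (PR : RParams K χ R) 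
    (hadm : PR.Admissible) (hQ : PR.Q = 0) : ∃ φ ψ, Sol K R F φ ψ := by
  obtain ⟨A, Nb, hA⟩ := exists_Conv hK hχ PF PR hadm hQ
  have ex : ∀ v : V, ∃ z : ℝ → V × ℝ, v ∈ interior (dualCone K) → z 0 = (v, 0) ∧ 
      (∀ t, 0 ≤ t → Tendsto (fun i => A i t v) atTop (𝓝 (z t))) ∧ 
      (∀ t, 0 ≤ t → HasDerivWithinAt z (R (z t).1, F (z t).1) (Ici 0) t) ∧ 
      (∀ T, 0 ≤ T → ∃ κ : ℝ, 0 < κ ∧ ∀ t, 0 ≤ t → t ≤ T → (z t).1 ∈ Bx K κ (Nb ‖v‖ T)) := by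
    intro v
    by_cases hv : v ∈ interior (dualCone K)
    · obtain ⟨z, hz⟩ := exists_z hK hχ PF PR hQ hA hv
      exact ⟨z, fun _ => hz⟩
    · exact ⟨0, fun h => absurd h hv⟩
  choose z hz using ex
  have hint : ∀ t, 0 ≤ t → ∀ u ∈ interior (dualCone K), (z u t).1 ∈ interior (dualCone K) := by
    intro t ht u hu
    obtain ⟨κ, hκ, h⟩ := (hz u hu).2.2.2 t ht
    exact IsProperConvexCone.mem_int_iff.2 ⟨κ, hκ, (h t ht le_rfl).1⟩
  have hflow : ∀ u ∈ interior (dualCone K), ∀ s t, 0 ≤ s → 0 ≤ t → 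
      z (z u t).1 s = z u (t + s) - (0, (z u t).2) := by
    intro u hu s t hs ht
    obtain ⟨h0, h1, h2, h3⟩ := hz u hu
    have f1 := z_flow hK hχ PF PR hQ hA h2 (fun T hT => by
      obtain ⟨κ, hκ, h⟩ := h3 T hT; exact ⟨κ, _, hκ, h⟩) ht hs
    have f2 := (hz (z u t).1 (hint t ht u hu)).2.1 s hs
    rw [add_comm t s]
    exact tendsto_nhds_unique f2 f1
  refine ⟨fun t u => (z u t).2, fun t u => (z u t).1, ?_, hint, ?_, ?_, ?_, ?_, ?_, ?_, ?_⟩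
  · intro t ht x hx
    refine LRep.limit hK (l := atTop) (g := fun i u => Real.exp (-(A i t u).2 - ⟪(A i t u).1, x⟫)) 
      (Eventually.of_forall fun i => hA.rep i t ht x hx) fun u hu => ?_
    have h1 := (hz u hu).2.1 t ht
    have c : Continuous fun q : V × ℝ => Real.exp (-q.2 - ⟪q.1, x⟫) := by fun_prop
    exact (c.tendsto _).comp h1
  · intro u hu; rw [(hz u hu).1]
  · intro u hu; rw [(hz u hu).1]
  · intro u hu t ht
    exact ((hz u hu).2.2.1 t ht).snd
  · intro u hu t ht
    exact ((hz u hu).2.2.1 t ht).fst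
  · intro u hu s t hs ht
    rw [hflow u hu s t hs ht]; simp
  · intro u hu s t hs ht
    rw [hflow u hu s t hs ht]; simp
  · intro T r hT
    refine ⟨Nb r T, fun u hu hur t ht htT => ?_⟩
    obtain ⟨κ, hκ, h⟩ := (hz u hu).2.2.2 T hT
    exact (h t ht htT).2.trans (hA.mono _ _ _ hur)

theorem Sol.lip (hK : IsProperConvexCone K) (hχ : IsTruncation χ) (PF : FParams K F) (PR : RParams K χ R) 
    (hQ : PR.Q = 0) {φ : ℝ → V → ℝ} {ψ : ℝ → V → V} (h : Sol K R F φ ψ) {T r : ℝ} (hT : 0 ≤ T) :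
    ∃ L : ℝ, 0 ≤ L ∧ ∀ u ∈ interior (dualCone K), ‖u‖ ≤ r → ∀ s ∈ Icc 0 T, ∀ t ∈ Icc 0 T, 
      ‖φ t u - φ s u‖ ≤ L * ‖t - s‖ ∧ ‖ψ t u - ψ s u‖ ≤ L * ‖t - s‖ := by
  obtain ⟨N, hN⟩ := h.bd T r hT
  obtain ⟨L1, h10, h1⟩ := F_bdd PF |N| (abs_nonneg _)
  obtain ⟨L2, h20, h2⟩ := R_bdd hK hχ PR hQ |N| (abs_nonneg _)
  refine ⟨max L1 L2, le_max_of_le_left h10, fun u hu hur s hs t ht => ?_⟩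
  have hb : ∀ τ ∈ Icc 0 T, ψ τ u ∈ dualCone K ∧ ‖ψ τ u‖ ≤ |N| := fun τ hτ => 
    ⟨int_sub_dual (h.int τ hτ.1 u hu), (hN u hu hur τ hτ.1 hτ.2).trans (le_abs_self _)⟩
  constructor
  · exact (convex_Icc 0 T).norm_image_sub_le_of_norm_hasDerivWithin_le (f := fun s => φ s u) 
      (fun τ hτ => (h.dφ u hu τ hτ.1).mono Icc_subset_Ici_self) 
      (fun τ hτ => (h1 _ (hb τ hτ).1 (hb τ hτ).2).trans (le_max_left _ _)) hs ht
  · exact (convex_Icc 0 T).norm_image_sub_le_of_norm_hasDerivWithin_le (f := fun s => ψ s u) 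
      (fun τ hτ => (h.dψ u hu τ hτ.1).mono Icc_subset_Ici_self) 
      (fun τ hτ => (h2 _ (hb τ hτ).1 (hb τ hτ).2).trans (le_max_right _ _)) hs ht

theorem joint_cont (hK : IsProperConvexCone K) {E : Type*} [NormedAddCommGroup E] {g : ℝ → V → E} 
    (hc : ∀ t, 0 ≤ t → ContinuousOn (g t) (dualCone K)) 
    (hl : ∀ T r : ℝ, 0 ≤ T → ∃ L : ℝ, 0 ≤ L ∧ ∀ u ∈ interior (dualCone K), ‖u‖ ≤ r → 
      ∀ s ∈ Icc 0 T, ∀ t ∈ Icc 0 T, ‖g t u - g s u‖ ≤ L * ‖t - s‖) :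
    ContinuousOn (fun q : ℝ × V => g q.1 q.2) (Ici (0:ℝ) ×ˢ dualCone K) := by
  obtain ⟨e, he⟩ := exists_int hK
  rintro ⟨t₀, u₀⟩ ⟨ht₀, hu₀⟩
  simp only [mem_Ici] at ht₀ hu₀
  obtain ⟨L, hL, H⟩ := hl (t₀ + 1) (‖u₀‖ + 1 + ‖e‖) (by linarith)
  have H' : ∀ u ∈ dualCone K, ‖u‖ ≤ ‖u₀‖ + 1 → ∀ s ∈ Icc 0 (t₀ + 1), ∀ t ∈ Icc 0 (t₀ + 1), 
      ‖g t u - g s u‖ ≤ L * ‖t - s‖ := by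
    intro u hu hur s hs t ht
    have l1 := (hc t ht.1 u hu).tendsto.comp (tendsto_add_e_within hu he)
    have l2 := (hc s hs.1 u hu).tendsto.comp (tendsto_add_e_within hu he)
    refine le_of_tendsto' (l1.sub l2).norm fun j => ?_
    refine H _ (add_e_int hu he j) ?_ s hs t ht
    refine (norm_add_le _ _).trans (add_le_add hur ?_)
    rw [norm_smul, Real.norm_of_nonneg (by positivity)]
    refine mul_le_of_le_one_left (norm_nonneg _) (inv_le_one_of_one_le₀ ?_)
    have : (0:ℝ) ≤ j := Nat.cast_nonneg j
    linarith
  have hcont : ContinuousOn (fun q : ℝ × V => g q.1 q.2) 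
      (Icc 0 (t₀ + 1) ×ˢ (dualCone K ∩ Metric.closedBall 0 (‖u₀‖ + 1))) := by
    refine continuousOn_prod_of_continuousOn_lipschitzOnWith _ ⟨L, hL⟩ ?_ ?_
    · intro t ht
      exact (hc t ht.1).mono inter_subset_left
    · intro u hu
      refine LipschitzOnWith.of_dist_le_mul fun t ht s hs => ?_
      rw [dist_eq_norm, dist_eq_norm]
      exact H' u hu.1 (by simpa using hu.2) s hs t ht
  have hmem : ((t₀, u₀) : ℝ × V) ∈ Icc 0 (t₀ + 1) ×ˢ (dualCone K ∩ Metric.closedBall 0 (‖u₀‖ + 1)) := 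
    ⟨⟨ht₀, by simp⟩, hu₀, by simp⟩
  refine (hcont _ hmem).mono_of_mem_nhdsWithin ?_
  have hn : Iic (t₀ + 1) ×ˢ Metric.closedBall (0:V) (‖u₀‖ + 1) ∈ 𝓝 ((t₀, u₀) : ℝ × V) := by
    refine prod_mem_nhds (Iic_mem_nhds (by linarith)) ?_
    refine mem_of_superset (Metric.ball_mem_nhds u₀ one_pos) fun v hv => ?_
    rw [mem_ball_iff_norm] at hv
    rw [mem_closedBall_zero_iff]
    have := norm_sub_norm_le v u₀
    linarith
  filter_upwards [self_mem_nhdsWithin, mem_nhdsWithin_of_mem_nhds hn] with q h1 h2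
  exact ⟨⟨h1.1, h2.1⟩, h1.2, h2.2⟩

theorem main_aux (hK : IsProperConvexCone K) (hχ : IsTruncation χ) (PF : FParams K F) (PR : RParams K χ R) 
    (hadm : PR.Admissible) (hQ : PR.Q = 0) : 
    ∃ φ : ℝ → V → ℝ, ∃ ψ : ℝ → V → V,
      ContinuousOn (fun q : ℝ × V => φ q.1 q.2) (Set.Ici (0 : ℝ) ×ˢ dualCone K) ∧
      ContinuousOn (fun q : ℝ × V => ψ q.1 q.2) (Set.Ici (0 : ℝ) ×ˢ dualCone K) ∧
      (∀ t : ℝ, 0 ≤ t → ∀ u ∈ dualCone K, 0 ≤ φ t u ∧ ψ t u ∈ dualCone K) ∧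
      (∀ u ∈ interior (dualCone K),
        φ 0 u = 0 ∧ ψ 0 u = u ∧
        ∀ t : ℝ, 0 ≤ t →
          HasDerivWithinAt (fun s => φ s u) (F (ψ t u)) (Set.Ici (0 : ℝ)) t ∧
          HasDerivWithinAt (fun s => ψ s u) (R (ψ t u)) (Set.Ici (0 : ℝ)) t) ∧
      ∃ X : AffineTransitionFamily K φ ψ,
        ∀ Y : AffineTransitionFamily K φ ψ, ∀ t : ℝ, 0 ≤ t → ∀ x ∈ K,
          Y.p t x = X.p t x := by
  obtain ⟨φ₀, ψ₀, hS⟩ := exists_Sol hK hχ PF PR hadm hQ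
  have ex : ∀ t : ℝ, ∃ φ' ψ' p, (∀ x, SP K (p x)) ∧ (0 ≤ t → AExt K (φ₀ t) (ψ₀ t) φ' ψ' p) := by
    intro t
    by_cases ht : 0 ≤ t
    · obtain ⟨a, b, p, h1, h2⟩ := exists_AExt hK (hS.rep t ht) (fun u hu => int_sub_dual (hS.int t ht u hu))
      exact ⟨a, b, p, h1, fun _ => h2⟩
    · exact ⟨fun _ => 0, fun _ => 0, fun _ => 0, fun _ => SP.zero, fun h => absurd h ht⟩
  choose φ ψ p hp hE using ex
  have Cφ : ContinuousOn (fun q : ℝ × V => φ q.1 q.2) (Set.Ici (0 : ℝ) ×ˢ dualCone K) := by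
    refine joint_cont hK (fun t ht => (hE t ht).cφ) fun T r hT => ?_
    obtain ⟨L, hL, H⟩ := hS.lip hK hχ PF PR hQ (T := T) (r := r) hT
    refine ⟨L, hL, fun u hu hur s hs t ht => ?_⟩
    rw [(hE t ht.1).eqφ u hu, (hE s hs.1).eqφ u hu]
    exact (H u hu hur s hs t ht).1
  have Cψ : ContinuousOn (fun q : ℝ × V => ψ q.1 q.2) (Set.Ici (0 : ℝ) ×ˢ dualCone K) := by
    refine joint_cont hK (fun t ht => (hE t ht).cψ) fun T r hT => ?_
    obtain ⟨L, hL, H⟩ := hS.lip hK hχ PF PR hQ (T := T) (r := r) hT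
    refine ⟨L, hL, fun u hu hur s hs t ht => ?_⟩
    rw [(hE t ht.1).eqψ u hu, (hE s hs.1).eqψ u hu]
    exact (H u hu hur s hs t ht).2
  refine ⟨φ, ψ, Cφ, Cψ, fun t ht u hu => ⟨(hE t ht).nn u hu, (hE t ht).mem u hu⟩, fun u hu => ⟨?_, ?_, ?_⟩, ?_⟩
  · rw [(hE 0 le_rfl).eqφ u hu, hS.initφ u hu]
  · rw [(hE 0 le_rfl).eqψ u hu, hS.initψ u hu]
  · intro t ht
    rw [(hE t ht).eqψ u hu]
    exact ⟨(hS.dφ u hu t ht).congr (fun s hs => (hE s hs).eqφ u hu) ((hE t ht).eqφ u hu), 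
      (hS.dψ u hu t ht).congr (fun s hs => (hE s hs).eqψ u hu) ((hE t ht).eqψ u hu)⟩
  have hLap : ∀ t, 0 ≤ t → ∀ u ∈ interior (dualCone K), ∀ x ∈ K, 
      LapT (p t x) u = Real.exp (-φ₀ t u - ⟪ψ₀ t u, x⟫) := fun t ht u hu x hx => by
    rw [(hE t ht).lap u (int_sub_dual hu) x hx, (hE t ht).eqφ u hu, (hE t ht).eqψ u hu]
  have hcont : ∀ x ∈ K, ∀ u ∈ dualCone K, ContinuousOn (fun s => LapT (p s x) u) (Ici 0) := by
    intro x hx u hu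
    have c1 : ContinuousOn (fun s : ℝ => φ s u) (Ici 0) := 
      Cφ.comp (f := fun s : ℝ => (s, u)) (by fun_prop) (fun s hs => ⟨hs, hu⟩)
    have c2 : ContinuousOn (fun s : ℝ => ψ s u) (Ici 0) := 
      Cψ.comp (f := fun s : ℝ => (s, u)) (by fun_prop) (fun s hs => ⟨hs, hu⟩)
    have c3 : ContinuousOn (fun s : ℝ => Real.exp (-φ s u - ⟪ψ s u, x⟫)) (Ici 0) := by
      exact (c1.neg.sub (ContinuousOn.inner (𝕜 := ℝ) c2 continuousOn_const)).rexp
    exact c3.congr fun s hs => (hE s hs).lap u hu x hx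
  refine ⟨{ p := p
            measurable_p := fun t ht A hA => (Measure.measurable_coe hA).comp (hE t ht).meas
            subprob := fun t ht x hx => (hp t x).1
            supported := fun t ht x hx => (hp t x).2
            init := ?_
            chapman := ?_
            weakCont := ?_
            laplace := fun t ht u hu x hx => (hE t ht).lap u hu x hx }, ?_⟩
  · intro x hx
    refine LT_unique hK (hp 0 x) ⟨by simp, ?_⟩ fun u hu => ?_
    · rw [Measure.dirac_apply' _ hK.isClosed.measurableSet.compl]; simp [hx]
    · rw [hLap 0 le_rfl u hu x hx, hS.initφ u hu, hS.initψ u hu]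
      simp [LapT]
  · intro s t hs ht x hx A hA
    rw [← Measure.bind_apply hA (hE t ht).meas.aemeasurable]
    congr 1
    refine LT_unique hK (hp _ x) ((hp s x).bind hK (hp t) (hE t ht).meas) fun u hu => ?_
    rw [SP.LT_bind hK (hp s x) (hp t) (hE t ht).meas (int_sub_dual hu), hLap _ (by linarith) u hu x hx, 
      hS.flowφ u hu s t hs ht, hS.flowψ u hu s t hs ht]
    have e1 : ∫ η, LapT (p t η) u ∂(p s x) = ∫ η, Real.exp (-φ₀ t u) * Real.exp (-⟪ψ₀ t u, η⟫) ∂(p s x) := by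
      refine integral_congr_ae ?_
      filter_upwards [(hp s x).ae] with η hη
      rw [hLap t ht u hu η hη, ← Real.exp_add, sub_eq_add_neg]
    rw [e1, integral_const_mul]
    have e2 := hLap s hs _ (hS.int t ht u hu) x hx
    rw [LapT] at e2
    rw [e2, ← Real.exp_add]
    congr 1; ring
  · intro x hx f s hs
    exact weak_tendsto hK (fun s => hp s x) (hp s x) 
      (fun u hu => (hcont x hx u (int_sub_dual hu) s hs).tendsto) (hcont x hx 0 dual_zero s hs).tendsto f
  · intro Y t ht x hx
    refine LT_unique hK ⟨Y.subprob t ht x hx, Y.supported t ht x hx⟩ (hp t x) fun u hu => ?_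
    rw [(hE t ht).lap u (int_sub_dual hu) x hx]
    exact Y.laplace t ht u (int_sub_dual hu) x hx

end Final

/-- For `F` of form (F) and `R` of form (R) with admissible
parameters and `Q = 0`, there exist continuous `φ : ℝ₊ × K* → ℝ₊` and
`ψ : ℝ₊ × K* → K*` solving the generalized Riccati equations on `K̊*`, and a unique
affine family of transition kernels on `K` with associated functions `φ` and `ψ`. -/
theorem existence_pure_jump_affine
    {V : Type*} [NormedAddCommGroup V] [InnerProductSpace ℝ V] [FiniteDimensional ℝ V]
    [MeasurableSpace V] [BorelSpace V]
    (K : Set V) (hK : IsProperConvexCone K)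
    (χ : V → V) (hχ : IsTruncation χ)
    (F : V → ℝ) (R : V → V)
    (PF : FParams K F) (PR : RParams K χ R) (hadm : PR.Admissible)
    (hQ : PR.Q = 0) :
    ∃ φ : ℝ → V → ℝ, ∃ ψ : ℝ → V → V,
      ContinuousOn (fun q : ℝ × V => φ q.1 q.2) (Set.Ici (0 : ℝ) ×ˢ dualCone K) ∧
      ContinuousOn (fun q : ℝ × V => ψ q.1 q.2) (Set.Ici (0 : ℝ) ×ˢ dualCone K) ∧
      (∀ t : ℝ, 0 ≤ t → ∀ u ∈ dualCone K, 0 ≤ φ t u ∧ ψ t u ∈ dualCone K) ∧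
      (∀ u ∈ interior (dualCone K),
        φ 0 u = 0 ∧ ψ 0 u = u ∧
        ∀ t : ℝ, 0 ≤ t →
          HasDerivWithinAt (fun s => φ s u) (F (ψ t u)) (Set.Ici (0 : ℝ)) t ∧
          HasDerivWithinAt (fun s => ψ s u) (R (ψ t u)) (Set.Ici (0 : ℝ)) t) ∧
      ∃ X : AffineTransitionFamily K φ ψ,
        ∀ Y : AffineTransitionFamily K φ ψ, ∀ t : ℝ, 0 ≤ t → ∀ x ∈ K,
          Y.p t x = X.p t x := by
  exact main_aux hK hχ PF PR hadm hQ
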